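/- arXiv:2001.10917 — 2 statements merged into one kernel-verified Lean document; each statement's English description precedes it below -/
import Mathlib

section
/- Let d ≥ 3, let Σ be a d×d positive definite matrix with smallest eigenvalue σ_*² > 0, and Z ~ N(0,Σ). For A ∈ 𝓡 set h̃ = 1_A − P(Z ∈ A), and for s > 0 define T_s h̃(x) = E h̃(e^{−s} x + √(1 − e^{−2s}) Z) and ψ_t(x) = −∫_t^∞ T_s h̃(x) ds for t > 0. Then ψ_t solves ⟨Σ, Hess ψ_t(w)⟩_{H.S.} − w · ∇ψ_t(w) = T_t h̃(w), and there is an absolute constant C > 0 such that for all t > 0, all A ∈ 𝓡 and all x ∈ ℝ^d: ∑_{j=1}^d |∂_j ψ_t(x)| ≤ C σ_*^{−1} √(log d), ∑_{j,k=1}^d |∂_{jk} ψ_t(x)| ≤ C σ_*^{−2} (|log t| ∨ 1) log d, and ∑_{j,k,l=1}^d |∂_{jkl} ψ_t(x)| ≤ C σ_*^{−3} t^{−1/2} (log d)^{3/2}. -/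
open MeasureTheory ProbabilityTheory Real Matrix

noncomputable section

/-- Density of the centered Gaussian distribution `N(0, S)` on `ℝ^d`. -/
def gaussianPdf (d : ℕ) (S : Matrix (Fin d) (Fin d) ℝ) (x : Fin d → ℝ) : ℝ :=
  (2 * π) ^ (-(d : ℝ) / 2) * S.det ^ (-(1 : ℝ) / 2) *
    Real.exp (-(1 / 2) * (x ⬝ᵥ S⁻¹.mulVec x))

/-- The centered Gaussian distribution `N(0, S)` on `ℝ^d` (for positive definite `S`). -/
def gaussianMeasure (d : ℕ) (S : Matrix (Fin d) (Fin d) ℝ) : Measure (Fin d → ℝ) :=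
  volume.withDensity fun x => ENNReal.ofReal (gaussianPdf d S x)

/-- `A` is a hyperrectangle `∏ (a_j, b_j)` with `-∞ ≤ a_j ≤ b_j ≤ ∞`. -/
def IsHyperrectangle {d : ℕ} (A : Set (Fin d → ℝ)) : Prop :=
  ∃ a b : Fin d → EReal, A = {x | ∀ j, a j < (x j : EReal) ∧ (x j : EReal) < b j}

/-- `s ^ 2` is the smallest eigenvalue of `S`. -/
def IsSmallestEigenvalueSq {d : ℕ} (S : Matrix (Fin d) (Fin d) ℝ) (s : ℝ) : Prop :=
  IsLeast {r : ℝ | ∃ x : Fin d → ℝ, x ≠ 0 ∧ S.mulVec x = r • x} (s ^ 2)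

/-- Partial derivative `∂_j f` of a function on `ℝ^d`. -/
def pd {d : ℕ} (f : (Fin d → ℝ) → ℝ) (j : Fin d) (x : Fin d → ℝ) : ℝ :=
  fderiv ℝ f x (Pi.single j 1)

section

/-- Standard Gaussian product measure. -/
def stdPi (d : ℕ) : Measure (Fin d → ℝ) := Measure.pi (fun _ => gaussianReal 0 1)

instance (d : ℕ) : IsProbabilityMeasure (stdPi d) := by unfold stdPi; infer_instance

/-- The Gaussian measure as an image of Mathlib's one. -/
def mg (d : ℕ) (S : Matrix (Fin d) (Fin d) ℝ) : Measure (Fin d → ℝ) :=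
  (multivariateGaussian 0 S).map (WithLp.ofLp)

lemma measurable_ofLp' (d : ℕ) : Measurable (WithLp.ofLp : EuclideanSpace ℝ (Fin d) → (Fin d → ℝ)) := by
  fun_prop

instance (d : ℕ) (S : Matrix (Fin d) (Fin d) ℝ) : IsProbabilityMeasure (mg d S) := by
  unfold mg
  exact Measure.isProbabilityMeasure_map (measurable_ofLp' d).aemeasurable

lemma mg_one (d : ℕ) : mg d 1 = stdPi d := by
  unfold mg stdPi
  rw [multivariateGaussian_zero_one, ← map_pi_eq_stdGaussian,
    Measure.map_map (measurable_ofLp' d) (by fun_prop)]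
  exact Measure.map_id

lemma mvg_comb {d : ℕ} {S₁ S₂ S : Matrix (Fin d) (Fin d) ℝ} (h₁ : S₁.PosSemidef)
    (h₂ : S₂.PosSemidef) (h : S.PosSemidef) {α β c : ℝ}
    (he : α ^ 2 • S₁ + β ^ 2 • S₂ = c ^ 2 • S) :
    ((multivariateGaussian 0 S₁).prod (multivariateGaussian 0 S₂)).map
      (fun p => α • p.1 + β • p.2) = (multivariateGaussian 0 S).map (fun p => c • p) := by
  have e1 : ((multivariateGaussian 0 S₁).prod (multivariateGaussian 0 S₂)).map
      (fun p => α • p.1 + β • p.2) =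
      ((multivariateGaussian 0 S₁).map (fun p => α • p)) ∗
      ((multivariateGaussian 0 S₂).map (fun p => β • p)) := by
    unfold Measure.conv
    rw [Measure.map_prod_map _ _ (by fun_prop) (by fun_prop), Measure.map_map (by fun_prop) (by fun_prop)]
    rfl
  rw [e1]
  apply Measure.ext_of_charFun
  ext x
  have : IsFiniteMeasure ((multivariateGaussian 0 S₁).map (fun p => α • p)) := by
    exact Measure.isFiniteMeasure_map _ _
  have : IsFiniteMeasure ((multivariateGaussian 0 S₂).map (fun p => β • p)) := by
    exact Measure.isFiniteMeasure_map _ _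
  rw [charFun_conv, charFun_map_smul, charFun_map_smul, charFun_map_smul,
    charFun_multivariateGaussian h₁, charFun_multivariateGaussian h₂,
    charFun_multivariateGaussian h, ← Complex.exp_add]
  congr 1
  have h3 : α ^ 2 * (x.ofLp ⬝ᵥ S₁ *ᵥ x.ofLp) + β ^ 2 * (x.ofLp ⬝ᵥ S₂ *ᵥ x.ofLp)
      = c ^ 2 * (x.ofLp ⬝ᵥ S *ᵥ x.ofLp) := by
    have := congrArg (fun M : Matrix (Fin d) (Fin d) ℝ => x.ofLp ⬝ᵥ M *ᵥ x.ofLp) he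
    simpa [Matrix.add_mulVec, Matrix.smul_mulVec, dotProduct_add] using this
  have h4 : (α:ℂ) ^ 2 * (x.ofLp ⬝ᵥ S₁ *ᵥ x.ofLp : ℝ) + (β:ℂ) ^ 2 * (x.ofLp ⬝ᵥ S₂ *ᵥ x.ofLp : ℝ)
      = (c:ℂ) ^ 2 * (x.ofLp ⬝ᵥ S *ᵥ x.ofLp : ℝ) := by exact_mod_cast h3
  simp only [inner_zero_right, WithLp.ofLp_smul, Matrix.mulVec_smul, dotProduct_smul, smul_dotProduct, smul_eq_mul]
  push_cast
  linear_combination (-1/2) * h4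

lemma mg_comb {d : ℕ} {S₁ S₂ S : Matrix (Fin d) (Fin d) ℝ} (h₁ : S₁.PosSemidef)
    (h₂ : S₂.PosSemidef) (h : S.PosSemidef) {α β c : ℝ}
    (he : α ^ 2 • S₁ + β ^ 2 • S₂ = c ^ 2 • S) :
    ((mg d S₁).prod (mg d S₂)).map
      (fun p => α • p.1 + β • p.2) = (mg d S).map (fun p => c • p) := by
  unfold mg
  rw [Measure.map_prod_map _ _ (measurable_ofLp' d) (measurable_ofLp' d),
    Measure.map_map (by fun_prop) (by fun_prop), Measure.map_map (by fun_prop) (by fun_prop)]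
  have := congrArg (fun m => Measure.map (WithLp.ofLp) m) (mvg_comb h₁ h₂ h he)
  simp only at this
  rw [Measure.map_map (by fun_prop) (by fun_prop), Measure.map_map (by fun_prop) (by fun_prop)] at this
  exact this

/-- Integral form of the combination lemma. -/
lemma mg_comb_integral {d : ℕ} {S₁ S₂ S : Matrix (Fin d) (Fin d) ℝ} (h₁ : S₁.PosSemidef)
    (h₂ : S₂.PosSemidef) (h : S.PosSemidef) {α β c : ℝ}
    (he : α ^ 2 • S₁ + β ^ 2 • S₂ = c ^ 2 • S) {f : (Fin d → ℝ) → ℝ} (hf : Measurable f)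
    {K : ℝ} (hK : ∀ x, |f x| ≤ K) :
    ∫ z, ∫ z', f (α • z' + β • z) ∂(mg d S₁) ∂(mg d S₂) = ∫ z, f (c • z) ∂(mg d S) := by
  have e := mg_comb h₁ h₂ h he
  have h1 : ∫ z, f (c • z) ∂(mg d S) = ∫ y, f y ∂((mg d S).map (fun p => c • p)) := by
    rw [integral_map (by fun_prop) hf.aestronglyMeasurable]
  rw [h1, ← e, integral_map (by fun_prop) hf.aestronglyMeasurable, integral_prod_symm]
  refine Integrable.of_bound (C := K) ?_ (Filter.Eventually.of_forall fun x => hK _)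
  exact (hf.comp (by fun_prop)).aestronglyMeasurable

lemma stdPi_eq_withDensity (d : ℕ) : stdPi d = volume.withDensity
    (fun x : Fin d → ℝ => ENNReal.ofReal (∏ i, gaussianPDFReal 0 1 (x i))) := by
  unfold stdPi
  refine (Measure.pi_eq (fun s hs => ?_))
  rw [withDensity_apply _ (MeasurableSet.univ_pi hs), volume_pi, Measure.restrict_pi_pi,
    ← ofReal_integral_eq_lintegral_ofReal]
  · rw [integral_fintype_prod_eq_prod (𝕜 := ℝ) (fun i x => gaussianPDFReal 0 1 x),
      ENNReal.ofReal_prod_of_nonneg]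
    · congr 1
      ext i
      rw [gaussianReal_apply_eq_integral _ one_ne_zero]
    · intro i _
      exact integral_nonneg fun x => gaussianPDFReal_nonneg _ _ _
  · exact Integrable.fintype_prod (f := fun i x => gaussianPDFReal 0 1 x)
      (fun i => (integrable_gaussianPDFReal 0 1).restrict)
  · exact Filter.Eventually.of_forall fun x => Finset.prod_nonneg fun i _ => gaussianPDFReal_nonneg _ _ _

open scoped MatrixOrder in
lemma gaussianMeasure_eq_mg {d : ℕ} {S : Matrix (Fin d) (Fin d) ℝ} (hS : S.PosDef) :
    gaussianMeasure d S = mg d S := by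
  set B : Matrix (Fin d) (Fin d) ℝ := CFC.sqrt S with hB
  have hBB : B * B = S := CFC.sqrt_mul_sqrt_self _ hS.posSemidef.nonneg
  have hBT : Bᵀ = B := by
    have : IsSelfAdjoint B := (CFC.sqrt_nonneg S).isSelfAdjoint
    simpa [IsSelfAdjoint, Matrix.star_eq_conjTranspose] using this
  have hdet : B.det * B.det = S.det := by rw [← Matrix.det_mul, hBB]
  have hSd : 0 < S.det := hS.det_pos
  have hBd : B.det ≠ 0 := by
    intro h; rw [h] at hdet; simp at hdet; exact hSd.ne hdet
  have e1 : mg d S = (stdPi d).map (Matrix.toLin' B) := by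
    unfold mg multivariateGaussian stdPi
    rw [← map_pi_eq_stdGaussian, Measure.map_map (by fun_prop) (by fun_prop),
      Measure.map_map (by fun_prop) (by fun_prop)]
    congr 1
    ext x i
    simp [B]
  have hmeas : Measurable (Matrix.toLin' B) :=
    (LinearMap.continuous_of_finiteDimensional _).measurable
  have hmeasI : Measurable (Matrix.toLin' B⁻¹) :=
    (LinearMap.continuous_of_finiteDimensional _).measurable
  have hinv : ∀ x, Matrix.toLin' B⁻¹ (Matrix.toLin' B x) = x := by
    intro x
    simp [Matrix.toLin'_apply, Matrix.mulVec_mulVec, Matrix.nonsing_inv_mul B (isUnit_iff_ne_zero.2 hBd)]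
  have hSinv : S⁻¹ = B⁻¹ * B⁻¹ := by rw [← hBB, Matrix.mul_inv_rev]
  have hpdf : ∀ y, ENNReal.ofReal (gaussianPdf d S y) = ENNReal.ofReal |B.det⁻¹| *
      ENNReal.ofReal (∏ i, gaussianPDFReal 0 1 (Matrix.toLin' B⁻¹ y i)) := by
    intro y
    rw [← ENNReal.ofReal_mul (abs_nonneg _)]
    congr 1
    unfold gaussianPdf gaussianPDFReal
    have q : y ⬝ᵥ S⁻¹ *ᵥ y = ∑ i, (Matrix.toLin' B⁻¹ y i) ^ 2 := by
      have hBiT : (B⁻¹)ᵀ = B⁻¹ := by rw [Matrix.transpose_nonsing_inv, hBT]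
      rw [hSinv, ← Matrix.mulVec_mulVec, Matrix.dotProduct_mulVec, ← Matrix.mulVec_transpose, hBiT]
      simp [dotProduct, Matrix.toLin'_apply, sq]
    rw [q, Finset.prod_mul_distrib, ← Real.exp_sum]
    have hd1 : S.det ^ (-(1:ℝ)/2) = |B.det⁻¹| := by
      rw [← hdet, ← abs_mul_abs_self, abs_inv, neg_div, Real.rpow_neg (by positivity), ← Real.sqrt_eq_rpow,
        Real.sqrt_mul_self (abs_nonneg _)]
    have hd2 : (2 * π) ^ (-(d : ℝ) / 2) = ∏ i : Fin d, (√(2 * π * ((1 : NNReal) : ℝ)))⁻¹ := by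
      simp only [Finset.prod_const, Finset.card_univ, Fintype.card_fin, NNReal.coe_one, mul_one]
      rw [Real.sqrt_eq_rpow, ← Real.rpow_neg (by positivity), ← Real.rpow_natCast, ← Real.rpow_mul (by positivity)]
      congr 1; ring
    rw [hd1, hd2]
    have : (∑ i, -(Matrix.toLin' B⁻¹ y i - 0) ^ 2 / (2 * ((1 : NNReal) : ℝ))) = -(1/2) * ∑ i, (Matrix.toLin' B⁻¹ y i) ^ 2 := by
      rw [Finset.mul_sum]; congr 1; ext i; simp; ring
    rw [this]; ring
  rw [e1, stdPi_eq_withDensity]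
  unfold gaussianMeasure
  have gm : Measurable (fun x : Fin d → ℝ => ENNReal.ofReal (∏ i, gaussianPDFReal 0 1 (x i))) := by
    refine ENNReal.measurable_ofReal.comp ?_
    exact Finset.measurable_prod _ fun i _ => (measurable_gaussianPDFReal 0 1).comp (measurable_pi_apply i)
  ext s hs
  rw [Measure.map_apply hmeas hs, withDensity_apply _ hs, withDensity_apply _ (hmeas hs)]
  have hvol : (volume : Measure (Fin d → ℝ)) = ENNReal.ofReal |B.det| • Measure.map (Matrix.toLin' B) volume := by
    rw [Real.map_matrix_volume_pi_eq_smul_volume_pi hBd, smul_smul, ← ENNReal.ofReal_mul (abs_nonneg _), abs_inv,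
      mul_inv_cancel₀ (abs_ne_zero.2 hBd)]
    simp
  conv_lhs => rw [hvol]
  rw [Measure.restrict_smul, lintegral_smul_measure, setLIntegral_map hs _ hmeas]
  · simp_rw [hpdf, hinv]
    rw [lintegral_const_mul _ gm, smul_eq_mul, ← mul_assoc, ← ENNReal.ofReal_mul (abs_nonneg _), abs_inv,
      mul_inv_cancel₀ (abs_ne_zero.2 hBd)]
    simp
  · simp_rw [hpdf]
    exact (gm.comp hmeasI).const_mul _

lemma mg_integrable_norm_pow (d : ℕ) (S : Matrix (Fin d) (Fin d) ℝ) (n : ℕ) :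
    Integrable (fun z => ‖z‖ ^ n) (mg d S) := by
  have h := (IsGaussian.memLp_id (multivariateGaussian 0 S) n (by simp)).integrable_norm_pow'
  unfold mg
  rw [integrable_map_measure (by fun_prop) (by fun_prop)]
  refine h.mono' (by fun_prop) (Filter.Eventually.of_forall fun x => ?_)
  have : ‖WithLp.ofLp x‖ ≤ ‖x‖ := by
    simpa using (PiLp.lipschitzWith_ofLp 2 (fun _ : Fin d => ℝ)).norm_sub_le x 0
  simp only [Function.comp, norm_pow, norm_norm, id]
  gcongr

lemma mg_integrable_coord (d : ℕ) (S : Matrix (Fin d) (Fin d) ℝ) (i : Fin d) :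
    Integrable (fun z => z i) (mg d S) := by
  refine (mg_integrable_norm_pow d S 1).mono' (measurable_pi_apply i).aestronglyMeasurable (Filter.Eventually.of_forall fun x => ?_)
  simpa using norm_le_pi_norm x i

lemma mg_integrable_coord_mul (d : ℕ) (S : Matrix (Fin d) (Fin d) ℝ) (i j : Fin d) :
    Integrable (fun z => z i * z j) (mg d S) := by
  refine (mg_integrable_norm_pow d S 2).mono' (by fun_prop) (Filter.Eventually.of_forall fun x => ?_)
  rw [norm_mul, sq]
  exact mul_le_mul (norm_le_pi_norm x i) (norm_le_pi_norm x j) (norm_nonneg _) (norm_nonneg _)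

lemma mg_integral_coord (d : ℕ) (S : Matrix (Fin d) (Fin d) ℝ) (i : Fin d) :
    ∫ z, z i ∂(mg d S) = 0 := by
  unfold mg
  rw [integral_map (f := fun z : Fin d → ℝ => z i) (by fun_prop) (by exact (measurable_pi_apply i).aestronglyMeasurable)]
  have := ContinuousLinearMap.integral_comp_comm (EuclideanSpace.proj (𝕜 := ℝ) i)
    (IsGaussian.integrable_fun_id (μ := multivariateGaussian 0 S))
  simpa using this

lemma mg_integral_coord_mul {d : ℕ} {S : Matrix (Fin d) (Fin d) ℝ} (hS : S.PosSemidef) (i j : Fin d) :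
    ∫ z, z i * z j ∂(mg d S) = S i j := by
  have h := covariance_eval_multivariateGaussian (μ := 0) hS i j
  have h0 : ∀ i, ∫ x : EuclideanSpace ℝ (Fin d), x i ∂(multivariateGaussian 0 S) = 0 := by
    intro i
    have := mg_integral_coord d S i
    unfold mg at this
    rwa [integral_map (f := fun z : Fin d → ℝ => z i) (by fun_prop) (by exact (measurable_pi_apply i).aestronglyMeasurable)] at this
  unfold covariance at h
  simp only [h0, sub_zero] at h
  unfold mg
  rw [integral_map (by fun_prop) (by fun_prop)]
  exact h

end

section

/-- Gaussian cdf and its first derivatives. -/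
def gK : ℕ → ℝ → ℝ
  | 0, u => (gaussianReal 0 1).real (Set.Iic u)
  | 1, u => gaussianPDFReal 0 1 u
  | 2, u => - u * gaussianPDFReal 0 1 u
  | 3, u => (u ^ 2 - 1) * gaussianPDFReal 0 1 u
  | _ + 4, _ => 0

lemma pdf01 (u : ℝ) : gaussianPDFReal 0 1 u = (√(2 * π))⁻¹ * Real.exp (- u ^ 2 / 2) := by
  simp [gaussianPDFReal]

lemma hasDerivAt_pdf01 (u : ℝ) :
    HasDerivAt (gaussianPDFReal 0 1) (- u * gaussianPDFReal 0 1 u) u := by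
  have : gaussianPDFReal 0 1 = fun u => (√(2 * π))⁻¹ * Real.exp (- u ^ 2 / 2) := by
    ext u; exact pdf01 u
  rw [this]
  have h : HasDerivAt (fun u : ℝ => - u ^ 2 / 2) (-u) u := by
    have := ((hasDerivAt_pow 2 u).neg).div_const 2
    refine this.congr_deriv ?_
    push_cast; ring
  have := (h.exp).const_mul ((√(2 * π))⁻¹)
  refine this.congr_deriv ?_
  simp only; ring

lemma pdf01_cont : Continuous (gaussianPDFReal 0 1) :=
  continuous_iff_continuousAt.2 fun u => (hasDerivAt_pdf01 u).continuousAt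

lemma gK_zero_hasDerivAt (u : ℝ) : HasDerivAt (gK 0) (gK 1 u) u := by
  have e : gK 0 = fun u => gK 0 0 + ∫ x in (0:ℝ)..u, gaussianPDFReal 0 1 x := by
    ext v
    have h : ∀ v, gK 0 v = ∫ x in Set.Iic v, gaussianPDFReal 0 1 x := by
      intro v
      simp only [gK, Measure.real]
      rw [gaussianReal_apply_eq_integral _ one_ne_zero, ENNReal.toReal_ofReal]
      exact integral_nonneg fun x => gaussianPDFReal_nonneg _ _ _
    rw [h, h, ← intervalIntegral.integral_Iic_sub_Iic (integrable_gaussianPDFReal 0 1).integrableOn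
      (integrable_gaussianPDFReal 0 1).integrableOn]
    ring
  rw [e]
  refine HasDerivAt.const_add _ ?_
  exact intervalIntegral.integral_hasDerivAt_right
    ((integrable_gaussianPDFReal 0 1).intervalIntegrable)
    (pdf01_cont.stronglyMeasurableAtFilter _ _) pdf01_cont.continuousAt

lemma gK_hasDerivAt {m : ℕ} (hm : m ≤ 2) (u : ℝ) : HasDerivAt (gK m) (gK (m + 1) u) u := by
  interval_cases m
  · exact gK_zero_hasDerivAt u
  · exact hasDerivAt_pdf01 u
  · have := ((hasDerivAt_id u).neg).mul (hasDerivAt_pdf01 u)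
    refine this.congr_deriv ?_
    simp [gK]; ring

lemma gK_cont (m : ℕ) : Continuous (gK m) := by
  rcases m with _ | _ | _ | _ | m
  · exact continuous_iff_continuousAt.2 fun u => (gK_hasDerivAt (by norm_num) u).continuousAt
  · exact continuous_iff_continuousAt.2 fun u => (gK_hasDerivAt (by norm_num) u).continuousAt
  · exact continuous_iff_continuousAt.2 fun u => (gK_hasDerivAt (by norm_num) u).continuousAt
  · have : gK 3 = fun u => (u ^ 2 - 1) * gaussianPDFReal 0 1 u := by ext; rfl
    show Continuous (gK 3)
    rw [this]
    exact (by fun_prop : Continuous fun u : ℝ => u ^ 2 - 1).mul pdf01_cont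
  · exact continuous_const

lemma gK_zero_nonneg (u : ℝ) : 0 ≤ gK 0 u := measureReal_nonneg
lemma gK_zero_le_one (u : ℝ) : gK 0 u ≤ 1 := measureReal_le_one

lemma one_sub_gK (v : ℝ) : 1 - gK 0 v = (gaussianReal 0 1).real (Set.Ioi v) := by
  have := probReal_compl_eq_one_sub (μ := gaussianReal 0 1) (measurableSet_Iic (a := v))
  rw [Set.compl_Iic] at this
  rw [this]; rfl

instance : NullSingletonClass (gaussianReal 0 1) := nullSingletonClass_gaussianReal one_ne_zero

lemma gK_neg (v : ℝ) : gK 0 (-v) = 1 - gK 0 v := by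
  rw [one_sub_gK]
  have h : (gaussianReal 0 1).map (fun x => -x) = gaussianReal 0 1 := by
    rw [gaussianReal_map_neg]; simp
  simp only [gK, Measure.real]
  conv_lhs => rw [← h]
  rw [Measure.map_apply (by fun_prop) measurableSet_Iic]
  congr 1
  have : (fun x : ℝ => -x) ⁻¹' Set.Iic (-v) = Set.Ici v := by ext; simp
  rw [this]
  exact (measure_congr Ioi_ae_eq_Ici).symm

lemma gK_abs_neg {m : ℕ} (hm : 1 ≤ m) (v : ℝ) : |gK m (-v)| = |gK m v| := by
  have : gaussianPDFReal 0 1 (-v) = gaussianPDFReal 0 1 v := by simp [pdf01]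
  rcases m with _ | _ | _ | _ | m
  · omega
  · simp [gK, this]
  · simp [gK, this, abs_mul]
  · simp [gK, this]
  · simp [gK]

lemma mills {v : ℝ} (hv : 1 ≤ v) :
    gaussianPDFReal 0 1 v ≤ Real.exp (3 / 2) * v * (1 - gK 0 v) := by
  have hv0 : 0 < v := by linarith
  have h1 : (gaussianReal 0 1).real (Set.Ioc v (v + 1 / v)) ≤ 1 - gK 0 v := by
    rw [one_sub_gK]
    exact measureReal_mono Set.Ioc_subset_Ioi_self
  have h2 : (1 / v) * gaussianPDFReal 0 1 (v + 1 / v) ≤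
      (gaussianReal 0 1).real (Set.Ioc v (v + 1 / v)) := by
    simp only [Measure.real]
    rw [gaussianReal_apply_eq_integral _ one_ne_zero, ENNReal.toReal_ofReal
      (integral_nonneg fun x => gaussianPDFReal_nonneg _ _ _)]
    have : ∫ x in Set.Ioc v (v + 1 / v), gaussianPDFReal 0 1 (v + 1 / v) =
        (1 / v) * gaussianPDFReal 0 1 (v + 1 / v) := by
      rw [setIntegral_const]
      simp [Measure.real, hv0.le]
    rw [← this]
    refine setIntegral_mono_on (by simp) (integrable_gaussianPDFReal 0 1).integrableOn
      measurableSet_Ioc ?_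
    intro x hx
    rw [pdf01, pdf01]
    have : 0 < x := hv0.trans hx.1
    have h3 := hx.2
    gcongr
  have h3 : Real.exp (-(3/2)) * gaussianPDFReal 0 1 v ≤ gaussianPDFReal 0 1 (v + 1 / v) := by
    rw [pdf01, pdf01, mul_left_comm, ← Real.exp_add]
    gcongr
    have : (v + 1 / v) ^ 2 = v ^ 2 + 2 + (1 / v) ^ 2 := by field_simp; ring
    rw [this]
    have h4 : (1 / v) ^ 2 ≤ 1 := by
      have : 1 / v ≤ 1 := by rw [div_le_one hv0]; exact hv
      have h0 : 0 ≤ 1 / v := by positivity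
      nlinarith
    linarith
  have h5 : (1 / v) * (Real.exp (-(3/2)) * gaussianPDFReal 0 1 v) ≤ 1 - gK 0 v :=
    (mul_le_mul_of_nonneg_left h3 (by positivity)).trans (h2.trans h1)
  calc gaussianPDFReal 0 1 v = Real.exp (3 / 2) * v * ((1 / v) * (Real.exp (-(3/2)) * gaussianPDFReal 0 1 v)) := by
        rw [Real.exp_neg]; field_simp
    _ ≤ _ := by gcongr

lemma mul_exp_neg_le_one (x : ℝ) : x * Real.exp (-x) ≤ 1 := by
  have := Real.add_one_le_exp x
  rw [Real.exp_neg, ← div_eq_mul_inv, div_le_one (Real.exp_pos _)]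
  linarith

lemma pdf01_le (u : ℝ) : gaussianPDFReal 0 1 u ≤ Real.exp (-u ^ 2 / 2) := by
  rw [pdf01]
  have : (√(2 * π))⁻¹ ≤ 1 := by
    apply inv_le_one_of_one_le₀
    rw [Real.one_le_sqrt]
    have := Real.pi_gt_three
    linarith
  have h := Real.exp_pos (-u ^ 2 / 2)
  nlinarith

lemma gK_abs_le {m : ℕ} (hm : 1 ≤ m) (v : ℝ) : |gK m v| ≤ (1 + v ^ 2) * gaussianPDFReal 0 1 v := by
  have h0 := gaussianPDFReal_nonneg 0 1 v
  rcases m with _ | _ | _ | _ | m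
  · omega
  · simp only [gK, zero_add, abs_of_nonneg h0]
    nlinarith [sq_nonneg v]
  · simp only [gK, zero_add, abs_mul, abs_of_nonneg h0, abs_neg]
    gcongr
    rw [abs_le]; constructor <;> nlinarith [sq_nonneg (v-1), sq_nonneg (v+1)]
  · simp only [gK, zero_add, abs_mul, abs_of_nonneg h0]
    gcongr
    rw [abs_le]; constructor <;> nlinarith [sq_nonneg v]
  · simp only [gK, abs_zero]; positivity

lemma gK_abs_le' {m : ℕ} (hm : 1 ≤ m) {v : ℝ} (hv : 1 ≤ v) :
    |gK m v| ≤ v ^ (m - 1) * gaussianPDFReal 0 1 v := by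
  have h0 := gaussianPDFReal_nonneg 0 1 v
  rcases m with _ | _ | _ | _ | m
  · omega
  · simp [gK, abs_of_nonneg h0]
  · simp [gK, abs_mul, abs_of_nonneg h0, abs_of_nonneg (zero_le_one.trans hv)]
  · simp only [gK, zero_add, abs_mul, abs_of_nonneg h0]
    gcongr
    show |v ^ 2 - 1| ≤ v ^ 2
    rw [abs_le]; constructor <;> nlinarith [sq_nonneg v]
  · simp only [gK, abs_zero]; positivity

lemma gK_bound : ∃ K : ℝ, 0 < K ∧ ∀ m, 1 ≤ m → m ≤ 3 → ∀ L : ℝ, 1 ≤ L → ∀ v : ℝ,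
    |gK m v| ≤ K * (L ^ m * (1 - gK 0 v) + Real.exp (- L ^ 2)) := by
  set c := 1 - gK 0 1 with hc
  have hcpos : 0 < c := by
    have h := mills (le_refl (1:ℝ))
    have h1 := gaussianPDFReal_pos 0 1 (1:ℝ) one_ne_zero
    have h2 := h1.trans_le h
    rw [← hc] at h2
    have := Real.exp_pos (3/2)
    exact pos_of_mul_pos_right h2 (by positivity)
  refine ⟨3 / c + 8 * Real.exp (3/2) + 5, by positivity, ?_⟩
  intro m hm hm3 L hL v
  have hLm : 1 ≤ L ^ m := one_le_pow₀ hL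
  have hq : 0 ≤ 1 - gK 0 v := by linarith [gK_zero_le_one v]
  have hE := Real.exp_pos (-L ^ 2)
  have hX : 0 ≤ L ^ m * (1 - gK 0 v) := by positivity
  have hC := Real.exp_pos (3/2)
  have hD : 0 ≤ 3 / c := by positivity
  rcases le_or_gt v 1 with hv | hv
  · have h1 : |gK m v| ≤ 3 := by
      refine (gK_abs_le hm v).trans ?_
      have h2 : (1 + v ^ 2) * gaussianPDFReal 0 1 v ≤ (1 + v ^ 2) * Real.exp (-v ^ 2 / 2) := by
        gcongr; exact pdf01_le v
      have h3 := mul_exp_neg_le_one (v ^ 2 / 2)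
      have h4 : Real.exp (-v ^ 2 / 2) ≤ 1 := Real.exp_le_one_iff.2 (by nlinarith [sq_nonneg v])
      rw [neg_div] at h2 h4
      linarith
    have h2 : c ≤ 1 - gK 0 v := by
      have : gK 0 v ≤ gK 0 1 := measureReal_mono (Set.Iic_subset_Iic.2 hv)
      rw [hc]; linarith
    have h3 : c ≤ L ^ m * (1 - gK 0 v) := by nlinarith
    have h4 : 3 ≤ 3 / c * (L ^ m * (1 - gK 0 v)) := by
      calc (3:ℝ) = 3 / c * c := by field_simp
        _ ≤ _ := by gcongr
    nlinarith
  · rcases le_or_gt v (2 * L) with hvL | hvL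
    · have h1 := gK_abs_le' hm hv.le
      have h2 := mills hv.le
      have h3 : |gK m v| ≤ Real.exp (3/2) * v ^ m * (1 - gK 0 v) := by
        refine h1.trans ?_
        calc v ^ (m-1) * gaussianPDFReal 0 1 v ≤ v ^ (m-1) * (Real.exp (3 / 2) * v * (1 - gK 0 v)) := by
              gcongr
          _ = _ := by
              obtain ⟨k, rfl⟩ : ∃ k, m = k + 1 := ⟨m - 1, by omega⟩
              simp only [Nat.add_sub_cancel]; ring
      have h4 : v ^ m ≤ 8 * L ^ m := by
        calc v ^ m ≤ (2 * L) ^ m := by gcongr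
          _ = 2 ^ m * L ^ m := by ring
          _ ≤ 2 ^ 3 * L ^ m := by gcongr; norm_num
          _ = _ := by norm_num
      have h5 : |gK m v| ≤ 8 * Real.exp (3/2) * (L ^ m * (1 - gK 0 v)) := by
        refine h3.trans ?_
        calc Real.exp (3/2) * v ^ m * (1 - gK 0 v) ≤ Real.exp (3/2) * (8 * L ^ m) * (1 - gK 0 v) := by gcongr
          _ = _ := by ring
      nlinarith
    · have h1 : |gK m v| ≤ 5 * Real.exp (-L ^ 2) := by
        refine (gK_abs_le hm v).trans ?_
        have h2 : (1 + v ^ 2) * gaussianPDFReal 0 1 v ≤ (1 + v ^ 2) * Real.exp (-v ^ 2 / 2) := by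
          gcongr; exact pdf01_le v
        have h3 := mul_exp_neg_le_one (v ^ 2 / 4)
        have h4 : Real.exp (-(v ^ 2 / 4)) ≤ 1 := Real.exp_le_one_iff.2 (by nlinarith [sq_nonneg v])
        have h5 : Real.exp (-v ^ 2 / 2) = Real.exp (-(v ^ 2 / 4)) * Real.exp (-(v ^ 2 / 4)) := by
          rw [← Real.exp_add]; congr 1; ring
        have h6 : Real.exp (-(v ^ 2 / 4)) ≤ Real.exp (-L ^ 2) := by
          apply Real.exp_le_exp.2; nlinarith
        have h7 : (1 + v ^ 2) * Real.exp (-(v ^ 2 / 4)) ≤ 5 := by linarith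
        rw [h5, ← mul_assoc] at h2
        refine h2.trans ?_
        exact mul_le_mul h7 h6 (Real.exp_pos _).le (by norm_num)
      nlinarith

/-- cdf with extended endpoint. -/
def gE (m : ℕ) (b : EReal) (τ u : ℝ) : ℝ :=
  if b = ⊤ then (if m = 0 then 1 else 0) else if b = ⊥ then 0 else
    (-1) ^ m * gK m (b.toReal / τ - u)

/-- Probability of an interval and its derivatives. -/
def gP (m : ℕ) (a b : EReal) (τ u : ℝ) : ℝ :=
  if a < b then gE m b τ u - gE m a τ u else 0

lemma gE_hasDerivAt {m : ℕ} (hm : m ≤ 2) (b : EReal) (τ u : ℝ) :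
    HasDerivAt (gE m b τ) (gE (m + 1) b τ u) u := by
  unfold gE
  rw [if_neg (Nat.succ_ne_zero m)]
  split_ifs
  · exact hasDerivAt_const _ _
  · exact hasDerivAt_const _ _
  · exact hasDerivAt_const _ _
  · have h1 : HasDerivAt (fun u : ℝ => b.toReal / τ - u) (-1) u := by
      simpa using (hasDerivAt_id u).const_sub (b.toReal / τ)
    have := ((gK_hasDerivAt hm (b.toReal / τ - u)).comp u h1).const_mul ((-1) ^ m)
    refine this.congr_deriv ?_
    ring

lemma gP_hasDerivAt {m : ℕ} (hm : m ≤ 2) (a b : EReal) (τ u : ℝ) :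
    HasDerivAt (gP m a b τ) (gP (m + 1) a b τ u) u := by
  unfold gP
  split_ifs
  · exact (gE_hasDerivAt hm b τ u).sub (gE_hasDerivAt hm a τ u)
  · exact hasDerivAt_const _ _

lemma gE_contOn (m : ℕ) (b : EReal) :
    ContinuousOn (fun p : ℝ × ℝ => gE m b p.1 p.2) {p | 0 < p.1} := by
  unfold gE
  split_ifs
  · exact continuousOn_const
  · exact continuousOn_const
  · exact continuousOn_const
  · refine continuousOn_const.mul ((gK_cont m).comp_continuousOn ?_)
    refine ContinuousOn.sub (ContinuousOn.div continuousOn_const continuousOn_fst ?_) continuousOn_snd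
    intro p hp; exact (show 0 < p.1 from hp).ne'

lemma gP_contOn (m : ℕ) (a b : EReal) :
    ContinuousOn (fun p : ℝ × ℝ => gP m a b p.1 p.2) {p | 0 < p.1} := by
  unfold gP
  split_ifs
  · exact (gE_contOn m b).sub (gE_contOn m a)
  · exact continuousOn_const

lemma gE_meas (m : ℕ) (b : EReal) : Measurable (fun p : ℝ × ℝ => gE m b p.1 p.2) := by
  unfold gE
  split_ifs
  · exact measurable_const
  · exact measurable_const
  · exact measurable_const
  · exact ((gK_cont m).measurable.comp (by fun_prop)).const_mul _

lemma gP_meas (m : ℕ) (a b : EReal) : Measurable (fun p : ℝ × ℝ => gP m a b p.1 p.2) := by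
  unfold gP
  split_ifs
  · exact (gE_meas m b).sub (gE_meas m a)
  · exact measurable_const

lemma gE_lt (b : EReal) {τ : ℝ} (hτ : 0 < τ) (u : ℝ) :
    (gaussianReal 0 1).real {v : ℝ | ((τ * (u + v) : ℝ) : EReal) < b} = gE 0 b τ u := by
  unfold gE
  induction b with
  | bot => simp
  | top => simp [EReal.coe_lt_top, -EReal.coe_mul, -EReal.coe_add]
  | coe b =>
    have : {v : ℝ | ((τ * (u + v) : ℝ) : EReal) < (b : EReal)} = Set.Iio (b / τ - u) := by
      ext v
      simp only [Set.mem_ofPred_eq, EReal.coe_lt_coe_iff, Set.mem_Iio]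
      rw [lt_sub_iff_add_lt, lt_div_iff₀ hτ]
      constructor <;> intro h <;> linarith
    rw [this]
    simp only [EReal.coe_ne_top, EReal.coe_ne_bot, if_false, pow_zero, one_mul, EReal.toReal_coe, gK, Measure.real]
    rw [measure_congr Iio_ae_eq_Iic]

lemma gE_le (b : EReal) {τ : ℝ} (hτ : 0 < τ) (u : ℝ) :
    (gaussianReal 0 1).real {v : ℝ | ((τ * (u + v) : ℝ) : EReal) ≤ b} = gE 0 b τ u := by
  unfold gE
  induction b with
  | bot => simp [-EReal.coe_mul, -EReal.coe_add]
  | top => simp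
  | coe b =>
    have : {v : ℝ | ((τ * (u + v) : ℝ) : EReal) ≤ (b : EReal)} = Set.Iic (b / τ - u) := by
      ext v
      simp only [Set.mem_ofPred_eq, EReal.coe_le_coe_iff, Set.mem_Iic]
      rw [le_sub_iff_add_le, le_div_iff₀ hτ]
      constructor <;> intro h <;> linarith
    rw [this]
    simp only [EReal.coe_ne_top, EReal.coe_ne_bot, if_false, pow_zero, one_mul, EReal.toReal_coe, gK]

lemma meas_aff (τ u : ℝ) : Measurable fun v : ℝ => ((τ * (u + v) : ℝ) : EReal) :=
  measurable_coe_real_ereal.comp (by fun_prop)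

lemma gP_zero (a b : EReal) {τ : ℝ} (hτ : 0 < τ) (u : ℝ) :
    gP 0 a b τ u = (gaussianReal 0 1).real
      {v : ℝ | a < ((τ * (u + v) : ℝ) : EReal) ∧ ((τ * (u + v) : ℝ) : EReal) < b} := by
  unfold gP
  split_ifs with h
  · have e : {v : ℝ | a < ((τ * (u + v) : ℝ) : EReal) ∧ ((τ * (u + v) : ℝ) : EReal) < b} =
      {v : ℝ | ((τ * (u + v) : ℝ) : EReal) < b} \ {v : ℝ | ((τ * (u + v) : ℝ) : EReal) ≤ a} := by
      ext v
      simp only [Set.mem_ofPred_eq, Set.mem_sdiff, not_le]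
      tauto
    rw [e, measureReal_sdiff, gE_lt b hτ, gE_le a hτ]
    · intro v hv; exact lt_of_le_of_lt hv h
    · exact measurableSet_le (meas_aff τ u) measurable_const
  · have e : {v : ℝ | a < ((τ * (u + v) : ℝ) : EReal) ∧ ((τ * (u + v) : ℝ) : EReal) < b} = ∅ := by
      ext v
      simp only [Set.mem_ofPred_eq, Set.mem_empty_iff_false, iff_false]
      rintro ⟨h1, h2⟩; exact h (h1.trans h2)
    rw [e]; simp

lemma gP_bound : ∃ K : ℝ, 0 < K ∧ ∀ m, 1 ≤ m → m ≤ 3 → ∀ L : ℝ, 1 ≤ L → ∀ a b τ u,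
    |gP m a b τ u| ≤ K * (L ^ m * ((1 - gP 0 a b τ u) + Real.exp (- L ^ 2))) := by
  obtain ⟨K, hK, h⟩ := gK_bound
  refine ⟨2 * K, by positivity, ?_⟩
  intro m hm hm3 L hL a b τ u
  have hE := Real.exp_pos (-L ^ 2)
  have hLm : 1 ≤ L ^ m := one_le_pow₀ hL
  have hb : |gE m b τ u| ≤ K * (L ^ m * (1 - gE 0 b τ u) + Real.exp (- L ^ 2)) := by
    unfold gE
    split_ifs <;> try omega
    · simp; positivity
    · simp; positivity
    · simpa [abs_mul] using h m hm hm3 L hL _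
  have ha : |gE m a τ u| ≤ K * (L ^ m * (gE 0 a τ u) + Real.exp (- L ^ 2)) := by
    unfold gE
    split_ifs <;> try omega
    · simp; positivity
    · simp; positivity
    · have := h m hm hm3 L hL (-(a.toReal / τ - u))
      rw [gK_abs_neg hm, gK_neg] at this
      simpa [abs_mul] using this
  have hb1 : gE 0 b τ u ≤ 1 := by
    unfold gE
    split_ifs <;> try norm_num
    exact gK_zero_le_one _
  have ha1 : 0 ≤ gE 0 a τ u := by
    unfold gE
    split_ifs <;> try norm_num
    exact gK_zero_nonneg _
  unfold gP
  split_ifs with hab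
  · refine (abs_sub _ _).trans ?_
    have : 0 ≤ L ^ m * (1 - gE 0 b τ u + gE 0 a τ u) := by
      have : 0 ≤ 1 - gE 0 b τ u := by linarith
      positivity
    have h2 : Real.exp (-L^2) ≤ L ^ m * Real.exp (-L^2) := by nlinarith
    nlinarith
  · simp; positivity

end

section

/-- Mixed derivative (indexed by a list of directions) of a product of interval probabilities. -/
def Ml {d : ℕ} (a b : Fin d → EReal) (τ : ℝ) (js : List (Fin d)) (y : Fin d → ℝ) : ℝ :=
  ∏ i, gP (js.count i) (a i) (b i) τ (y i)

lemma Ml_cons {d : ℕ} (a b : Fin d → EReal) (τ : ℝ) (js : List (Fin d)) (j : Fin d) (y : Fin d → ℝ) :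
    Ml a b τ (j :: js) y = (∏ i ∈ Finset.univ.erase j, gP (js.count i) (a i) (b i) τ (y i)) *
      gP (js.count j + 1) (a j) (b j) τ (y j) := by
  unfold Ml
  rw [← Finset.prod_erase_mul _ _ (Finset.mem_univ j)]
  congr 1
  · refine Finset.prod_congr rfl fun i hi => ?_
    rw [List.count_cons_of_ne (Finset.ne_of_mem_erase hi).symm]
  · rw [List.count_cons_self]

lemma Ml_hasFDerivAt {d : ℕ} (a b : Fin d → EReal) (τ : ℝ) (js : List (Fin d)) (hl : js.length ≤ 2)
    (y : Fin d → ℝ) :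
    HasFDerivAt (Ml a b τ js)
      (∑ j, Ml a b τ (j :: js) y • (ContinuousLinearMap.proj j : (Fin d → ℝ) →L[ℝ] ℝ)) y := by
  have h1 : ∀ i ∈ (Finset.univ : Finset (Fin d)),
      HasFDerivAt (fun y : Fin d → ℝ => gP (js.count i) (a i) (b i) τ (y i))
      (gP (js.count i + 1) (a i) (b i) τ (y i) •
        (ContinuousLinearMap.proj i : (Fin d → ℝ) →L[ℝ] ℝ)) y := by
    intro i _
    have := (gP_hasDerivAt ((List.count_le_length (a := i) (l := js)).trans hl) (a i) (b i) τ (y i))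
    exact this.comp_hasFDerivAt y (ContinuousLinearMap.proj i : (Fin d → ℝ) →L[ℝ] ℝ).hasFDerivAt
  have := HasFDerivAt.finsetProd h1
  refine this.congr_fderiv ?_
  refine Finset.sum_congr rfl fun j _ => ?_
  rw [smul_smul, Ml_cons]

lemma Ml_comp_hasFDerivAt {d : ℕ} (a b : Fin d → EReal) (τ κ : ℝ) (js : List (Fin d))
    (hl : js.length ≤ 2) (w x : Fin d → ℝ) :
    HasFDerivAt (fun x => κ ^ js.length * Ml a b τ js (κ • x + w))
      (∑ j, (κ ^ (j :: js).length * Ml a b τ (j :: js) (κ • x + w)) •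
        (ContinuousLinearMap.proj j : (Fin d → ℝ) →L[ℝ] ℝ)) x := by
  have h1 : HasFDerivAt (fun x : Fin d → ℝ => κ • x + w)
      (κ • ContinuousLinearMap.id ℝ (Fin d → ℝ)) x :=
    ((hasFDerivAt_id x).const_smul κ).add_const w
  have h2 := ((Ml_hasFDerivAt a b τ js hl (κ • x + w)).comp x h1).const_mul (κ ^ js.length)
  refine h2.congr_fderiv ?_
  ext v
  simp only [ContinuousLinearMap.smul_apply, ContinuousLinearMap.comp_apply, ContinuousLinearMap.sum_apply,
    ContinuousLinearMap.proj_apply, ContinuousLinearMap.id_apply, smul_eq_mul, List.length_cons,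
    Finset.mul_sum, Pi.smul_apply]
  refine Finset.sum_congr rfl fun j _ => ?_
  ring

/-- Weight. -/
def Wt {d : ℕ} (ρ : Fin d → ℝ) (js : List (Fin d)) : ℝ := ∏ i, if js.count i = 0 then 1 else ρ i

lemma Wt_nonneg {d : ℕ} {ρ : Fin d → ℝ} (hρ : ∀ i, 0 ≤ ρ i) (js : List (Fin d)) : 0 ≤ Wt ρ js := by
  unfold Wt
  refine Finset.prod_nonneg fun i _ => ?_
  split_ifs
  · exact zero_le_one
  · exact hρ i

lemma Wt_cons {d : ℕ} {ρ : Fin d → ℝ} (hρ : ∀ i, 0 ≤ ρ i) (j : Fin d) (js : List (Fin d)) :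
    Wt ρ (j :: js) ≤ (ρ j + js.count j) * Wt ρ js := by
  have h0 := Wt_nonneg hρ js
  by_cases h : js.count j = 0
  · apply le_of_eq
    unfold Wt
    rw [← Finset.prod_erase_mul _ _ (Finset.mem_univ j),
      ← Finset.prod_erase_mul (Finset.univ) (fun i => if js.count i = 0 then 1 else ρ i) (Finset.mem_univ j)]
    rw [List.count_cons_self, if_neg (Nat.succ_ne_zero _), h]
    simp only [Nat.cast_zero, add_zero, if_true, mul_one]
    rw [mul_comm]
    congr 1
    refine Finset.prod_congr rfl fun i hi => ?_
    rw [List.count_cons_of_ne (Finset.ne_of_mem_erase hi).symm]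
  · have e : Wt ρ (j :: js) = Wt ρ js := by
      unfold Wt
      refine Finset.prod_congr rfl fun i _ => ?_
      by_cases hij : i = j
      · subst hij
        rw [List.count_cons_self, if_neg (Nat.succ_ne_zero _), if_neg h]
      · rw [List.count_cons_of_ne (Ne.symm hij)]
    rw [e]
    have h1 : (1:ℝ) ≤ js.count j := by exact_mod_cast Nat.one_le_iff_ne_zero.2 h
    have := hρ j
    nlinarith

lemma sum_count {d : ℕ} (js : List (Fin d)) : ∑ j, (js.count j : ℝ) = js.length := by
  induction js with
  | nil => simp
  | cons a l ih =>
    simp only [List.count_cons, Nat.cast_add, Finset.sum_add_distrib, ih, List.length_cons]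
    simp

lemma Wt_sum {d : ℕ} {ρ : Fin d → ℝ} (hρ : ∀ i, 0 ≤ ρ i) (js : List (Fin d)) :
    ∑ j, Wt ρ (j :: js) ≤ (∑ i, ρ i + js.length) * Wt ρ js := by
  calc _ ≤ ∑ j, (ρ j + js.count j) * Wt ρ js := Finset.sum_le_sum fun j _ => Wt_cons hρ j js
    _ = _ := by rw [← Finset.sum_mul, Finset.sum_add_distrib, sum_count]

lemma Wt_le_pow {d : ℕ} {ρ : Fin d → ℝ} (hρ : ∀ i, 0 ≤ ρ i) (js : List (Fin d)) (hl : js.length ≤ 3) :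
    Wt ρ js ≤ (∑ i, ρ i + 2) ^ js.length := by
  have hR : 0 ≤ ∑ i, ρ i := Finset.sum_nonneg fun i _ => hρ i
  induction js with
  | nil => simp [Wt]
  | cons j l ih =>
    simp only [List.length_cons] at hl ⊢
    have h1 : Wt ρ (j :: l) ≤ ∑ j, Wt ρ (j :: l) :=
      Finset.single_le_sum (f := fun j => Wt ρ (j :: l)) (fun i _ => Wt_nonneg hρ _) (Finset.mem_univ j)
    have h2 := Wt_sum hρ l
    have h3 := ih (by omega)
    have h4 : (l.length : ℝ) ≤ 2 := by exact_mod_cast (by omega : l.length ≤ 2)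
    calc Wt ρ (j :: l) ≤ (∑ i, ρ i + l.length) * Wt ρ l := h1.trans h2
      _ ≤ (∑ i, ρ i + 2) * (∑ i, ρ i + 2) ^ l.length := by
          have := Wt_nonneg hρ l
          gcongr
      _ = _ := by ring

lemma Wt_sum1 {d : ℕ} {ρ : Fin d → ℝ} (hρ : ∀ i, 0 ≤ ρ i) :
    ∑ j, Wt ρ [j] ≤ (∑ i, ρ i + 2) ^ 1 := by
  have hR : 0 ≤ ∑ i, ρ i := Finset.sum_nonneg fun i _ => hρ i
  have h := Wt_sum hρ []
  have : Wt ρ [] = 1 := by simp [Wt]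
  rw [this] at h
  simp at h
  linarith

lemma Wt_sum2 {d : ℕ} {ρ : Fin d → ℝ} (hρ : ∀ i, 0 ≤ ρ i) :
    ∑ j, ∑ k, Wt ρ [j, k] ≤ (∑ i, ρ i + 2) ^ 2 := by
  have hR : 0 ≤ ∑ i, ρ i := Finset.sum_nonneg fun i _ => hρ i
  rw [Finset.sum_comm]
  calc _ ≤ ∑ k, (∑ i, ρ i + 2) * Wt ρ [k] := by
        refine Finset.sum_le_sum fun k _ => (Wt_sum hρ [k]).trans ?_
        have := Wt_nonneg hρ [k]
        gcongr
        simp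
    _ = (∑ i, ρ i + 2) * ∑ k, Wt ρ [k] := by rw [Finset.mul_sum]
    _ ≤ (∑ i, ρ i + 2) * (∑ i, ρ i + 2) ^ 1 := by
        gcongr; exact Wt_sum1 hρ
    _ = _ := by ring

lemma Wt_sum3 {d : ℕ} {ρ : Fin d → ℝ} (hρ : ∀ i, 0 ≤ ρ i) :
    ∑ j, ∑ k, ∑ l, Wt ρ [j, k, l] ≤ (∑ i, ρ i + 2) ^ 3 := by
  have hR : 0 ≤ ∑ i, ρ i := Finset.sum_nonneg fun i _ => hρ i
  rw [Finset.sum_comm]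
  have e : ∀ k, ∑ j, ∑ l, Wt ρ [j, k, l] = ∑ l, ∑ j, Wt ρ [j, k, l] := fun k => Finset.sum_comm
  simp_rw [e]
  calc _ ≤ ∑ k, ∑ l, (∑ i, ρ i + 2) * Wt ρ [k, l] := by
        refine Finset.sum_le_sum fun k _ => Finset.sum_le_sum fun l _ => (Wt_sum hρ [k, l]).trans ?_
        have := Wt_nonneg hρ [k, l]
        gcongr
        simp
    _ = (∑ i, ρ i + 2) * ∑ k, ∑ l, Wt ρ [k, l] := by simp_rw [Finset.mul_sum]
    _ ≤ (∑ i, ρ i + 2) * (∑ i, ρ i + 2) ^ 2 := by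
        gcongr; exact Wt_sum2 hρ
    _ = _ := by ring

lemma gP_zero_mem (a b : EReal) {τ : ℝ} (hτ : 0 < τ) (u : ℝ) : 0 ≤ gP 0 a b τ u ∧ gP 0 a b τ u ≤ 1 := by
  rw [gP_zero a b hτ u]
  exact ⟨measureReal_nonneg, measureReal_le_one⟩

lemma Ml_bounds : ∃ B : ℝ, 0 < B ∧ ∀ (d : ℕ), 3 ≤ d → ∀ (a b : Fin d → EReal) (τ : ℝ), 0 < τ →
    ∀ y : Fin d → ℝ,
    (∀ js : List (Fin d), js.length ≤ 3 → |Ml a b τ js y| ≤ B * √(Real.log d) ^ js.length) ∧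
    (∑ j, |Ml a b τ [j] y| ≤ B * √(Real.log d) ^ 1) ∧
    (∑ j, ∑ k, |Ml a b τ [j, k] y| ≤ B * √(Real.log d) ^ 2) ∧
    (∑ j, ∑ k, ∑ l, |Ml a b τ [j, k, l] y| ≤ B * √(Real.log d) ^ 3) := by
  obtain ⟨K, hK, hb⟩ := gP_bound
  set c := Real.exp 1 * K + 1 with hc
  have hc1 : 1 ≤ c := by rw [hc]; have := Real.exp_pos 1; nlinarith
  refine ⟨27 * c ^ 3, by positivity, ?_⟩
  intro d hd a b τ hτ y
  set L := √(Real.log d) with hL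
  have hd0 : (3:ℝ) ≤ d := by exact_mod_cast hd
  have hlog : 1 ≤ Real.log d := by
    rw [Real.le_log_iff_exp_le (by linarith)]
    exact (Real.exp_one_lt_d9.le.trans (by norm_num)).trans hd0
  have hL1 : 1 ≤ L := by rw [hL, Real.one_le_sqrt]; exact hlog
  have hLE : Real.exp (-L ^ 2) = 1 / d := by
    rw [hL, Real.sq_sqrt (by linarith), Real.exp_neg, Real.exp_log (by linarith), one_div]
  set q : Fin d → ℝ := fun i => 1 - gP 0 (a i) (b i) τ (y i) with hq
  have hq0 : ∀ i, 0 ≤ q i := fun i => by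
    have := (gP_zero_mem (a i) (b i) hτ (y i)).2
    simp only [hq]; linarith
  have hq1 : ∀ i, q i ≤ 1 := fun i => by
    have := (gP_zero_mem (a i) (b i) hτ (y i)).1
    simp only [hq]; linarith
  set ρ : Fin d → ℝ := fun i => c * (q i + 1 / d) with hρd
  have hρ : ∀ i, 0 ≤ ρ i := fun i => by
    have := hq0 i
    simp only [hρd]; positivity
  set Q := ∑ i, q i with hQ
  have hQ0 : 0 ≤ Q := Finset.sum_nonneg fun i _ => hq0 i
  have hR : ∑ i, ρ i = c * (Q + 1) := by
    simp only [hρd]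
    rw [← Finset.mul_sum, Finset.sum_add_distrib]
    simp
    left
    field_simp
    rfl
  have key : ∀ js : List (Fin d), js.length ≤ 3 →
      |Ml a b τ js y| ≤ Real.exp (-Q) * L ^ js.length * Wt ρ js := by
    intro js hjs
    unfold Ml
    rw [Finset.abs_prod]
    have h1 : ∀ i, |gP (js.count i) (a i) (b i) τ (y i)| ≤
        Real.exp (- q i) * L ^ (js.count i) * (if js.count i = 0 then 1 else ρ i) := by
      intro i
      by_cases h : js.count i = 0
      · rw [h]
        simp only [pow_zero, if_true, mul_one]
        rw [abs_of_nonneg (gP_zero_mem (a i) (b i) hτ (y i)).1]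
        have := Real.add_one_le_exp (- q i)
        simp only [hq] at this ⊢; linarith
      · rw [if_neg h]
        have h2 := hb (js.count i) (Nat.one_le_iff_ne_zero.2 h) ((List.count_le_length).trans hjs) L hL1
          (a i) (b i) τ (y i)
        rw [hLE] at h2
        refine h2.trans ?_
        have h3 : Real.exp (-1) ≤ Real.exp (- q i) := Real.exp_le_exp.2 (by linarith [hq1 i])
        have h4 : K ≤ Real.exp (-1) * c := by
          have : Real.exp (-1) * Real.exp 1 = 1 := by rw [← Real.exp_add]; simp
          have h5 := Real.exp_pos (-1)
          rw [hc, mul_add, ← mul_assoc, this]; linarith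
        have h5 : 0 ≤ q i + 1 / d := by have := hq0 i; positivity
        calc K * (L ^ (js.count i) * (q i + 1 / d)) ≤ (Real.exp (-q i) * c) * (L ^ (js.count i) * (q i + 1 / d)) := by
              gcongr
              exact h4.trans (by gcongr)
          _ = _ := by simp only [hρd]; ring
    calc _ ≤ ∏ i, (Real.exp (- q i) * L ^ (js.count i) * (if js.count i = 0 then 1 else ρ i)) :=
          Finset.prod_le_prod (fun i _ => abs_nonneg _) fun i _ => h1 i
      _ = _ := by
          rw [Finset.prod_mul_distrib, Finset.prod_mul_distrib, ← Real.exp_sum, Finset.prod_pow_eq_pow_sum,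
            Finset.sum_neg_distrib]
          have : ∑ i, js.count i = js.length := by exact_mod_cast sum_count js
          rw [this]; rfl
  have fin : ∀ m, m ≤ 3 → Real.exp (-Q) * (∑ i, ρ i + 2) ^ m ≤ 27 * c ^ 3 := by
    intro m hm
    have h1 : ∑ i, ρ i + 2 ≤ c * (Q + 3) := by rw [hR]; nlinarith
    have h2 : 1 ≤ c * (Q + 3) := by nlinarith
    have h3 : Q + 3 ≤ 3 * Real.exp (Q / 3) := by
      have := Real.add_one_le_exp (Q / 3); linarith
    have hR0 : 0 ≤ ∑ i, ρ i := Finset.sum_nonneg fun i _ => hρ i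
    calc Real.exp (-Q) * (∑ i, ρ i + 2) ^ m ≤ Real.exp (-Q) * (c * (Q + 3)) ^ m := by gcongr
      _ ≤ Real.exp (-Q) * (c * (Q + 3)) ^ 3 := by gcongr
      _ ≤ Real.exp (-Q) * (c * (3 * Real.exp (Q / 3))) ^ 3 := by gcongr
      _ = 27 * c ^ 3 * (Real.exp (-Q) * (Real.exp (Q / 3)) ^ 3) := by ring
      _ = 27 * c ^ 3 := by
          rw [← Real.exp_nat_mul, ← Real.exp_add]
          have : -Q + ((3:ℕ):ℝ) * (Q / 3) = 0 := by push_cast; ring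
          rw [this]; simp
  have hL0 : 0 ≤ L := by linarith
  have comb : ∀ m, m ≤ 3 → ∀ X, X ≤ (∑ i, ρ i + 2) ^ m → Real.exp (-Q) * L ^ m * X ≤ 27 * c ^ 3 * L ^ m := by
    intro m hm X hX
    calc Real.exp (-Q) * L ^ m * X ≤ Real.exp (-Q) * L ^ m * (∑ i, ρ i + 2) ^ m := by gcongr
      _ = (Real.exp (-Q) * (∑ i, ρ i + 2) ^ m) * L ^ m := by ring
      _ ≤ _ := mul_le_mul_of_nonneg_right (fin m hm) (by positivity)
  refine ⟨?_, ?_, ?_, ?_⟩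
  · intro js hjs
    exact (key js hjs).trans (comb _ hjs _ (Wt_le_pow hρ js hjs))
  · refine le_trans ?_ (comb 1 (by norm_num) _ (Wt_sum1 hρ))
    rw [Finset.mul_sum]
    exact Finset.sum_le_sum fun j _ => key [j] (by simp)
  · refine le_trans ?_ (comb 2 (by norm_num) _ (Wt_sum2 hρ))
    simp_rw [Finset.mul_sum]
    exact Finset.sum_le_sum fun j _ => Finset.sum_le_sum fun k _ => key [j, k] (by simp)
  · refine le_trans ?_ (comb 3 (by norm_num) _ (Wt_sum3 hρ))
    simp_rw [Finset.mul_sum]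
    exact Finset.sum_le_sum fun j _ => Finset.sum_le_sum fun k _ => Finset.sum_le_sum fun l _ =>
      key [j, k, l] (by simp)

end

section

lemma posSemidef_sub_smallest {d : ℕ} {S : Matrix (Fin d) (Fin d) ℝ} (hS : S.PosDef) {σ : ℝ}
    (h : IsSmallestEigenvalueSq S σ) : (S - σ ^ 2 • (1 : Matrix (Fin d) (Fin d) ℝ)).PosSemidef := by
  have hH : (S - σ ^ 2 • (1 : Matrix (Fin d) (Fin d) ℝ)).IsHermitian := by
    refine hS.isHermitian.sub ?_
    unfold Matrix.IsHermitian
    simp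
  rw [hH.posSemidef_iff_eigenvalues_nonneg]
  intro j
  have h1 := hH.mulVec_eigenvectorBasis j
  set v := (hH.eigenvectorBasis j).ofLp with hv
  have hv0 : v ≠ 0 := by
    intro h0
    have h2 : ‖hH.eigenvectorBasis j‖ = 1 := hH.eigenvectorBasis.orthonormal.1 j
    have h3 : hH.eigenvectorBasis j = 0 := by
      ext i
      exact congrFun h0 i
    rw [h3] at h2
    simp at h2
  have h2 : S.mulVec v = (hH.eigenvalues j + σ ^ 2) • v := by
    rw [Matrix.sub_mulVec, Matrix.smul_mulVec, Matrix.one_mulVec] at h1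
    rw [add_smul, ← h1]; simp
  have := h.2 ⟨v, hv0, h2⟩
  simp only [Pi.zero_apply]
  linarith

lemma norm_sum_proj_le {d : ℕ} (c : Fin d → ℝ) {K : ℝ} (hc : ∀ j, |c j| ≤ K) :
    ‖∑ j, c j • (ContinuousLinearMap.proj j : (Fin d → ℝ) →L[ℝ] ℝ)‖ ≤ d * K := by
  refine (norm_sum_le _ _).trans ?_
  have h1 : ∀ j, ‖(ContinuousLinearMap.proj j : (Fin d → ℝ) →L[ℝ] ℝ)‖ ≤ 1 := fun j =>
    ContinuousLinearMap.opNorm_le_bound _ zero_le_one fun x => by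
      simpa using norm_le_pi_norm x j
  calc _ ≤ ∑ _j : Fin d, K := by
        refine Finset.sum_le_sum fun j _ => ?_
        rw [norm_smul, Real.norm_eq_abs]
        have := abs_nonneg (c j)
        nlinarith [hc j, h1 j]
    _ = _ := by simp

lemma hasFDerivAt_integral_proj {α : Type*} [MeasurableSpace α] {μ : Measure α} {d : ℕ}
    {f : α → (Fin d → ℝ) → ℝ} {f' : Fin d → α → (Fin d → ℝ) → ℝ} {bd : α → ℝ} (x : Fin d → ℝ)
    (hfm : ∀ x, AEStronglyMeasurable (fun ω => f ω x) μ) (hfi : Integrable (fun ω => f ω x) μ)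
    (hfm' : ∀ j, AEStronglyMeasurable (fun ω => f' j ω x) μ)
    (hb : ∀ᵐ ω ∂μ, ∀ j y, |f' j ω y| ≤ bd ω) (hbi : Integrable bd μ)
    (hd : ∀ᵐ ω ∂μ, ∀ y, HasFDerivAt (f ω)
      (∑ j, f' j ω y • (ContinuousLinearMap.proj j : (Fin d → ℝ) →L[ℝ] ℝ)) y) :
    HasFDerivAt (fun x => ∫ ω, f ω x ∂μ)
      (∑ j, (∫ ω, f' j ω x ∂μ) • (ContinuousLinearMap.proj j : (Fin d → ℝ) →L[ℝ] ℝ)) x := by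
  have hintg : ∀ j, Integrable (fun ω => f' j ω x) μ := fun j =>
    hbi.mono' (hfm' j) (by filter_upwards [hb] with ω h; exact h j x)
  have h := hasFDerivAt_integral_of_dominated_of_fderiv_le (𝕜 := ℝ) (μ := μ)
    (F := fun x ω => f ω x) (x₀ := x) (bound := fun ω => d * bd ω) (s := Set.univ)
    (F' := fun y ω => ∑ j, f' j ω y • (ContinuousLinearMap.proj j : (Fin d → ℝ) →L[ℝ] ℝ))
    Filter.univ_mem (Filter.Eventually.of_forall hfm) hfi
    (by
      refine Finset.aestronglyMeasurable_fun_sum _ fun j _ => ?_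
      exact (hfm' j).smul_const _)
    (by
      filter_upwards [hb] with ω h y _
      exact norm_sum_proj_le _ fun j => h j y)
    (hbi.const_mul _)
    (by filter_upwards [hd] with ω h y _ using h y)
  refine h.congr_fderiv ?_
  rw [integral_finsetSum]
  · refine Finset.sum_congr rfl fun j _ => ?_
    rw [integral_smul_const]
  · intro j _
    exact (hintg j).smul_const _

lemma pd_of_hasFDerivAt {d : ℕ} {f : (Fin d → ℝ) → ℝ} {c : Fin d → ℝ} {x : Fin d → ℝ}
    (h : HasFDerivAt f (∑ j, c j • (ContinuousLinearMap.proj j : (Fin d → ℝ) →L[ℝ] ℝ)) x) (j : Fin d) :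
    pd f j x = c j := by
  unfold pd
  rw [h.fderiv]
  simp [_root_.sum_apply, Pi.single_apply]

/-- Gaussian average of `Ml`. -/
def HH {d : ℕ} (a b : Fin d → EReal) (σ : ℝ) (μ : Measure (Fin d → ℝ)) (js : List (Fin d)) (τ : ℝ)
    (y : Fin d → ℝ) : ℝ := ∫ z, Ml a b τ js (y + σ⁻¹ • z) ∂μ

lemma gP_meas' {d : ℕ} (m : ℕ) (a b : EReal) (i : Fin d) :
    Measurable (fun p : ℝ × (Fin d → ℝ) => gP m a b p.1 (p.2 i)) := by
  have h1 : Measurable (fun p : ℝ × (Fin d → ℝ) => (p.1, p.2 i)) := by fun_prop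
  have := (gP_meas m a b).comp h1
  exact this

lemma Ml_meas {d : ℕ} (a b : Fin d → EReal) (js : List (Fin d)) :
    Measurable (fun p : ℝ × (Fin d → ℝ) => Ml a b p.1 js p.2) := by
  unfold Ml
  refine Finset.measurable_fun_prod _ fun i _ => ?_
  apply gP_meas'

lemma Ml_contOn {d : ℕ} (a b : Fin d → EReal) (js : List (Fin d)) :
    ContinuousOn (fun p : ℝ × (Fin d → ℝ) => Ml a b p.1 js p.2) {p | 0 < p.1} := by
  unfold Ml
  refine continuousOn_finsetProd _ fun i _ => ?_
  refine (gP_contOn (js.count i) (a i) (b i)).comp (f := fun p : ℝ × (Fin d → ℝ) => (p.1, p.2 i)) ?_ ?_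
  · fun_prop
  · intro p hp; exact hp

variable {d : ℕ} {a b : Fin d → EReal} {σ : ℝ} {μ : Measure (Fin d → ℝ)} [IsProbabilityMeasure μ]

lemma Ml_shift_meas (js : List (Fin d)) (τ : ℝ) (y : Fin d → ℝ) :
    Measurable (fun z => Ml a b τ js (y + σ⁻¹ • z)) := by
  have h1 : Measurable (fun z : Fin d → ℝ => (τ, y + σ⁻¹ • z)) := by fun_prop
  have := (Ml_meas a b js).comp h1
  exact this

lemma Ml_shift_integrable {B : ℝ} {js : List (Fin d)} {τ : ℝ} 
    (hB : ∀ y, |Ml a b τ js y| ≤ B) (y : Fin d → ℝ) :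
    Integrable (fun z => Ml a b τ js (y + σ⁻¹ • z)) μ :=
  Integrable.of_bound (Ml_shift_meas js τ y).aestronglyMeasurable B (Filter.Eventually.of_forall fun z => hB _)

lemma HH_hasFDerivAt {B τ : ℝ} (hB : ∀ js : List (Fin d), js.length ≤ 3 → ∀ y, |Ml a b τ js y| ≤ B)
    {js : List (Fin d)} (hl : js.length ≤ 2) (y : Fin d → ℝ) :
    HasFDerivAt (HH a b σ μ js τ) (∑ j, HH a b σ μ (j :: js) τ y •
      (ContinuousLinearMap.proj j : (Fin d → ℝ) →L[ℝ] ℝ)) y := by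
  refine hasFDerivAt_integral_proj (f := fun z y => Ml a b τ js (y + σ⁻¹ • z))
    (f' := fun j z y => Ml a b τ (j :: js) (y + σ⁻¹ • z)) (bd := fun _ => B) y ?_ ?_ ?_ ?_ ?_ ?_
  · exact fun x => (Ml_shift_meas js τ x).aestronglyMeasurable
  · exact Ml_shift_integrable (hB js (by omega)) y
  · exact fun j => (Ml_shift_meas _ τ y).aestronglyMeasurable
  · exact Filter.Eventually.of_forall fun z j y => hB (j :: js) (by simp; omega) _
  · exact integrable_const _
  · refine Filter.Eventually.of_forall fun z y => ?_
    have := Ml_comp_hasFDerivAt a b τ 1 js hl (σ⁻¹ • z) y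
    simpa using this

lemma HH_abs_le {B τ : ℝ} {js : List (Fin d)} (hB : ∀ y, |Ml a b τ js y| ≤ B) (y : Fin d → ℝ) :
    |HH a b σ μ js τ y| ≤ B := by
  have := norm_integral_le_of_norm_le_const (μ := μ) (f := fun z => Ml a b τ js (y + σ⁻¹ • z)) (C := B)
    (Filter.Eventually.of_forall fun z => hB _)
  simpa [HH] using this

lemma sum_abs_integral_le {ι α : Type*} [MeasurableSpace α] {ν : Measure α} [IsProbabilityMeasure ν] (s : Finset ι)
    {f : ι → α → ℝ} {B : ℝ} (hf : ∀ i, Integrable (f i) ν) (h : ∀ z, ∑ i ∈ s, |f i z| ≤ B) :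
    ∑ i ∈ s, |∫ z, f i z ∂ν| ≤ B := by
  calc _ ≤ ∑ i ∈ s, ∫ z, |f i z| ∂ν := Finset.sum_le_sum fun i _ => abs_integral_le_integral_abs
    _ = ∫ z, ∑ i ∈ s, |f i z| ∂ν := (integral_finsetSum _ fun i _ => (hf i).abs).symm
    _ ≤ ∫ z, B ∂ν := integral_mono (integrable_finsetSum _ fun i _ => (hf i).abs) (integrable_const _) h
    _ = B := by simp

lemma HH_contOn {B : ℝ} {js : List (Fin d)} (hB : ∀ τ, 0 < τ → ∀ y, |Ml a b τ js y| ≤ B) :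
    ContinuousOn (fun p : ℝ × (Fin d → ℝ) => HH a b σ μ js p.1 p.2) {p | 0 < p.1} := by
  unfold HH
  refine continuousOn_of_dominated (bound := fun _ => B) ?_ ?_ (integrable_const _) ?_
  · exact fun p _ => (Ml_shift_meas js p.1 p.2).aestronglyMeasurable
  · exact fun p hp => Filter.Eventually.of_forall fun z => hB p.1 hp _
  · refine Filter.Eventually.of_forall fun z => ?_
    refine (Ml_contOn a b js).comp (f := fun p : ℝ × (Fin d → ℝ) => (p.1, p.2 + σ⁻¹ • z)) ?_ ?_
    · fun_prop
    · intro p hp; exact hp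


/-- Box. -/
def Bx (a b : Fin d → EReal) : Set (Fin d → ℝ) := {x | ∀ j, a j < (x j : EReal) ∧ (x j : EReal) < b j}

lemma Bx_meas (a b : Fin d → EReal) : MeasurableSet (Bx a b) := by
  have : Bx a b = ⋂ j, ({x : Fin d → ℝ | a j < (x j : EReal)} ∩ {x | (x j : EReal) < b j}) := by
    ext x; simp [Bx]
  rw [this]
  refine MeasurableSet.iInter fun j => ?_
  have hm : Measurable (fun x : Fin d → ℝ => ((x j : ℝ) : EReal)) :=
    measurable_coe_real_ereal.comp (measurable_pi_apply j)
  exact (measurableSet_lt measurable_const hm).inter (measurableSet_lt hm measurable_const)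

lemma rep {S : Matrix (Fin d) (Fin d) ℝ} (hS : S.PosDef) (hσ : 0 < σ)
    (hP : (S - σ ^ 2 • (1 : Matrix (Fin d) (Fin d) ℝ)).PosSemidef) (e : ℝ) {α : ℝ} (hα : 0 < α) (x : Fin d → ℝ) :
    ∫ z, (Bx a b).indicator (fun _ => (1:ℝ)) (e • x + α • z) ∂(mg d S) =
      HH a b σ (mg d (S - σ ^ 2 • (1 : Matrix (Fin d) (Fin d) ℝ))) [] (α * σ) ((e / (α * σ)) • x) := by
  have h1 := mg_comb_integral (S₁ := 1) (S₂ := S - σ ^ 2 • (1 : Matrix (Fin d) (Fin d) ℝ)) (S := S)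
    Matrix.PosSemidef.one hP hS.posSemidef (α := σ) (β := 1) (c := 1) (by simp)
    (f := fun z => (Bx a b).indicator (fun _ => (1:ℝ)) (e • x + α • z))
    ((measurable_const.indicator (Bx_meas a b)).comp (by fun_prop)) (K := 1)
    (fun z => by
      by_cases h : e • x + α • z ∈ Bx a b
      · simp [h]
      · simp [h])
  simp only [one_smul] at h1
  rw [← h1]
  unfold HH
  refine integral_congr_ae (Filter.Eventually.of_forall fun z => ?_)
  simp only
  have hασ : 0 < α * σ := by positivity
  have e1 : (fun v : Fin d → ℝ => (Bx a b).indicator (fun _ => (1:ℝ)) (e • x + α • (σ • v + z))) =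
      (Set.univ.pi fun i => {v : ℝ | a i < ((α * σ * (((e / (α * σ)) • x + σ⁻¹ • z) i + v) : ℝ) : EReal) ∧
        ((α * σ * (((e / (α * σ)) • x + σ⁻¹ • z) i + v) : ℝ) : EReal) < b i}).indicator (fun _ => (1:ℝ)) := by
    ext v
    have e2 : ∀ i, (e • x + α • (σ • v + z)) i = α * σ * (((e / (α * σ)) • x + σ⁻¹ • z) i + v i) := by
      intro i
      simp only [Pi.add_apply, Pi.smul_apply, smul_eq_mul]
      field_simp
      ring
    unfold Set.indicator
    congr 1
    simp only [Bx, Set.mem_ofPred_eq, e2, Set.mem_pi, Set.mem_univ, true_imp_iff]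
  rw [e1, mg_one, integral_indicator_const]
  · simp only [smul_eq_mul, mul_one, Ml, List.count_nil, Measure.real, stdPi, Measure.pi_pi]
    rw [ENNReal.toReal_prod]
    refine Finset.prod_congr rfl fun i _ => ?_
    rw [gP_zero _ _ hασ]
    rfl
  · refine MeasurableSet.univ_pi fun i => ?_
    have hm : Measurable (fun v : ℝ => ((α * σ * (((e / (α * σ)) • x + σ⁻¹ • z) i + v) : ℝ) : EReal)) :=
      measurable_coe_real_ereal.comp (by fun_prop)
    exact (measurableSet_lt measurable_const hm).inter (measurableSet_lt hm measurable_const)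

end

section

lemma mvt01 {f f' : ℝ → ℝ} {K : ℝ} (hf : ∀ t, HasDerivAt f (f' t) t)
    (hb : ∀ t ∈ Set.Icc (0:ℝ) 1, |f' t| ≤ K) {t : ℝ} (ht : t ∈ Set.Icc (0:ℝ) 1) : |f t - f 0| ≤ K := by
  have h := (convex_Icc (0:ℝ) 1).norm_image_sub_le_of_norm_hasDerivWithin_le (C := K)
    (fun x _ => (hf x).hasDerivWithinAt) hb (Set.left_mem_Icc.2 zero_le_one) ht
  rw [Real.norm_eq_abs, Real.norm_eq_abs, sub_zero] at h
  have hK : 0 ≤ K := (abs_nonneg _).trans (hb t ht)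
  have : |t| ≤ 1 := by rw [abs_of_nonneg ht.1]; exact ht.2
  nlinarith

lemma scalar_taylor {f f1 f2 f3 : ℝ → ℝ} {K : ℝ} (h0 : ∀ t, HasDerivAt f (f1 t) t)
    (h1 : ∀ t, HasDerivAt f1 (f2 t) t) (h2 : ∀ t, HasDerivAt f2 (f3 t) t) (hb : ∀ t, |f3 t| ≤ K) :
    |f 1 - f 0 - f1 0 - 1 / 2 * f2 0| ≤ K := by
  have e2 : ∀ t ∈ Set.Icc (0:ℝ) 1, |f2 t - f2 0| ≤ K := fun t ht => mvt01 h2 (fun t _ => hb t) ht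
  have e1 : ∀ t ∈ Set.Icc (0:ℝ) 1, |f1 t - f1 0 - t * f2 0| ≤ K := by
    intro t ht
    have := mvt01 (f := fun t => f1 t - t * f2 0) (f' := fun t => f2 t - 1 * f2 0)
      (fun t => (h1 t).sub ((hasDerivAt_id t).mul_const _)) (K := K) (by simpa using e2) ht
    simp only [zero_mul, sub_zero] at this
    rwa [show f1 t - f1 0 - t * f2 0 = f1 t - t * f2 0 - f1 0 by ring]
  have := mvt01 (f := fun t => f t - t * f1 0 - t ^ 2 / 2 * f2 0) (f' := fun t => f1 t - f1 0 - t * f2 0)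
      (fun t => by
        have h3 : HasDerivAt (fun t : ℝ => t ^ 2 / 2) t t :=
          ((hasDerivAt_pow 2 t).div_const 2).congr_deriv (by simp)
        exact (((h0 t).sub ((hasDerivAt_id t).mul_const (f1 0))).sub (h3.mul_const (f2 0))).congr_deriv (by simp))
      (K := K) e1 (Set.right_mem_Icc.2 zero_le_one)
  refine le_of_eq_of_le ?_ this
  congr 1
  ring

lemma line_deriv {d : ℕ} {g : (Fin d → ℝ) → ℝ} {c : Fin d → (Fin d → ℝ) → ℝ} (x v : Fin d → ℝ)
    (h : ∀ y, HasFDerivAt g (∑ j, c j y • (ContinuousLinearMap.proj j : (Fin d → ℝ) →L[ℝ] ℝ)) y) (t : ℝ) :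
    HasDerivAt (fun t : ℝ => g (x + t • v)) (∑ j, c j (x + t • v) * v j) t := by
  have h1 : HasDerivAt (fun t : ℝ => x + t • v) v t := by
    have := ((hasDerivAt_id t).smul_const v).const_add x
    simpa using this
  have h2 := (h (x + t • v)).comp_hasDerivAt t h1
  refine h2.congr_deriv ?_
  simp [_root_.sum_apply]

lemma taylor3 {d : ℕ} {G : List (Fin d) → (Fin d → ℝ) → ℝ} {M : ℝ}
    (hG : ∀ js : List (Fin d), js.length ≤ 2 → ∀ y, HasFDerivAt (G js)
      (∑ j, G (j :: js) y • (ContinuousLinearMap.proj j : (Fin d → ℝ) →L[ℝ] ℝ)) y)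
    (hM : ∀ js : List (Fin d), js.length = 3 → ∀ y, |G js y| ≤ M) (x v : Fin d → ℝ) :
    |G [] (x + v) - G [] x - ∑ j, G [j] x * v j - 1 / 2 * ∑ j, ∑ k, G [k, j] x * v k * v j| ≤
      d ^ 3 * M * ‖v‖ ^ 3 := by
  have h := scalar_taylor (f := fun t : ℝ => G [] (x + t • v)) (f1 := fun t => ∑ j, G [j] (x + t • v) * v j)
    (f2 := fun t => ∑ j, (∑ k, G [k, j] (x + t • v) * v k) * v j)
    (f3 := fun t => ∑ j, (∑ k, (∑ l, G [l, k, j] (x + t • v) * v l) * v k) * v j) (K := d ^ 3 * M * ‖v‖ ^ 3)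
    (fun t => line_deriv x v (hG [] (by simp)) t)
    (fun t => HasDerivAt.fun_sum fun j _ => (line_deriv x v (hG [j] (by simp)) t).mul_const (v j))
    (fun t => HasDerivAt.fun_sum fun j _ => HasDerivAt.mul_const (HasDerivAt.fun_sum fun k _ =>
      (line_deriv x v (hG [k, j] (by simp)) t).mul_const (v k)) (v j))
    (fun t => by
      have hv : ∀ j, |v j| ≤ ‖v‖ := fun j => norm_le_pi_norm v j
      have key : ∀ (f : Fin d → ℝ) (C : ℝ), (∀ j, |f j| ≤ C) → |∑ j, f j * v j| ≤ d * (C * ‖v‖) := by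
        intro f C hf
        calc _ ≤ ∑ j, |f j * v j| := Finset.abs_sum_le_sum_abs _ _
          _ ≤ ∑ _j : Fin d, C * ‖v‖ := by
              refine Finset.sum_le_sum fun j _ => ?_
              rw [abs_mul]
              exact mul_le_mul (hf j) (hv j) (abs_nonneg _) ((abs_nonneg _).trans (hf j))
          _ = _ := by simp
      refine (key _ _ fun j => key _ _ fun k => key _ _ fun l => hM [l, k, j] (by simp) _).trans (le_of_eq ?_)
      ring)
  simp only [one_smul, zero_smul, add_zero] at h
  convert h using 3
  congr 1
  exact Finset.sum_congr rfl fun j _ => by rw [Finset.sum_mul]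

lemma integral_add4 {α : Type*} [MeasurableSpace α] {ν : Measure α} {f1 f2 f3 f4 : α → ℝ}
    (h1 : Integrable f1 ν) (h2 : Integrable f2 ν) (h3 : Integrable f3 ν) (h4 : Integrable f4 ν) :
    ∫ z, (f1 z + f2 z + f3 z + f4 z) ∂ν = ∫ z, f1 z ∂ν + ∫ z, f2 z ∂ν + ∫ z, f3 z ∂ν + ∫ z, f4 z ∂ν := by
  have h12 : Integrable (fun z => f1 z + f2 z) ν := h1.add h2
  have h123 : Integrable (fun z => f1 z + f2 z + f3 z) ν := h12.add h3
  rw [integral_add h123 h4, integral_add h12 h3, integral_add h1 h2]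

lemma integral_sub4 {α : Type*} [MeasurableSpace α] {ν : Measure α} {f1 f2 f3 f4 : α → ℝ}
    (h1 : Integrable f1 ν) (h2 : Integrable f2 ν) (h3 : Integrable f3 ν) (h4 : Integrable f4 ν) :
    ∫ z, (f1 z - f2 z - f3 z - f4 z) ∂ν = ∫ z, f1 z ∂ν - ∫ z, f2 z ∂ν - ∫ z, f3 z ∂ν - ∫ z, f4 z ∂ν := by
  have h12 : Integrable (fun z => f1 z - f2 z) ν := h1.sub h2
  have h123 : Integrable (fun z => f1 z - f2 z - f3 z) ν := h12.sub h3
  rw [integral_sub h123 h4, integral_sub h12 h3, integral_sub h1 h2]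

/-- Small-time expansion of a Mehler average. -/
lemma mehler_small {d : ℕ} {S : Matrix (Fin d) (Fin d) ℝ} (hS : S.PosSemidef)
    {G : List (Fin d) → (Fin d → ℝ) → ℝ} {M : ℝ} (hM0 : 0 ≤ M)
    (hG : ∀ js : List (Fin d), js.length ≤ 2 → ∀ y, HasFDerivAt (G js)
      (∑ j, G (j :: js) y • (ContinuousLinearMap.proj j : (Fin d → ℝ) →L[ℝ] ℝ)) y)
    (hM : ∀ js : List (Fin d), js.length ≤ 3 → ∀ y, |G js y| ≤ M) (x : Fin d → ℝ) :
    ∃ K, ∀ h, 0 < h → h ≤ 1 →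
      |∫ z, G [] (Real.exp (-h) • x + √(1 - Real.exp (-2 * h)) • z) ∂(mg d S) - G [] x
        - (Real.exp (-h) - 1) * (∑ j, x j * G [j] x)
        - 1 / 2 * ((Real.exp (-h) - 1) ^ 2 * ∑ j, ∑ k, G [k, j] x * x k * x j)
        - 1 / 2 * ((1 - Real.exp (-2 * h)) * ∑ j, ∑ k, G [k, j] x * S k j)| ≤ K * (h * √h) := by
  set μ := mg d S with hμ
  have hintg : Integrable (fun z : Fin d → ℝ => (‖x‖ + 2 * ‖z‖) ^ 3) μ := by
    have e : (fun z : Fin d → ℝ => (‖x‖ + 2 * ‖z‖) ^ 3) = fun z => ‖x‖ ^ 3 + 6 * ‖x‖ ^ 2 * ‖z‖ ^ 1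
        + 12 * ‖x‖ * ‖z‖ ^ 2 + 8 * ‖z‖ ^ 3 := by ext z; ring
    rw [e]
    exact (((integrable_const _).add ((mg_integrable_norm_pow d S 1).const_mul _)).add
      ((mg_integrable_norm_pow d S 2).const_mul _)).add ((mg_integrable_norm_pow d S 3).const_mul _)
  refine ⟨d ^ 3 * M * ∫ z, (‖x‖ + 2 * ‖z‖) ^ 3 ∂μ, fun h h0 h1 => ?_⟩
  set e := Real.exp (-h) - 1 with he
  set α := √(1 - Real.exp (-2 * h)) with hα
  have hα2 : α ^ 2 = 1 - Real.exp (-2 * h) := by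
    rw [hα, Real.sq_sqrt]
    have : Real.exp (-2 * h) ≤ 1 := Real.exp_le_one_iff.2 (by linarith)
    linarith
  set v : (Fin d → ℝ) → (Fin d → ℝ) := fun z => e • x + α • z with hv
  have hxv : ∀ z, Real.exp (-h) • x + α • z = x + v z := by
    intro z; ext i; simp [hv, he]; ring
  have hGc : Continuous (G []) := continuous_iff_continuousAt.2 fun y => (hG [] (by simp) y).continuousAt
  have hvc : Continuous v := by simp only [hv]; fun_prop
  have i0 : Integrable (fun z => G [] (x + v z)) μ :=
    Integrable.of_bound (hGc.comp (by fun_prop)).aestronglyMeasurable M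
      (Filter.Eventually.of_forall fun z => hM [] (by simp) _)
  have i1 : ∀ j, Integrable (fun z => v z j) μ := fun j => by
    simp only [hv, Pi.add_apply, Pi.smul_apply, smul_eq_mul]
    exact (integrable_const _).add ((mg_integrable_coord d S j).const_mul _)
  have m1 : ∀ j, ∫ z, v z j ∂μ = e * x j := fun j => by
    simp only [hv, Pi.add_apply, Pi.smul_apply, smul_eq_mul]
    rw [integral_add (integrable_const _) ((mg_integrable_coord d S j).const_mul _),
      integral_const_mul α, mg_integral_coord]
    simp
  have ev2 : ∀ j k, (fun z => v z k * v z j) = fun z => e ^ 2 * (x k * x j) + (e * x k * α) * z j +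
      (e * x j * α) * z k + α ^ 2 * (z k * z j) := by
    intro j k; ext z
    simp only [hv, Pi.add_apply, Pi.smul_apply, smul_eq_mul]; ring
  have i2 : ∀ j k, Integrable (fun z => v z k * v z j) μ := fun j k => by
    rw [ev2]
    exact (((integrable_const _).add ((mg_integrable_coord d S j).const_mul _)).add
      ((mg_integrable_coord d S k).const_mul _)).add ((mg_integrable_coord_mul d S k j).const_mul _)
  have m2 : ∀ j k, ∫ z, v z k * v z j ∂μ = e ^ 2 * (x k * x j) + α ^ 2 * S k j := fun j k => by
    rw [ev2]
    rw [integral_add4 (integrable_const _) ((mg_integrable_coord d S j).const_mul _)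
      ((mg_integrable_coord d S k).const_mul _) ((mg_integrable_coord_mul d S k j).const_mul _),
      integral_const_mul (e * x k * α), integral_const_mul (e * x j * α), integral_const_mul (α ^ 2),
      mg_integral_coord, mg_integral_coord, mg_integral_coord_mul hS]
    simp
  have iA : Integrable (fun z => ∑ j, G [j] x * v z j) μ :=
    integrable_finsetSum _ fun j _ => (i1 j).const_mul _
  have iB : Integrable (fun z => ∑ j, ∑ k, G [k, j] x * (v z k * v z j)) μ :=
    integrable_finsetSum _ fun j _ => integrable_finsetSum _ fun k _ => (i2 j k).const_mul _
  have mA : ∫ z, ∑ j, G [j] x * v z j ∂μ = e * ∑ j, x j * G [j] x := by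
    rw [integral_finsetSum _ fun j _ => (i1 j).const_mul _, Finset.mul_sum]
    refine Finset.sum_congr rfl fun j _ => ?_
    rw [integral_const_mul, m1]; ring
  have mB : ∫ z, ∑ j, ∑ k, G [k, j] x * (v z k * v z j) ∂μ = e ^ 2 * (∑ j, ∑ k, G [k, j] x * x k * x j) +
      (1 - Real.exp (-2 * h)) * ∑ j, ∑ k, G [k, j] x * S k j := by
    rw [integral_finsetSum _ fun j _ => integrable_finsetSum _ fun k _ => (i2 j k).const_mul _,
      Finset.mul_sum, Finset.mul_sum, ← Finset.sum_add_distrib]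
    refine Finset.sum_congr rfl fun j _ => ?_
    rw [integral_finsetSum _ fun k _ => (i2 j k).const_mul _, Finset.mul_sum, Finset.mul_sum,
      ← Finset.sum_add_distrib]
    refine Finset.sum_congr rfl fun k _ => ?_
    rw [integral_const_mul, m2, hα2]; ring
  have hT : ∀ z, |G [] (x + v z) - G [] x - ∑ j, G [j] x * v z j
      - 1 / 2 * ∑ j, ∑ k, G [k, j] x * (v z k * v z j)| ≤ (h * √h) * (d ^ 3 * M * (‖x‖ + 2 * ‖z‖) ^ 3) := by
    intro z
    have t := taylor3 hG (fun js hj => hM js hj.le) x (v z)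
    simp only [mul_assoc] at t ⊢
    refine t.trans ?_
    have hsq : √h * √h = h := Real.mul_self_sqrt h0.le
    have hs0 : 0 < √h := Real.sqrt_pos.2 h0
    have hs1 : √h ≤ 1 := Real.sqrt_le_one.2 h1
    have he' : |e| ≤ √h := by
      have a1 := Real.add_one_le_exp (-h)
      have a2 : Real.exp (-h) ≤ 1 := Real.exp_le_one_iff.2 (by linarith)
      rw [abs_le]; constructor
      · nlinarith
      · linarith
    have hα' : |α| ≤ 2 * √h := by
      rw [abs_of_nonneg (Real.sqrt_nonneg _)]
      apply Real.sqrt_le_iff.2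
      refine ⟨by positivity, ?_⟩
      have := Real.add_one_le_exp (-2 * h)
      nlinarith
    have hvn : ‖v z‖ ≤ √h * (‖x‖ + 2 * ‖z‖) := by
      calc ‖v z‖ ≤ ‖e • x‖ + ‖α • z‖ := norm_add_le _ _
        _ = |e| * ‖x‖ + |α| * ‖z‖ := by rw [norm_smul, norm_smul, Real.norm_eq_abs, Real.norm_eq_abs]
        _ ≤ √h * ‖x‖ + 2 * √h * ‖z‖ := by gcongr
        _ = _ := by ring
    calc (d:ℝ) ^ 3 * (M * ‖v z‖ ^ 3) ≤ (d:ℝ) ^ 3 * (M * (√h * (‖x‖ + 2 * ‖z‖)) ^ 3) := by gcongr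
      _ = (√h * √h) * (√h * (d ^ 3 * (M * (‖x‖ + 2 * ‖z‖) ^ 3))) := by ring
      _ = _ := by rw [hsq]
  have fin : |∫ z, (G [] (x + v z) - G [] x - ∑ j, G [j] x * v z j
      - 1 / 2 * ∑ j, ∑ k, G [k, j] x * (v z k * v z j)) ∂μ| ≤
      ∫ z, (h * √h) * (d ^ 3 * M * (‖x‖ + 2 * ‖z‖) ^ 3) ∂μ := by
    rw [← Real.norm_eq_abs]
    exact norm_integral_le_of_norm_le ((hintg.const_mul _).const_mul _) (Filter.Eventually.of_forall hT)
  rw [integral_sub4 i0 (integrable_const _) iA (iB.const_mul _),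
    integral_const_mul, integral_const_mul, integral_const_mul, mA, mB] at fin
  simp only [integral_const, probReal_univ, one_smul] at fin
  simp only [hxv]
  calc _ = _ := by congr 1; ring
    _ ≤ _ := fin
    _ = _ := by ring

lemma right_deriv_of_small {f : ℝ → ℝ} {c1 c2 c3 K f0 : ℝ} (hf0 : f 0 = f0)
    (h : ∀ h, 0 < h → h ≤ 1 → |f h - f0 - (Real.exp (-h) - 1) * c1 -
      1 / 2 * ((Real.exp (-h) - 1) ^ 2 * c2) - 1 / 2 * ((1 - Real.exp (-2 * h)) * c3)| ≤ K * (h * √h)) :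
    HasDerivWithinAt f (c3 - c1) (Set.Ioi 0) 0 := by
  set q : ℝ → ℝ := fun h => f0 + (Real.exp (-h) - 1) * c1 +
      1 / 2 * ((Real.exp (-h) - 1) ^ 2 * c2) + 1 / 2 * ((1 - Real.exp (-2 * h)) * c3) with hq
  have hqd : HasDerivAt q (c3 - c1) 0 := by
    have e1 : HasDerivAt (fun h : ℝ => Real.exp (-h) - 1) (-1) 0 :=
      (((hasDerivAt_neg (0:ℝ)).exp).sub_const 1).congr_deriv (by simp)
    have e2 : HasDerivAt (fun h : ℝ => 1 - Real.exp (-2 * h)) 2 0 :=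
      ((((hasDerivAt_id (0:ℝ)).const_mul (-2)).exp).const_sub 1).congr_deriv (by simp)
    refine ((((e1.mul_const c1).const_add f0).add (((e1.pow 2).mul_const c2).const_mul (1/2))).add
      ((e2.mul_const c3).const_mul (1/2))).congr_deriv ?_
    simp; ring
  have hr : HasDerivWithinAt (fun h => f h - q h) 0 (Set.Ioi 0) 0 := by
    rw [hasDerivWithinAt_iff_isLittleO]
    have h0 : f 0 - q 0 = 0 := by simp [hq, hf0]
    simp only [h0, sub_zero, smul_zero]
    have hO : (fun h => f h - q h) =O[nhdsWithin 0 (Set.Ioi 0)] (fun h : ℝ => h * √h) := by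
      refine Asymptotics.IsBigO.of_bound |K| ?_
      have : Set.Ioo (0:ℝ) 1 ∈ nhdsWithin (0:ℝ) (Set.Ioi 0) := Ioo_mem_nhdsGT zero_lt_one
      filter_upwards [this] with t ht
      have h1 := h t ht.1 ht.2.le
      rw [Real.norm_eq_abs, Real.norm_eq_abs, abs_of_nonneg (a := t * √t) (mul_nonneg ht.1.le (Real.sqrt_nonneg _))]
      have h2 : f t - q t = f t - f0 - (Real.exp (-t) - 1) * c1 -
        1 / 2 * ((Real.exp (-t) - 1) ^ 2 * c2) - 1 / 2 * ((1 - Real.exp (-2 * t)) * c3) := by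
        simp only [hq]; ring
      rw [h2]
      exact h1.trans (mul_le_mul_of_nonneg_right (le_abs_self K) (mul_nonneg ht.1.le (Real.sqrt_nonneg _)))
    refine hO.trans_isLittleO ?_
    have : (fun h : ℝ => √h) =o[nhdsWithin 0 (Set.Ioi 0)] (fun _ => (1:ℝ)) := by
      rw [Asymptotics.isLittleO_one_iff]
      have : Filter.Tendsto (fun h : ℝ => √h) (nhds 0) (nhds (√0)) := Real.continuous_sqrt.tendsto 0
      rw [Real.sqrt_zero] at this
      exact this.mono_left nhdsWithin_le_nhds
    simpa using (Asymptotics.isBigO_refl (fun h : ℝ => h) _).mul_isLittleO this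
  have := hr.add hqd.hasDerivWithinAt (s := Set.Ioi 0)
  refine (this.congr_deriv (zero_add _)).congr (fun t _ => ?_) ?_
  · simp
  · simp

end

section

def aS (s : ℝ) : ℝ := √(1 - Real.exp (-2 * s))
def tau (σ s : ℝ) : ℝ := aS s * σ
def kap (σ s : ℝ) : ℝ := Real.exp (-s) / (aS s * σ)

lemma aS_pos {s : ℝ} (hs : 0 < s) : 0 < aS s := by
  apply Real.sqrt_pos.2
  have : Real.exp (-2 * s) < 1 := by rw [← Real.exp_zero]; exact Real.exp_lt_exp.2 (by linarith)
  linarith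

lemma aS_sq {s : ℝ} (hs : 0 ≤ s) : aS s ^ 2 = 1 - Real.exp (-2 * s) := by
  unfold aS
  rw [Real.sq_sqrt]
  have : Real.exp (-2 * s) ≤ 1 := Real.exp_le_one_iff.2 (by linarith)
  linarith

lemma aS_mono {s t : ℝ} (h : t ≤ s) : aS t ≤ aS s := by
  unfold aS
  apply Real.sqrt_le_sqrt
  have : Real.exp (-2 * s) ≤ Real.exp (-2 * t) := Real.exp_le_exp.2 (by linarith)
  linarith

lemma aS_cont : Continuous aS := by unfold aS; fun_prop

lemma aS_tendsto : Filter.Tendsto aS Filter.atTop (nhds 1) := by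
  have h1 : Filter.Tendsto (fun s : ℝ => Real.exp (-2 * s)) Filter.atTop (nhds 0) :=
    Real.tendsto_exp_atBot.comp (Filter.tendsto_id.const_mul_atTop_of_neg (by norm_num))
  have := (h1.const_sub 1).sqrt
  rw [sub_zero, Real.sqrt_one] at this
  exact this

lemma tau_pos {σ s : ℝ} (hσ : 0 < σ) (hs : 0 < s) : 0 < tau σ s := mul_pos (aS_pos hs) hσ
lemma kap_pos {σ s : ℝ} (hσ : 0 < σ) (hs : 0 < s) : 0 < kap σ s := div_pos (Real.exp_pos _) (tau_pos hσ hs)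

lemma kap_le {σ s t : ℝ} (hσ : 0 < σ) (ht : 0 < t) (h : t ≤ s) :
    kap σ s ≤ Real.exp (-s) / (aS t * σ) := by
  unfold kap
  have := aS_pos ht
  have := aS_mono h
  gcongr

variable {d : ℕ} {a b : Fin d → EReal} {σ : ℝ} {S : Matrix (Fin d) (Fin d) ℝ}

/-- The residual covariance measure. -/
def rmu (S : Matrix (Fin d) (Fin d) ℝ) (σ : ℝ) : Measure (Fin d → ℝ) :=
  mg d (S - σ ^ 2 • (1 : Matrix (Fin d) (Fin d) ℝ))

instance : IsProbabilityMeasure (rmu S σ) := by unfold rmu; infer_instance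

/-- Space derivatives of the semigroup applied to the box indicator. -/
def DD (a b : Fin d → EReal) (σ : ℝ) (S : Matrix (Fin d) (Fin d) ℝ) (js : List (Fin d)) (s : ℝ)
    (x : Fin d → ℝ) : ℝ := kap σ s ^ js.length * HH a b σ (rmu S σ) js (tau σ s) (kap σ s • x)

/-- Uniform bound for all `Ml`. -/
def UB (a b : Fin d → EReal) (B : ℝ) : Prop :=
  ∀ js : List (Fin d), js.length ≤ 3 → ∀ τ, 0 < τ → ∀ y, |Ml a b τ js y| ≤ B

lemma DD_hasFDerivAt {B : ℝ} (hB : UB a b B) (hσ : 0 < σ) {s : ℝ} (hs : 0 < s) {js : List (Fin d)}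
    (hl : js.length ≤ 2) (x : Fin d → ℝ) :
    HasFDerivAt (DD a b σ S js s) (∑ j, DD a b σ S (j :: js) s x •
      (ContinuousLinearMap.proj j : (Fin d → ℝ) →L[ℝ] ℝ)) x := by
  have h1 : HasFDerivAt (fun x : Fin d → ℝ => kap σ s • x)
      (kap σ s • ContinuousLinearMap.id ℝ (Fin d → ℝ)) x := (hasFDerivAt_id x).const_smul (kap σ s)
  have h2 := ((HH_hasFDerivAt (σ := σ) (μ := rmu S σ) (fun js h => hB js h (tau σ s) (tau_pos hσ hs)) hl
    (kap σ s • x)).comp x h1).const_mul (kap σ s ^ js.length)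
  refine h2.congr_fderiv ?_
  ext v
  simp only [_root_.smul_apply, ContinuousLinearMap.comp_apply, _root_.sum_apply,
    ContinuousLinearMap.proj_apply, ContinuousLinearMap.id_apply, smul_eq_mul, List.length_cons,
    Finset.mul_sum, Pi.smul_apply, DD]
  refine Finset.sum_congr rfl fun j _ => ?_
  ring

lemma DD_abs_le {B : ℝ} (hB : UB a b B) (hσ : 0 < σ) {s : ℝ} (hs : 0 < s) {js : List (Fin d)}
    (hl : js.length ≤ 3) (x : Fin d → ℝ) : |DD a b σ S js s x| ≤ kap σ s ^ js.length * B := by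
  unfold DD
  have hk := kap_pos hσ hs
  rw [abs_mul, abs_of_nonneg (by positivity : 0 ≤ kap σ s ^ js.length)]
  gcongr
  exact HH_abs_le (fun y => hB js hl _ (tau_pos hσ hs) y) _

lemma DD_contOn {B : ℝ} (hB : UB a b B) (hσ : 0 < σ) {js : List (Fin d)}
    (hl : js.length ≤ 3) (x : Fin d → ℝ) : ContinuousOn (fun s => DD a b σ S js s x) (Set.Ioi 0) := by
  have hk : ContinuousOn (kap σ) (Set.Ioi 0) := by
    unfold kap
    refine ContinuousOn.div (by fun_prop) ((aS_cont.mul continuous_const).continuousOn) ?_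
    intro s hs
    exact (tau_pos hσ hs).ne'
  have ht : ContinuousOn (tau σ) (Set.Ioi 0) := (aS_cont.mul continuous_const).continuousOn
  unfold DD
  refine (hk.pow _).mul ?_
  have h := HH_contOn (σ := σ) (μ := rmu S σ) (js := js) (fun τ hτ y => hB js hl τ hτ y)
  have hg : ContinuousOn (fun s => (tau σ s, kap σ s • x)) (Set.Ioi 0) :=
    ht.prodMk (hk.smul continuousOn_const)
  have := h.comp hg (fun s hs => tau_pos hσ hs)
  exact this

lemma DD_rep (hS : S.PosDef) (hσ : 0 < σ)
    (hP : (S - σ ^ 2 • (1 : Matrix (Fin d) (Fin d) ℝ)).PosSemidef) {s : ℝ} (hs : 0 < s) (x : Fin d → ℝ) :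
    ∫ z, (Bx a b).indicator (fun _ => (1:ℝ)) (Real.exp (-s) • x + aS s • z) ∂(mg d S) = DD a b σ S [] s x := by
  rw [rep hS hσ hP _ (aS_pos hs)]
  simp [DD, rmu, tau, kap]

lemma DD_tendsto {B : ℝ} (hB : UB a b B) (hS : S.PosDef) (hσ : 0 < σ)
    (hP : (S - σ ^ 2 • (1 : Matrix (Fin d) (Fin d) ℝ)).PosSemidef) (x : Fin d → ℝ) :
    Filter.Tendsto (fun s => DD a b σ S [] s x) Filter.atTop (nhds ((mg d S (Bx a b)).toReal)) := by
  have h0 := rep (a := a) (b := b) hS hσ hP 0 zero_lt_one x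
  simp only [zero_smul, one_smul, zero_add, zero_div, one_mul] at h0
  rw [integral_indicator_const _ (Bx_meas a b)] at h0
  simp only [smul_eq_mul, mul_one, Measure.real] at h0
  rw [h0]
  have h := HH_contOn (σ := σ) (μ := rmu S σ) (js := []) (fun τ hτ y => hB [] (by simp) τ hτ y)
  have hop : IsOpen {p : ℝ × (Fin d → ℝ) | 0 < p.1} := isOpen_lt continuous_const continuous_fst
  have hc := h.continuousAt (x := (σ, (0 : Fin d → ℝ))) (hop.mem_nhds hσ)
  have ht : Filter.Tendsto (tau σ) Filter.atTop (nhds σ) := by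
    have := aS_tendsto.mul_const σ
    rw [one_mul] at this
    exact this
  have hk : Filter.Tendsto (kap σ) Filter.atTop (nhds 0) := by
    have h1 : Filter.Tendsto (fun s : ℝ => Real.exp (-s)) Filter.atTop (nhds 0) := Real.tendsto_exp_neg_atTop_nhds_zero
    have := h1.div ht hσ.ne'
    rw [zero_div] at this
    exact this
  have hk2 : Filter.Tendsto (fun s => kap σ s • x) Filter.atTop (nhds 0) := by
    simpa using hk.smul_const x
  have h3 : Filter.Tendsto (fun s => (tau σ s, kap σ s • x)) Filter.atTop (nhds (σ, 0)) := ht.prodMk_nhds hk2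
  have := hc.tendsto.comp h3
  simpa [DD, Function.comp_def, rmu] using this

lemma DD_semigroup (hS : S.PosDef) (hσ : 0 < σ)
    (hP : (S - σ ^ 2 • (1 : Matrix (Fin d) (Fin d) ℝ)).PosSemidef) {s h : ℝ} (hs : 0 < s) (hh : 0 < h)
    (x : Fin d → ℝ) :
    DD a b σ S [] (s + h) x = ∫ z, DD a b σ S [] s (Real.exp (-h) • x + aS h • z) ∂(mg d S) := by
  rw [← DD_rep hS hσ hP (by positivity)]
  have e1 : Real.exp (-(s + h)) = Real.exp (-s) * Real.exp (-h) := by rw [← Real.exp_add]; ring_nf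
  have h1 := mg_comb_integral hS.posSemidef hS.posSemidef hS.posSemidef (α := aS s) (β := Real.exp (-s) * aS h)
    (c := aS (s + h)) (by
      rw [← add_smul]; congr 1
      rw [mul_pow, aS_sq hs.le, aS_sq hh.le, aS_sq (by positivity)]
      have e2 : Real.exp (-2 * (s + h)) = Real.exp (-2 * s) * Real.exp (-2 * h) := by
        rw [← Real.exp_add]; ring_nf
      have e3 : Real.exp (-2 * s) = Real.exp (-s) ^ 2 := by
        rw [← Real.exp_nat_mul]; push_cast; ring_nf
      rw [e2, e3]; ring)
    (f := fun z => (Bx a b).indicator (fun _ => (1:ℝ)) (Real.exp (-(s + h)) • x + z))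
    ((measurable_const.indicator (Bx_meas a b)).comp (by fun_prop)) (K := 1)
    (fun z => by
      by_cases hz : Real.exp (-(s + h)) • x + z ∈ Bx a b
      · rw [Set.indicator_of_mem hz]; simp
      · rw [Set.indicator_of_notMem hz]; simp)
  rw [← h1]
  refine integral_congr_ae (Filter.Eventually.of_forall fun z => ?_)
  simp only
  rw [← DD_rep hS hσ hP hs]
  refine integral_congr_ae (Filter.Eventually.of_forall fun z' => ?_)
  simp only
  congr 1
  rw [e1]
  ext i
  simp only [Pi.add_apply, Pi.smul_apply, smul_eq_mul]
  ring

/-- The generator applied to the semigroup. -/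
def LTs (a b : Fin d → EReal) (σ : ℝ) (S : Matrix (Fin d) (Fin d) ℝ) (s : ℝ) (x : Fin d → ℝ) : ℝ :=
  ∑ j, ∑ k, DD a b σ S [k, j] s x * S k j - ∑ j, x j * DD a b σ S [j] s x

lemma DD_right_deriv {B : ℝ} (hB0 : 0 ≤ B) (hB : UB a b B) (hS : S.PosDef) (hσ : 0 < σ)
    (hP : (S - σ ^ 2 • (1 : Matrix (Fin d) (Fin d) ℝ)).PosSemidef) {s : ℝ} (hs : 0 < s) (x : Fin d → ℝ) :
    HasDerivWithinAt (fun s => DD a b σ S [] s x) (LTs a b σ S s x) (Set.Ioi s) s := by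
  have hk := kap_pos hσ hs
  obtain ⟨K, hK⟩ := mehler_small (M := (1 + kap σ s) ^ 3 * B) hS.posSemidef (by positivity)
    (fun js hl y => DD_hasFDerivAt (S := S) hB hσ hs hl y)
    (fun js hl y => (DD_abs_le (S := S) hB hσ hs hl y).trans (by
      gcongr
      calc kap σ s ^ js.length ≤ (1 + kap σ s) ^ js.length := by gcongr; linarith
        _ ≤ _ := by gcongr; linarith)) x
  have h := right_deriv_of_small (f := fun h => DD a b σ S [] (s + h) x) (f0 := DD a b σ S [] s x)
    (c1 := ∑ j, x j * DD a b σ S [j] s x) (c2 := ∑ j, ∑ k, DD a b σ S [k, j] s x * x k * x j)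
    (c3 := ∑ j, ∑ k, DD a b σ S [k, j] s x * S k j) (K := K) (by simp) (fun h h0 h1 => by
      have := hK h h0 h1
      rw [DD_semigroup hS hσ hP hs h0]
      exact this)
  have h2 : HasDerivWithinAt (fun u : ℝ => u - s) 1 (Set.Ioi s) s :=
    ((hasDerivAt_id s).sub_const s).hasDerivWithinAt
  have h3 := HasDerivWithinAt.scomp (g₁ := fun h => DD a b σ S [] (s + h) x) (h := fun u : ℝ => u - s) s
    (t' := Set.Ioi 0) (by simpa using h) h2 (fun u hu => by simpa using hu)
  simpa [Function.comp_def, LTs] using h3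

end

section

/-- `1 - e^{-s}`. -/
def pE (s : ℝ) : ℝ := 1 - Real.exp (-s)

lemma pE_pos {s : ℝ} (hs : 0 < s) : 0 < pE s := by
  unfold pE
  have : Real.exp (-s) < 1 := by rw [← Real.exp_zero]; exact Real.exp_lt_exp.2 (by linarith)
  linarith

lemma pE_ge {t : ℝ} (ht : 0 < t) : t / (1 + t) ≤ pE t := by
  unfold pE
  have h := Real.add_one_le_exp t
  have : Real.exp (-t) ≤ 1 / (1 + t) := by
    rw [Real.exp_neg, one_div]
    exact inv_anti₀ (by linarith) (by linarith)
  have e : t / (1 + t) = 1 - 1 / (1 + t) := by field_simp; ring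
  linarith

lemma pE_hasDerivAt (s : ℝ) : HasDerivAt pE (Real.exp (-s)) s :=
  (((hasDerivAt_neg s).exp).const_sub 1).congr_deriv (by simp)

lemma pE_tendsto : Filter.Tendsto pE Filter.atTop (nhds 1) := by
  have := (Real.tendsto_exp_neg_atTop_nhds_zero).const_sub 1
  rw [sub_zero] at this
  exact this

lemma int1 {t : ℝ} (ht : 0 < t) : IntegrableOn (fun s => Real.exp (-s) / √(pE s) ^ 1) (Set.Ioi t) ∧
    ∫ s in Set.Ioi t, Real.exp (-s) / √(pE s) ^ 1 ≤ 2 := by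
  have hd : ∀ s ∈ Set.Ici t, HasDerivAt (fun s => 2 * √(pE s)) (Real.exp (-s) / √(pE s) ^ 1) s := by
    intro s hs
    have hp := pE_pos (ht.trans_le hs)
    refine (((pE_hasDerivAt s).sqrt hp.ne').const_mul 2).congr_deriv ?_
    have := Real.sqrt_pos.2 hp
    field_simp
  have hn : ∀ s ∈ Set.Ioi t, 0 ≤ Real.exp (-s) / √(pE s) ^ 1 := fun s _ => by positivity
  have hl : Filter.Tendsto (fun s => 2 * √(pE s)) Filter.atTop (nhds 2) := by
    simpa using (pE_tendsto.sqrt).const_mul 2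
  refine ⟨integrableOn_Ioi_deriv_of_nonneg' hd hn hl, ?_⟩
  rw [integral_Ioi_of_hasDerivAt_of_nonneg' hd hn hl]
  have := Real.sqrt_nonneg (pE t)
  linarith

lemma int2 {t : ℝ} (ht : 0 < t) : IntegrableOn (fun s => Real.exp (-s) / √(pE s) ^ 2) (Set.Ioi t) ∧
    ∫ s in Set.Ioi t, Real.exp (-s) / √(pE s) ^ 2 ≤ 2 * (|Real.log t| ⊔ 1) := by
  have hd : ∀ s ∈ Set.Ici t, HasDerivAt (fun s => Real.log (pE s)) (Real.exp (-s) / √(pE s) ^ 2) s := by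
    intro s hs
    have hp := pE_pos (ht.trans_le hs)
    refine ((pE_hasDerivAt s).log hp.ne').congr_deriv ?_
    rw [Real.sq_sqrt hp.le]
  have hn : ∀ s ∈ Set.Ioi t, 0 ≤ Real.exp (-s) / √(pE s) ^ 2 := fun s _ => by positivity
  have hl : Filter.Tendsto (fun s => Real.log (pE s)) Filter.atTop (nhds 0) := by
    simpa using pE_tendsto.log one_ne_zero
  refine ⟨integrableOn_Ioi_deriv_of_nonneg' hd hn hl, ?_⟩
  rw [integral_Ioi_of_hasDerivAt_of_nonneg' hd hn hl]
  have h1 : Real.log (t / (1 + t)) ≤ Real.log (pE t) := Real.log_le_log (by positivity) (pE_ge ht)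
  rw [Real.log_div ht.ne' (by linarith)] at h1
  have hm1 := le_max_left |Real.log t| 1
  have hm2 := le_max_right |Real.log t| 1
  have h2 : Real.log 2 ≤ 1 := by have := Real.log_two_lt_d9; linarith
  have h3 : Real.log (1 + t) - Real.log t ≤ 2 * (|Real.log t| ⊔ 1) := by
    rcases le_total t 1 with h | h
    · have h4 : Real.log (1 + t) ≤ Real.log 2 := Real.log_le_log (by linarith) (by linarith)
      have h5 := neg_le_abs (Real.log t)
      linarith
    · have h4 : Real.log (1 + t) ≤ Real.log (2 * t) := Real.log_le_log (by linarith) (by linarith)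
      rw [Real.log_mul (by norm_num) (by linarith)] at h4
      linarith
  linarith

lemma int3 {t : ℝ} (ht : 0 < t) : IntegrableOn (fun s => Real.exp (-s) / √(pE s) ^ 3) (Set.Ioi t) ∧
    ∫ s in Set.Ioi t, Real.exp (-s) / √(pE s) ^ 3 ≤ 2 * (√t)⁻¹ := by
  have hd : ∀ s ∈ Set.Ici t, HasDerivAt (fun s => -2 * (√(pE s))⁻¹) (Real.exp (-s) / √(pE s) ^ 3) s := by
    intro s hs
    have hp := pE_pos (ht.trans_le hs)
    have h0 := Real.sqrt_pos.2 hp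
    refine ((((pE_hasDerivAt s).sqrt hp.ne').inv h0.ne').const_mul (-2)).congr_deriv ?_
    field_simp
  have hn : ∀ s ∈ Set.Ioi t, 0 ≤ Real.exp (-s) / √(pE s) ^ 3 := fun s _ => by positivity
  have hl : Filter.Tendsto (fun s => -2 * (√(pE s))⁻¹) Filter.atTop (nhds (-2)) := by
    have := ((pE_tendsto.sqrt).inv₀ (by simp)).const_mul (-2)
    simpa using this
  refine ⟨integrableOn_Ioi_deriv_of_nonneg' hd hn hl, ?_⟩
  rw [integral_Ioi_of_hasDerivAt_of_nonneg' hd hn hl]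
  have h0 := Real.sqrt_pos.2 (pE_pos ht)
  have hst := Real.sqrt_pos.2 ht
  have hsq : √t ^ 2 = t := Real.sq_sqrt ht.le
  have h1 : √t / (1 + √t) ≤ √(pE t) := by
    apply Real.le_sqrt_of_sq_le
    refine le_trans ?_ (pE_ge ht)
    rw [div_pow, hsq]
    gcongr
    nlinarith
  have h2 : (√(pE t))⁻¹ ≤ (√t / (1 + √t))⁻¹ := inv_anti₀ (by positivity) h1
  have h3 : (√t / (1 + √t))⁻¹ = (√t)⁻¹ + 1 := by field_simp
  rw [h3] at h2
  linarith

lemma kap_pow_le {σ s : ℝ} (hσ : 0 < σ) (hs : 0 < s) {m : ℕ} (hm : 1 ≤ m) :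
    kap σ s ^ m ≤ σ⁻¹ ^ m * (Real.exp (-s) / √(pE s) ^ m) := by
  have h1 : √(pE s) ≤ aS s := by
    apply Real.sqrt_le_sqrt
    unfold pE
    have : Real.exp (-2 * s) ≤ Real.exp (-s) := Real.exp_le_exp.2 (by linarith)
    linarith
  have h2 : Real.exp (-s) ^ m ≤ Real.exp (-s) := by
    have h3 : Real.exp (-s) ≤ 1 := Real.exp_le_one_iff.2 (by linarith)
    calc _ ≤ Real.exp (-s) ^ 1 := pow_le_pow_of_le_one (Real.exp_pos _).le h3 hm
      _ = _ := pow_one _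
  have h0 := Real.sqrt_pos.2 (pE_pos hs)
  calc kap σ s ^ m = σ⁻¹ ^ m * (Real.exp (-s) ^ m / aS s ^ m) := by
        unfold kap; rw [div_pow, mul_pow, inv_pow]; field_simp
    _ ≤ _ := by gcongr

variable {d : ℕ} {a b : Fin d → EReal} {σ : ℝ} {S : Matrix (Fin d) (Fin d) ℝ}

lemma DD_exp_bound {B : ℝ} (hB0 : 0 ≤ B) (hB : UB a b B) (hσ : 0 < σ) {t : ℝ} (ht : 0 < t) :
    ∃ K, 0 ≤ K ∧ ∀ js : List (Fin d), 1 ≤ js.length → js.length ≤ 3 → ∀ s, t ≤ s → ∀ x,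
      |DD a b σ S js s x| ≤ K * Real.exp (-s) := by
  set c := (aS t * σ)⁻¹ with hc
  have hc0 : 0 < c := inv_pos.2 (tau_pos hσ ht)
  refine ⟨(1 + c) ^ 3 * B, by positivity, fun js h1 h3 s hs x => ?_⟩
  have hs0 : 0 < s := ht.trans_le hs
  refine (DD_abs_le hB hσ hs0 h3 x).trans ?_
  have hk := kap_pos hσ hs0
  have hk1 : kap σ s ≤ Real.exp (-s) * c := by
    have := kap_le hσ ht hs
    rwa [div_eq_mul_inv] at this
  have he : Real.exp (-s) ^ js.length ≤ Real.exp (-s) := by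
    have h3 : Real.exp (-s) ≤ 1 := Real.exp_le_one_iff.2 (by linarith)
    calc _ ≤ Real.exp (-s) ^ 1 := pow_le_pow_of_le_one (Real.exp_pos _).le h3 h1
      _ = _ := pow_one _
  have hk2 : kap σ s ^ js.length ≤ Real.exp (-s) * (1 + c) ^ 3 := by
    calc _ ≤ (Real.exp (-s) * c) ^ js.length := by gcongr
      _ = Real.exp (-s) ^ js.length * c ^ js.length := mul_pow _ _ _
      _ ≤ Real.exp (-s) * (1 + c) ^ js.length := by gcongr; linarith
      _ ≤ Real.exp (-s) * (1 + c) ^ 3 := by gcongr; linarith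
  calc _ ≤ Real.exp (-s) * (1 + c) ^ 3 * B := by gcongr
    _ = _ := by ring

lemma expInt (K t : ℝ) : IntegrableOn (fun s => K * Real.exp (-s)) (Set.Ioi t) := by
  have := (integrableOn_exp_neg_Ioi t).const_mul K
  exact this

lemma DD_aesm {B : ℝ} (hB : UB a b B) (hσ : 0 < σ) {js : List (Fin d)} (hl : js.length ≤ 3)
    {t : ℝ} (ht : 0 < t) (x : Fin d → ℝ) :
    AEStronglyMeasurable (fun s => DD a b σ S js s x) (volume.restrict (Set.Ioi t)) :=
  ((DD_contOn hB hσ hl x).mono (Set.Ioi_subset_Ioi ht.le)).aestronglyMeasurable measurableSet_Ioi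

lemma DD_integrableOn {B : ℝ} (hB0 : 0 ≤ B) (hB : UB a b B) (hσ : 0 < σ) {js : List (Fin d)}
    (h1 : 1 ≤ js.length) (hl : js.length ≤ 3) {t : ℝ} (ht : 0 < t) (x : Fin d → ℝ) :
    IntegrableOn (fun s => DD a b σ S js s x) (Set.Ioi t) := by
  obtain ⟨K, hK0, hK⟩ := DD_exp_bound (S := S) hB0 hB hσ ht
  refine Integrable.mono' (expInt K t) (DD_aesm hB hσ hl ht x) ?_
  filter_upwards [ae_restrict_mem measurableSet_Ioi] with s hs
  exact hK js h1 hl s (le_of_lt hs) x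

lemma LTs_contOn {B : ℝ} (hB : UB a b B) (hσ : 0 < σ) (x : Fin d → ℝ) :
    ContinuousOn (fun s => LTs a b σ S s x) (Set.Ioi 0) := by
  unfold LTs
  refine ContinuousOn.sub ?_ ?_
  · exact continuousOn_finsetSum _ fun j _ => continuousOn_finsetSum _ fun k _ =>
      (DD_contOn hB hσ (by simp) x).mul continuousOn_const
  · exact continuousOn_finsetSum _ fun j _ => continuousOn_const.mul (DD_contOn hB hσ (by simp) x)

lemma LTs_bound {B : ℝ} (hB0 : 0 ≤ B) (hB : UB a b B) (hσ : 0 < σ) {t : ℝ} (ht : 0 < t) (x : Fin d → ℝ) :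
    ∃ K, 0 ≤ K ∧ ∀ s, t ≤ s → |LTs a b σ S s x| ≤ K * Real.exp (-s) := by
  obtain ⟨K, hK0, hK⟩ := DD_exp_bound (S := S) hB0 hB hσ ht
  refine ⟨∑ j, ∑ k, K * |S k j| + ∑ j, |x j| * K, by positivity, fun s hs => ?_⟩
  unfold LTs
  refine (abs_sub _ _).trans ?_
  rw [add_mul]
  gcongr
  · rw [Finset.sum_mul]
    refine (Finset.abs_sum_le_sum_abs _ _).trans (Finset.sum_le_sum fun j _ => ?_)
    rw [Finset.sum_mul]
    refine (Finset.abs_sum_le_sum_abs _ _).trans (Finset.sum_le_sum fun k _ => ?_)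
    rw [abs_mul]
    have := hK [k, j] (by simp) (by simp) s hs x
    have h2 := abs_nonneg (S k j)
    nlinarith
  · rw [Finset.sum_mul]
    refine (Finset.abs_sum_le_sum_abs _ _).trans (Finset.sum_le_sum fun j _ => ?_)
    rw [abs_mul]
    have := hK [j] (by simp) (by simp) s hs x
    have h2 := abs_nonneg (x j)
    nlinarith

lemma LTs_integrableOn {B : ℝ} (hB0 : 0 ≤ B) (hB : UB a b B) (hσ : 0 < σ) {t : ℝ} (ht : 0 < t)
    (x : Fin d → ℝ) : IntegrableOn (fun s => LTs a b σ S s x) (Set.Ioi t) := by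
  obtain ⟨K, hK0, hK⟩ := LTs_bound (S := S) hB0 hB hσ ht x
  refine Integrable.mono' (expInt K t) (((LTs_contOn hB hσ x).mono
    (Set.Ioi_subset_Ioi ht.le)).aestronglyMeasurable measurableSet_Ioi) ?_
  filter_upwards [ae_restrict_mem measurableSet_Ioi] with s hs
  exact hK s (le_of_lt hs)

lemma T_eq {B : ℝ} (hB0 : 0 ≤ B) (hB : UB a b B) (hS : S.PosDef) (hσ : 0 < σ)
    (hP : (S - σ ^ 2 • (1 : Matrix (Fin d) (Fin d) ℝ)).PosSemidef) {s : ℝ} (hs : 0 < s) (x : Fin d → ℝ) :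
    DD a b σ S [] s x - (mg d S (Bx a b)).toReal = -∫ u in Set.Ioi s, LTs a b σ S u x := by
  have h1 := intervalIntegral_tendsto_integral_Ioi s (LTs_integrableOn (S := S) hB0 hB hσ hs x) Filter.tendsto_id
  have h2 : Filter.Tendsto (fun R => DD a b σ S [] R x - DD a b σ S [] s x) Filter.atTop
      (nhds ((mg d S (Bx a b)).toReal - DD a b σ S [] s x)) :=
    (DD_tendsto hB hS hσ hP x).sub_const _
  have h3 : (fun R => ∫ u in s..(id R), LTs a b σ S u x) =ᶠ[Filter.atTop]
      (fun R => DD a b σ S [] R x - DD a b σ S [] s x) := by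
    filter_upwards [Filter.eventually_ge_atTop s] with R hR
    have hsub : Set.uIcc s R ⊆ Set.Ioi 0 := by
      rw [Set.uIcc_of_le hR]
      exact fun u hu => hs.trans_le hu.1
    refine intervalIntegral.integral_eq_sub_of_hasDeriv_right
      (f := fun u => DD a b σ S [] u x) (f' := fun u => LTs a b σ S u x) ?_ ?_ ?_
    · exact (DD_contOn hB hσ (by simp) x).mono hsub
    · intro u hu
      have hu1 : s < u := by
        have h9 := hu.1
        simp only [id] at h9
        rwa [min_eq_left hR] at h9
      exact DD_right_deriv hB0 hB hS hσ hP (hs.trans hu1) x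
    · exact ((LTs_contOn hB hσ x).mono hsub).intervalIntegrable
  have := tendsto_nhds_unique (h1.congr' h3) h2
  rw [this]; ring

lemma T_integrableOn {B : ℝ} (hB0 : 0 ≤ B) (hB : UB a b B) (hS : S.PosDef) (hσ : 0 < σ)
    (hP : (S - σ ^ 2 • (1 : Matrix (Fin d) (Fin d) ℝ)).PosSemidef) {t : ℝ} (ht : 0 < t) (x : Fin d → ℝ) :
    IntegrableOn (fun s => DD a b σ S [] s x - (mg d S (Bx a b)).toReal) (Set.Ioi t) := by
  obtain ⟨K, hK0, hK⟩ := LTs_bound (S := S) hB0 hB hσ ht x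
  refine Integrable.mono' (expInt K t) ((DD_aesm hB hσ (by simp) ht x).sub aestronglyMeasurable_const) ?_
  filter_upwards [ae_restrict_mem measurableSet_Ioi] with s hs
  have hs' : t < s := hs
  rw [T_eq hB0 hB hS hσ hP (ht.trans hs'), norm_neg]
  calc _ ≤ ∫ u in Set.Ioi s, K * Real.exp (-u) := by
        refine norm_integral_le_of_norm_le (expInt K s) ?_
        filter_upwards [ae_restrict_mem measurableSet_Ioi] with u hu
        exact hK u (hs'.trans hu).le
    _ = K * Real.exp (-s) := by rw [integral_const_mul, integral_exp_neg_Ioi]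

/-- Time integral of the derivative. -/
def Psi (a b : Fin d → EReal) (σ : ℝ) (S : Matrix (Fin d) (Fin d) ℝ) (js : List (Fin d)) (t : ℝ)
    (x : Fin d → ℝ) : ℝ := -∫ s in Set.Ioi t, DD a b σ S js s x

lemma neg_fderiv {d : ℕ} {f : (Fin d → ℝ) → ℝ} {c : Fin d → ℝ} {x : Fin d → ℝ}
    (h : HasFDerivAt f (∑ j, c j • (ContinuousLinearMap.proj j : (Fin d → ℝ) →L[ℝ] ℝ)) x) :
    HasFDerivAt (fun x => - f x) (∑ j, (- c j) • (ContinuousLinearMap.proj j : (Fin d → ℝ) →L[ℝ] ℝ)) x := by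
  refine h.neg.congr_fderiv ?_
  rw [← Finset.sum_neg_distrib]
  exact Finset.sum_congr rfl fun j _ => (neg_smul _ _).symm

lemma psi_pd0 {B : ℝ} (hB0 : 0 ≤ B) (hB : UB a b B) (hS : S.PosDef) (hσ : 0 < σ)
    (hP : (S - σ ^ 2 • (1 : Matrix (Fin d) (Fin d) ℝ)).PosSemidef) {t : ℝ} (ht : 0 < t) (j : Fin d) :
    pd (fun x => -∫ s in Set.Ioi t, (DD a b σ S [] s x - (mg d S (Bx a b)).toReal)) j =
      Psi a b σ S [j] t := by
  obtain ⟨K, hK0, hK⟩ := DD_exp_bound (S := S) hB0 hB hσ ht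
  ext x
  refine pd_of_hasFDerivAt (c := fun j => Psi a b σ S [j] t x) (neg_fderiv ?_) j
  refine hasFDerivAt_integral_proj (f := fun s x => DD a b σ S [] s x - (mg d S (Bx a b)).toReal)
    (f' := fun j s x => DD a b σ S [j] s x) (bd := fun s => K * Real.exp (-s)) x ?_ ?_ ?_ ?_ ?_ ?_
  · exact fun y => (DD_aesm hB hσ (by simp) ht y).sub aestronglyMeasurable_const
  · exact T_integrableOn hB0 hB hS hσ hP ht x
  · exact fun j => DD_aesm hB hσ (by simp) ht x
  · filter_upwards [ae_restrict_mem measurableSet_Ioi] with s hs j y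
    exact hK [j] (by simp) (by simp) s (le_of_lt hs) y
  · exact expInt K t
  · filter_upwards [ae_restrict_mem measurableSet_Ioi] with s hs y
    exact (DD_hasFDerivAt hB hσ (ht.trans hs) (by simp) y).sub_const _

lemma psi_pd1 {B : ℝ} (hB0 : 0 ≤ B) (hB : UB a b B) (hσ : 0 < σ) {js : List (Fin d)} (h1 : 1 ≤ js.length)
    (h2 : js.length ≤ 2) {t : ℝ} (ht : 0 < t) (j : Fin d) :
    pd (Psi a b σ S js t) j = Psi a b σ S (j :: js) t := by
  obtain ⟨K, hK0, hK⟩ := DD_exp_bound (S := S) hB0 hB hσ ht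
  ext x
  refine pd_of_hasFDerivAt (c := fun j => Psi a b σ S (j :: js) t x) (neg_fderiv ?_) j
  have hl : ∀ j : Fin d, (j :: js).length ≤ 3 := fun j => by simp; omega
  refine hasFDerivAt_integral_proj (f := fun s x => DD a b σ S js s x)
    (f' := fun j s x => DD a b σ S (j :: js) s x) (bd := fun s => K * Real.exp (-s)) x ?_ ?_ ?_ ?_ ?_ ?_
  · exact fun y => DD_aesm hB hσ (by omega) ht y
  · exact DD_integrableOn hB0 hB hσ h1 (by omega) ht x
  · exact fun j => DD_aesm hB hσ (hl j) ht x
  · filter_upwards [ae_restrict_mem measurableSet_Ioi] with s hs j y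
    exact hK (j :: js) (by simp) (hl j) s (le_of_lt hs) y
  · exact expInt K t
  · filter_upwards [ae_restrict_mem measurableSet_Ioi] with s hs y
    exact DD_hasFDerivAt hB hσ (ht.trans hs) h2 y

lemma psi_sum_bound {B : ℝ} (hB0 : 0 ≤ B) (hB : UB a b B) (hσ : 0 < σ) {ι : Type*} [Fintype ι]
    {js : ι → List (Fin d)} {m : ℕ} (hm : ∀ i, (js i).length = m) (h1 : 1 ≤ m) (h3 : m ≤ 3) {C : ℝ} (hC0 : 0 ≤ C)
    (hC : ∀ τ, 0 < τ → ∀ y, ∑ i, |Ml a b τ (js i) y| ≤ C) {t I : ℝ} (ht : 0 < t)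
    (hI : IntegrableOn (fun s => Real.exp (-s) / √(pE s) ^ m) (Set.Ioi t) ∧
      ∫ s in Set.Ioi t, Real.exp (-s) / √(pE s) ^ m ≤ I) (x : Fin d → ℝ) :
    ∑ i, |Psi a b σ S (js i) t x| ≤ C * σ⁻¹ ^ m * I := by
  have hintg : ∀ i, IntegrableOn (fun s => DD a b σ S (js i) s x) (Set.Ioi t) := fun i =>
    DD_integrableOn hB0 hB hσ (by rw [hm]; exact h1) (by rw [hm]; exact h3) ht x
  have hpt : ∀ s, 0 < s → ∑ i, |DD a b σ S (js i) s x| ≤ C * (σ⁻¹ ^ m * (Real.exp (-s) / √(pE s) ^ m)) := by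
    intro s hs
    have hk := kap_pos hσ hs
    have e1 : ∀ i, |DD a b σ S (js i) s x| = kap σ s ^ m *
        |∫ z, Ml a b (tau σ s) (js i) (kap σ s • x + σ⁻¹ • z) ∂(rmu S σ)| := by
      intro i
      unfold DD HH
      rw [abs_mul, hm, abs_of_nonneg (by positivity : 0 ≤ kap σ s ^ m)]
    simp_rw [e1]
    rw [← Finset.mul_sum]
    have e2 := sum_abs_integral_le (ν := rmu S σ) Finset.univ
      (f := fun i z => Ml a b (tau σ s) (js i) (kap σ s • x + σ⁻¹ • z)) (B := C)
      (fun i => Ml_shift_integrable (hB (js i) (by rw [hm]; exact h3) _ (tau_pos hσ hs)) _)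
      (fun z => hC _ (tau_pos hσ hs) _)
    calc _ ≤ (σ⁻¹ ^ m * (Real.exp (-s) / √(pE s) ^ m)) * C :=
          mul_le_mul (kap_pow_le hσ hs h1) e2 (Finset.sum_nonneg fun i _ => abs_nonneg _) (by positivity)
      _ = _ := mul_comm _ _
  calc ∑ i, |Psi a b σ S (js i) t x| ≤ ∑ i, ∫ s in Set.Ioi t, |DD a b σ S (js i) s x| := by
        refine Finset.sum_le_sum fun i _ => ?_
        unfold Psi
        rw [abs_neg]
        exact abs_integral_le_integral_abs
    _ = ∫ s in Set.Ioi t, ∑ i, |DD a b σ S (js i) s x| := (integral_finsetSum _ fun i _ => (hintg i).abs).symm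
    _ ≤ ∫ s in Set.Ioi t, C * (σ⁻¹ ^ m * (Real.exp (-s) / √(pE s) ^ m)) := by
        refine setIntegral_mono_on (integrable_finsetSum _ fun i _ => (hintg i).abs)
          ((hI.1.const_mul _).const_mul _) measurableSet_Ioi ?_
        intro s hs
        exact hpt s (ht.trans hs)
    _ = C * σ⁻¹ ^ m * ∫ s in Set.Ioi t, Real.exp (-s) / √(pE s) ^ m := by
        rw [integral_const_mul, integral_const_mul]; ring
    _ ≤ _ := by
        have := hI.2
        gcongr

end

/-- **Solution of the Stein equation and its derivative bounds.** -/
theorem stein_solution_bounds :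
    ∃ C : ℝ, 0 < C ∧
      ∀ (d : ℕ), 3 ≤ d →
      ∀ S : Matrix (Fin d) (Fin d) ℝ, S.PosDef →
      ∀ σs : ℝ, 0 < σs → IsSmallestEigenvalueSq S σs →
      ∀ A : Set (Fin d → ℝ), IsHyperrectangle A →
      ∀ htilde : (Fin d → ℝ) → ℝ,
        htilde = (fun x => Set.indicator A (fun _ => (1 : ℝ)) x -
          (gaussianMeasure d S A).toReal) →
      ∀ T : ℝ → (Fin d → ℝ) → ℝ,
        T = (fun s x => ∫ z, htilde (Real.exp (-s) • x +
          Real.sqrt (1 - Real.exp (-2 * s)) • z) ∂(gaussianMeasure d S)) →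
      ∀ ψ : ℝ → (Fin d → ℝ) → ℝ,
        ψ = (fun t x => -∫ s in Set.Ioi t, T s x ∂volume) →
      ∀ t : ℝ, 0 < t →
        -- `ψ_t` solves the Stein equation
        (∀ w : Fin d → ℝ,
          (∑ j, ∑ k, S j k * pd (pd (ψ t) k) j w) - ∑ j, w j * pd (ψ t) j w
            = T t w) ∧
        -- first-derivative bound
        (∀ x : Fin d → ℝ, ∑ j, |pd (ψ t) j x| ≤
          C * σs⁻¹ * Real.sqrt (Real.log d)) ∧
        -- second-derivative bound
        (∀ x : Fin d → ℝ, ∑ j, ∑ k, |pd (pd (ψ t) k) j x| ≤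
          C * σs⁻¹ ^ 2 * (|Real.log t| ⊔ 1) * Real.log d) ∧
        -- third-derivative bound
        (∀ x : Fin d → ℝ, ∑ j, ∑ k, ∑ l, |pd (pd (pd (ψ t) l) k) j x| ≤
          C * σs⁻¹ ^ 3 * (Real.sqrt t)⁻¹ * (Real.log d) ^ ((3 : ℝ) / 2)) := by
  obtain ⟨B, hB, hM⟩ := Ml_bounds
  refine ⟨2 * B, by positivity, ?_⟩
  intro d hd S hS σ hσ hev A hA htilde hh T hT ψ hψ t ht
  obtain ⟨a, b, hA⟩ := hA
  have hP := posSemidef_sub_smallest hS hev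
  have hAB : A = Bx a b := hA
  rw [gaussianMeasure_eq_mg hS] at hh hT
  have hprob : IsProbabilityMeasure (mg d S) := inferInstance
  set L := √(Real.log d) with hL
  have hL0 : 0 ≤ L := Real.sqrt_nonneg _
  have hd' : (3 : ℝ) ≤ d := by exact_mod_cast hd
  have hlog : 0 ≤ Real.log d := Real.log_nonneg (by linarith)
  have hB0 : 0 ≤ B * (1 + L) ^ 3 := by positivity
  have hUB : UB a b (B * (1 + L) ^ 3) := by
    intro js hjs τ hτ y
    refine ((hM d hd a b τ hτ y).1 js hjs).trans ?_
    refine mul_le_mul_of_nonneg_left ?_ hB.le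
    calc L ^ js.length ≤ (1 + L) ^ js.length := pow_le_pow_left₀ hL0 (by linarith) _
      _ ≤ (1 + L) ^ 3 := pow_le_pow_right₀ (by linarith) hjs
  have hTs : ∀ s, 0 < s → ∀ x, T s x = DD a b σ S [] s x - (mg d S (Bx a b)).toReal := by
    intro s hs x
    rw [← DD_rep hS hσ hP hs x]
    subst hT hh hAB
    have hm : Measurable (fun z : Fin d → ℝ => Real.exp (-s) • x + aS s • z) := by fun_prop
    have hind : Measurable ((Bx a b).indicator (fun _ => (1 : ℝ))) :=
      measurable_const.indicator (Bx_meas a b)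
    have hintg : Integrable (fun z => (Bx a b).indicator (fun _ => (1 : ℝ))
        (Real.exp (-s) • x + aS s • z)) (mg d S) := by
      have hc := hind.comp hm
      refine Integrable.of_bound (C := 1) hc.aestronglyMeasurable (Filter.Eventually.of_forall fun z => ?_)
      by_cases hz : Real.exp (-s) • x + aS s • z ∈ Bx a b <;> simp [hz]
    have h := integral_sub hintg (integrable_const ((mg d S (Bx a b)).toReal))
    rw [integral_const, probReal_univ, one_smul] at h
    exact h
  have hψt : ψ t = fun x => -∫ s in Set.Ioi t, (DD a b σ S [] s x - (mg d S (Bx a b)).toReal) := by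
    subst hψ
    ext x
    refine congrArg Neg.neg ?_
    exact setIntegral_congr_fun measurableSet_Ioi fun s hs => hTs s (ht.trans hs) x
  have p1 : ∀ j, pd (ψ t) j = Psi a b σ S [j] t := by
    intro j
    rw [hψt]
    exact psi_pd0 hB0 hUB hS hσ hP ht j
  have p2 : ∀ j k, pd (pd (ψ t) k) j = Psi a b σ S [j, k] t := by
    intro j k
    rw [p1]
    exact psi_pd1 hB0 hUB hσ (by simp) (by simp) ht j
  have p3 : ∀ j k l, pd (pd (pd (ψ t) l) k) j = Psi a b σ S [j, k, l] t := by
    intro j k l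
    rw [p2]
    exact psi_pd1 hB0 hUB hσ (by simp) (by simp) ht j
  have hI : ∀ js : List (Fin d), 1 ≤ js.length → js.length ≤ 3 → ∀ x,
      Integrable (fun s => DD a b σ S js s x) (volume.restrict (Set.Ioi t)) :=
    fun js h1 h3 x => DD_integrableOn hB0 hUB hσ h1 h3 ht x
  simp only [p3]
  simp only [p2]
  simp only [p1]
  refine ⟨fun w => ?_, fun x => ?_, fun x => ?_, fun x => ?_⟩
  · rw [hTs t ht w, T_eq hB0 hUB hS hσ hP ht w]
    unfold LTs
    have i1 : ∀ j k, Integrable (fun s => DD a b σ S [k, j] s w * S k j) (volume.restrict (Set.Ioi t)) :=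
      fun j k => (hI [k, j] (by simp) (by simp) w).mul_const _
    have i2 : ∀ j, Integrable (fun s => w j * DD a b σ S [j] s w) (volume.restrict (Set.Ioi t)) :=
      fun j => (hI [j] (by simp) (by simp) w).const_mul _
    rw [integral_sub (integrable_finsetSum _ fun j _ => integrable_finsetSum _ fun k _ => i1 j k)
      (integrable_finsetSum _ fun j _ => i2 j)]
    rw [integral_finsetSum _ fun j _ => integrable_finsetSum _ fun k _ => i1 j k,
      integral_finsetSum _ fun j _ => i2 j]
    have e1 : ∀ j, ∫ s in Set.Ioi t, ∑ k, DD a b σ S [k, j] s w * S k j =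
        ∑ k, - (S k j * Psi a b σ S [k, j] t w) := by
      intro j
      rw [integral_finsetSum _ fun k _ => i1 j k]
      refine Finset.sum_congr rfl fun k _ => ?_
      rw [integral_mul_const, Psi]
      ring
    have e2 : ∀ j, ∫ s in Set.Ioi t, w j * DD a b σ S [j] s w = - (w j * Psi a b σ S [j] t w) := by
      intro j
      rw [integral_const_mul, Psi]
      ring
    simp only [e1, e2, Finset.sum_neg_distrib]
    rw [Finset.sum_comm]
    ring
  · have h := psi_sum_bound (S := S) (js := fun j : Fin d => [j]) (m := 1) (C := B * L ^ 1) hB0 hUB hσ (fun _ => rfl)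
      le_rfl (by norm_num) (by positivity) (fun τ hτ y => (hM d hd a b τ hτ y).2.1) ht (int1 ht) x
    refine h.trans (le_of_eq ?_)
    ring
  · have h := psi_sum_bound (S := S) (js := fun p : Fin d × Fin d => [p.1, p.2]) (m := 2) (C := B * L ^ 2)
      hB0 hUB hσ (fun _ => rfl) (by norm_num) (by norm_num) (by positivity)
      (fun τ hτ y => by
        rw [Fintype.sum_prod_type]
        exact (hM d hd a b τ hτ y).2.2.1) ht (int2 ht) x
    rw [Fintype.sum_prod_type] at h
    refine h.trans (le_of_eq ?_)
    rw [hL, Real.sq_sqrt hlog]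
    ring
  · have h := psi_sum_bound (S := S) (js := fun p : Fin d × Fin d × Fin d => [p.1, p.2.1, p.2.2]) (m := 3)
      (C := B * L ^ 3) hB0 hUB hσ (fun _ => rfl) (by norm_num) (by norm_num) (by positivity)
      (fun τ hτ y => by
        simp only [Fintype.sum_prod_type]
        exact (hM d hd a b τ hτ y).2.2.2) ht (int3 ht) x
    simp only [Fintype.sum_prod_type] at h
    refine h.trans (le_of_eq ?_)
    have e : (Real.log d) ^ ((3 : ℝ) / 2) = L ^ 3 := by
      rw [hL, Real.sqrt_eq_rpow, ← Real.rpow_natCast, ← Real.rpow_mul hlog]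
      norm_num
    rw [e]
    ring
end
end

section
/- Let d ≥ 3, let Σ be a d×d positive definite matrix with σ̄² = max_j Σ_{jj} and σ̲² = min_j Σ_{jj}, and let Z ~ N(0,Σ). For A ∈ 𝓡 set h̃_A = 1_A − P(Z ∈ A) and, for t > 0, T_t h̃_A(x) = E h̃_A(e^{−t} x + √(1 − e^{−2t}) Z). Then there is an absolute constant C > 0 such that for every random vector W in ℝ^d and every t > 0: sup_{A∈𝓡} |P(W ∈ A) − P(Z ∈ A)| ≤ C ( sup_{A∈𝓡} |E T_t h̃_A(W)| + (σ̄/σ̲) e^t √t log d ). -/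
open MeasureTheory ProbabilityTheory Real Matrix

noncomputable section

/-- `T_t h̃_A (x) = E h̃_A(e^{-t} x + √(1-e^{-2t}) Z)` where
`h̃_A = 1_A - P(Z ∈ A)` and `Z ~ N(0, S)`. -/
def OUsemigroup (d : ℕ) (S : Matrix (Fin d) (Fin d) ℝ) (A : Set (Fin d → ℝ))
    (t : ℝ) (x : Fin d → ℝ) : ℝ :=
  ∫ z, (Set.indicator A (fun _ => (1 : ℝ))
      (Real.exp (-t) • x + Real.sqrt (1 - Real.exp (-2 * t)) • z) -
    (gaussianMeasure d S A).toReal) ∂(gaussianMeasure d S)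

lemma gp_nonneg (d : ℕ) (S : Matrix (Fin d) (Fin d) ℝ) (hS : S.PosDef) (x : Fin d → ℝ) :
    0 < gaussianPdf d S x := by
  unfold gaussianPdf
  have := hS.det_pos
  positivity

lemma gp_cont (d : ℕ) (S : Matrix (Fin d) (Fin d) ℝ) : Continuous (gaussianPdf d S) := by
  unfold gaussianPdf
  fun_prop

/-- total mass one -/
lemma gm_prob (d : ℕ) (S : Matrix (Fin d) (Fin d) ℝ) (hS : S.PosDef) :
    IsProbabilityMeasure (gaussianMeasure d S) := by
  constructor
  unfold gaussianMeasure
  rw [withDensity_apply _ MeasurableSet.univ, Measure.restrict_univ]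
  have hSi : (S⁻¹).PosDef := hS.inv
  obtain ⟨B, hB, hBS⟩ : ∃ B : Matrix (Fin d) (Fin d) ℝ, IsUnit B ∧ S⁻¹ = Bᵀ * B := by
    open scoped MatrixOrder Matrix.Norms.L2Operator in
    obtain ⟨y, hy, h⟩ := CStarAlgebra.isStrictlyPositive_iff_eq_star_mul_self.mp
        hSi.isStrictlyPositive
    exact ⟨y, hy, by simpa [star_eq_conjTranspose] using h⟩
  have hdet : B.det ≠ 0 := by
    have := (Matrix.isUnit_iff_isUnit_det B).1 hB
    exact this.ne_zero
  have hdS : S.det ^ (-(1 : ℝ) / 2) = |B.det| := by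
    have h1 : (S.det)⁻¹ = B.det ^ 2 := by
      have := congrArg Matrix.det hBS
      rw [Matrix.det_nonsing_inv, Matrix.det_mul, Matrix.det_transpose] at this
      rw [Ring.inverse_eq_inv'] at this
      rw [this]; ring
    have h2 := hS.det_pos
    rw [show (-(1:ℝ)/2) = -(1/2) by ring, Real.rpow_neg h2.le, ← Real.inv_rpow h2.le, h1,
      ← Real.sqrt_eq_rpow, Real.sqrt_sq_eq_abs]
  have hq : ∀ x : Fin d → ℝ, gaussianPdf d S x = ((2 * π) ^ (-(d : ℝ) / 2) * |B.det|) *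
      ∏ i, Real.exp (-(1/2) * (Matrix.toLin' B x i) ^ 2) := by
    intro x
    unfold gaussianPdf
    rw [hdS, ← Real.exp_sum]
    congr 2
    rw [hBS, ← Matrix.mulVec_mulVec, Matrix.dotProduct_mulVec, Matrix.vecMul_transpose,
      ← Finset.mul_sum]
    congr 1
    simp [dotProduct, Matrix.toLin'_apply, sq]
  have hIntg1 : Integrable (fun x : ℝ => Real.exp (-(1/2) * x ^ 2)) :=
    integrable_exp_neg_mul_sq (by norm_num)
  have hIntg : Integrable (fun x : Fin d → ℝ => ∏ i, Real.exp (-(1/2) * (x i) ^ 2)) :=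
    Integrable.fintype_prod (f := fun _ (x : ℝ) => Real.exp (-(1/2) * x ^ 2)) (fun _ => hIntg1)
  have hmap := Real.map_matrix_volume_pi_eq_smul_volume_pi hdet
  have hm : Measurable (Matrix.toLin' B) := by
    exact (LinearMap.continuous_of_finiteDimensional _).measurable
  have hval : ∫ x : Fin d → ℝ, ∏ i, Real.exp (-(1/2) * (x i) ^ 2) = (√(2 * π)) ^ d := by
    have := integral_fintype_prod_volume_eq_pow (ι := Fin d)
      (fun x : ℝ => Real.exp (-(1/2) * x ^ 2))
    rw [this, integral_gaussian, Fintype.card_fin]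
    congr 2
    ring
  have hl : ∫⁻ x : Fin d → ℝ, ENNReal.ofReal (∏ i, Real.exp (-(1/2) * (x i) ^ 2))
      = ENNReal.ofReal ((√(2 * π)) ^ d) := by
    rw [← hval, ofReal_integral_eq_lintegral_ofReal hIntg]
    exact Filter.Eventually.of_forall fun x => Finset.prod_nonneg fun i _ => (Real.exp_pos _).le
  have hmeas : Measurable fun x : Fin d → ℝ =>
      ENNReal.ofReal (∏ i, Real.exp (-(1/2) * (x i) ^ 2)) := by fun_prop
  have hl2 : ∫⁻ x : Fin d → ℝ, ENNReal.ofReal (∏ i, Real.exp (-(1/2) * (Matrix.toLin' B x i) ^ 2))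
      = ENNReal.ofReal (|(B.det)⁻¹|) * ENNReal.ofReal ((√(2 * π)) ^ d) := by
    rw [← lintegral_map hmeas hm, hmap, lintegral_smul_measure, hl]
    rfl
  simp_rw [hq]
  have hc : 0 ≤ (2 * π) ^ (-(d : ℝ) / 2) * |B.det| := by positivity
  simp_rw [ENNReal.ofReal_mul hc]
  rw [lintegral_const_mul _ (by fun_prop), hl2, ← ENNReal.ofReal_mul (by positivity),
    ← ENNReal.ofReal_mul hc]
  rw [ENNReal.ofReal_eq_one]
  rw [Real.sqrt_eq_rpow, ← Real.rpow_natCast, ← Real.rpow_mul (by positivity), abs_inv]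
  have e1 : (2 * π) ^ (-(d : ℝ) / 2) = ((2 * π) ^ (1 / 2 * (d : ℝ)))⁻¹ := by
    rw [← Real.rpow_neg (by positivity)]; congr 1; ring
  rw [e1]
  have : (2 * π) ^ (1 / 2 * (d : ℝ)) ≠ 0 := by positivity
  have : |B.det| ≠ 0 := by positivity
  field_simp

lemma lintegral_scale (d : ℕ) (c : ℝ) (hc : 0 < c) :
    ∃ κ : ENNReal, κ ≠ 0 ∧ κ ≠ ⊤ ∧ ∀ (g : (Fin d → ℝ) → ENNReal) (_ : Measurable g)
      (a : Fin d → ℝ), ∫⁻ x, g (c⁻¹ • (x - a)) = κ * ∫⁻ x, g x := by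
  have h := Measure.map_addHaar_smul (volume : Measure (Fin d → ℝ)) (inv_ne_zero hc.ne')
  refine ⟨ENNReal.ofReal |((c⁻¹) ^ (Module.finrank ℝ (Fin d → ℝ)))⁻¹|, ?_, ENNReal.ofReal_ne_top, ?_⟩
  · rw [Ne, ENNReal.ofReal_eq_zero, not_le]; positivity
  · intro g hg a
    rw [lintegral_sub_right_eq_self (fun x => g (c⁻¹ • x)) a,
      ← lintegral_map hg (measurable_const_smul c⁻¹), h, lintegral_smul_measure]
    rfl

lemma quad_exp (d : ℕ) (Q : Matrix (Fin d) (Fin d) ℝ) (hQ : Qᵀ = Q) (x y : Fin d → ℝ) (a b : ℝ) :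
    (a • x + b • y) ⬝ᵥ Q.mulVec (a • x + b • y)
      = a ^ 2 * (x ⬝ᵥ Q.mulVec x) + 2 * a * b * (x ⬝ᵥ Q.mulVec y) + b ^ 2 * (y ⬝ᵥ Q.mulVec y) := by
  have h : y ⬝ᵥ Q.mulVec x = x ⬝ᵥ Q.mulVec y := by
    conv_lhs => rw [Matrix.dotProduct_mulVec, ← Matrix.mulVec_transpose, hQ, dotProduct_comm]
  simp only [Matrix.mulVec_add, Matrix.mulVec_smul, add_dotProduct, dotProduct_add, smul_dotProduct,
    dotProduct_smul, smul_eq_mul, h]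
  ring

lemma inv_symm {d : ℕ} {S : Matrix (Fin d) (Fin d) ℝ} (hS : S.PosDef) : (S⁻¹)ᵀ = S⁻¹ := by
  have := hS.inv.isHermitian
  simpa [Matrix.IsHermitian] using this

/-- OU invariance -/
lemma gm_invariant (d : ℕ) (S : Matrix (Fin d) (Fin d) ℝ) (hS : S.PosDef) (c s : ℝ) (hc : 0 < c)
    (hcs : c ^ 2 + s ^ 2 = 1) (B : Set (Fin d → ℝ)) (hB : MeasurableSet B) :
    ∫⁻ z, gaussianMeasure d S {w | c • w + s • z ∈ B} ∂(gaussianMeasure d S)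
      = gaussianMeasure d S B := by
  set f : (Fin d → ℝ) → ENNReal := fun x => ENNReal.ofReal (gaussianPdf d S x) with hf
  have hfm : Measurable f := (gp_cont d S).measurable.ennreal_ofReal
  set F : (Fin d → ℝ) → ENNReal := B.indicator 1 with hF
  have hFm : Measurable F := measurable_one.indicator hB
  obtain ⟨κ, hκ0, hκt, hκ⟩ := lintegral_scale d c hc
  have hγ : ∀ E, MeasurableSet E → gaussianMeasure d S E = ∫⁻ x, E.indicator 1 x * f x := by
    intro E hE
    unfold gaussianMeasure
    rw [withDensity_apply _ hE, ← lintegral_indicator hE]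
    congr 1; ext x
    by_cases hx : x ∈ E <;> simp [hx, f]
  have hsec : ∀ z, gaussianMeasure d S {w | c • w + s • z ∈ B} = ∫⁻ x, F (c • x + s • z) * f x := by
    intro z
    rw [hγ _ (by exact (by fun_prop : Measurable fun w : Fin d → ℝ => c • w + s • z) hB)]
    rfl
  simp_rw [hsec]
  have key : ∀ u y, f y * f (c⁻¹ • (u - s • y)) = f u * f (c⁻¹ • (y - s • u)) := by
    intro u y
    simp only [hf]
    rw [← ENNReal.ofReal_mul (gp_nonneg d S hS _).le, ← ENNReal.ofReal_mul (gp_nonneg d S hS _).le]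
    congr 1
    unfold gaussianPdf
    have e1 : ∀ u y : Fin d → ℝ, c⁻¹ • (u - s • y) = c⁻¹ • u + (-(c⁻¹ * s)) • y := by
      intro u y; ext i; simp; ring
    rw [e1, e1, quad_exp d _ (inv_symm hS), quad_exp d _ (inv_symm hS)]
    have hsym : y ⬝ᵥ S⁻¹.mulVec u = u ⬝ᵥ S⁻¹.mulVec y := by
      conv_lhs => rw [Matrix.dotProduct_mulVec, ← Matrix.mulVec_transpose, inv_symm hS, dotProduct_comm]
    rw [hsym]
    have e2 : ∀ k k' a b : ℝ, (k * k' * Real.exp a) * (k * k' * Real.exp b) = (k * k') ^ 2 * Real.exp (a + b) := by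
      intro k k' a b; rw [Real.exp_add]; ring
    rw [e2, e2]
    congr 2
    have : s ^ 2 = 1 - c ^ 2 := by linarith
    field_simp
    rw [this]
    ring
  have hmm : Measurable fun z : Fin d → ℝ => ∫⁻ x, F (c • x + s • z) * f x := by
    refine Measurable.lintegral_prod_right (f := fun z x : Fin d → ℝ => F (c • x + s • z) * f x) ?_
    exact (hFm.comp (by fun_prop)).mul (hfm.comp measurable_snd)
  have hγi : ∫⁻ z, (∫⁻ x, F (c • x + s • z) * f x) ∂(gaussianMeasure d S)
      = ∫⁻ z, f z * (∫⁻ x, F (c • x + s • z) * f x) := by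
    unfold gaussianMeasure
    rw [lintegral_withDensity_eq_lintegral_mul _ hfm hmm]
    rfl
  rw [hγi, hγ B hB]
  have hfκ : ∫⁻ x, f x = 1 := by
    have := (gm_prob d S hS).measure_univ
    rw [hγ _ MeasurableSet.univ] at this
    simpa using this
  have main : κ * ∫⁻ z, f z * (∫⁻ x, F (c • x + s • z) * f x) = κ * ∫⁻ x, F x * f x := by
    calc κ * ∫⁻ z, f z * (∫⁻ x, F (c • x + s • z) * f x)
        = ∫⁻ z, f z * (κ * ∫⁻ x, F (c • x + s • z) * f x) := by
          rw [← lintegral_const_mul κ (f := fun z => f z * ∫⁻ x, F (c • x + s • z) * f x) (hfm.mul hmm)]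
          congr 1; ext z; ring
      _ = ∫⁻ z, f z * (∫⁻ u, F u * f (c⁻¹ • (u - s • z))) := by
          congr 1; ext z
          rw [← hκ (fun x => F (c • x + s • z) * f x)
            ((hFm.comp (by fun_prop)).mul hfm) (s • z)]
          congr 2; ext u
          rw [smul_inv_smul₀ hc.ne', sub_add_cancel]
      _ = ∫⁻ z, ∫⁻ u, F u * (f u * f (c⁻¹ • (z - s • u))) := by
          congr 1; ext z
          rw [← lintegral_const_mul (f z) (f := fun u => F u * f (c⁻¹ • (u - s • z)))
            (hFm.mul (hfm.comp (by fun_prop)))]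
          congr 1; ext u
          rw [← key u z]; ring
      _ = ∫⁻ u, ∫⁻ z, F u * (f u * f (c⁻¹ • (z - s • u))) := by
          rw [lintegral_lintegral_swap]
          apply Measurable.aemeasurable
          exact (hFm.comp measurable_snd).mul ((hfm.comp measurable_snd).mul
            (hfm.comp (by fun_prop)))
      _ = ∫⁻ u, κ * (F u * f u) := by
          congr 1; ext u
          simp_rw [← mul_assoc]
          rw [lintegral_const_mul (F u * f u) (f := fun z => f (c⁻¹ • (z - s • u)))
            (hfm.comp (by fun_prop)), hκ f hfm, hfκ]
          ring
      _ = κ * ∫⁻ x, F x * f x := lintegral_const_mul _ (hFm.mul hfm)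
  exact (ENNReal.mul_right_inj hκ0 hκt).1 main

/-- Cameron–Martin shift, inequality form. -/
lemma gm_shift (d : ℕ) (S : Matrix (Fin d) (Fin d) ℝ) (hS : S.PosDef) (j : Fin d) (σ : ℝ)
    (hσ : σ ^ 2 = 1 / S j j) (E E' : Set (Fin d → ℝ)) (hE : MeasurableSet E)
    (hE' : MeasurableSet E') (s c : ℝ) (hc0 : 0 ≤ c)
    (h : ∀ z ∈ E, z + s • (σ • S.col j) ∈ E' ∧ c ≤ Real.exp (-s * (σ * z j) - s ^ 2 / 2)) :
    c * (gaussianMeasure d S E).toReal ≤ (gaussianMeasure d S E').toReal := by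
  have := gm_prob d S hS
  have hpd : ∀ z, gaussianPdf d S (z + s • (σ • S.col j))
      = gaussianPdf d S z * Real.exp (-s * (σ * z j) - s ^ 2 / 2) := by
    intro z
    unfold gaussianPdf
    rw [mul_assoc, mul_assoc, mul_assoc, ← Real.exp_add]
    congr 3
    have e1 : z + s • (σ • S.col j) = (1:ℝ) • z + (s * σ) • S.col j := by
      rw [one_smul, smul_smul]
    have hSc : S⁻¹.mulVec (S.col j) = Pi.single j 1 := by
      have : S.col j = S.mulVec (Pi.single j 1) := by simp
      rw [this, Matrix.mulVec_mulVec, Matrix.nonsing_inv_mul _ (by simpa using hS.det_pos.ne'),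
        Matrix.one_mulVec]
    rw [e1, quad_exp d _ (inv_symm hS), hSc]
    have hpos : 0 < S j j := hS.diag_pos
    have : (s * σ) ^ 2 * S j j = s ^ 2 := by rw [mul_pow, hσ]; field_simp
    simp only [dotProduct_single, mul_one, Matrix.col_apply]
    linear_combination (-1/2) * this
  have hfm : Measurable fun x => ENNReal.ofReal (gaussianPdf d S x) :=
    (gp_cont d S).measurable.ennreal_ofReal
  have main : ENNReal.ofReal c * gaussianMeasure d S E ≤ gaussianMeasure d S E' := by
    unfold gaussianMeasure
    rw [withDensity_apply _ hE, withDensity_apply _ hE', ← lintegral_indicator hE,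
      ← lintegral_indicator hE', ← lintegral_add_right_eq_self (E'.indicator _) (s • (σ • S.col j)),
      ← lintegral_const_mul _ (hfm.indicator hE)]
    apply lintegral_mono
    intro z
    by_cases hz : z ∈ E
    · obtain ⟨h1, h2⟩ := h z hz
      simp only [Set.indicator_of_mem hz, Set.indicator_of_mem h1]
      rw [hpd, ← ENNReal.ofReal_mul hc0, mul_comm]
      apply ENNReal.ofReal_le_ofReal
      exact mul_le_mul_of_nonneg_left h2 (gp_nonneg d S hS z).le
    · simp [hz]
  have := ENNReal.toReal_mono (measure_ne_top _ _) main
  rwa [ENNReal.toReal_mul, ENNReal.toReal_ofReal hc0] at this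

/-- sum of measures of pairwise disjoint sets is at most one -/
lemma sum_real_le_one {E ι : Type*} [MeasurableSpace E] (γ : Measure E) [IsProbabilityMeasure γ]
    (T : Finset ι) (G : ι → Set E) (hm : ∀ i ∈ T, MeasurableSet (G i))
    (hd : ∀ i ∈ T, ∀ j ∈ T, ∀ z, z ∈ G i → z ∈ G j → i = j) :
    ∑ i ∈ T, γ.real (G i) ≤ 1 := by
  rw [← measureReal_biUnion_finset _ hm]
  · exact measureReal_le_one
  · intro i hi j hj hij
    rw [Function.onFun, Set.disjoint_left]
    intro z h1 h2
    exact hij (hd i hi j hj z h1 h2)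

lemma slab_index {ε x : ℝ} (hε : 0 < ε) {k k' : ℕ} (h1 : k * ε ≤ x) (h2 : x < (k + 1) * ε)
    (h3 : k' * ε ≤ x) (h4 : x < (k' + 1) * ε) : k = k' := by
  have a : (k : ℝ) < k' + 1 := by
    by_contra h; push Not at h; nlinarith
  have b : (k' : ℝ) < k + 1 := by
    by_contra h; push Not at h; nlinarith
  have a' : k < k' + 1 := by exact_mod_cast a
  have b' : k' < k + 1 := by exact_mod_cast b
  omega

lemma floor_half {x : ℝ} (hx : 1 ≤ x) : x / 2 ≤ (⌊x⌋₊ : ℝ) := by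
  have h1 := Nat.lt_floor_add_one x
  have h2 : (1 : ℝ) ≤ (⌊x⌋₊ : ℝ) := by
    exact_mod_cast Nat.le_floor (by simpa using hx)
  linarith

/-- Nazarov-type anti-concentration, abstract form. -/
lemma anti_abs {E J : Type*} [MeasurableSpace E] (γ : Measure E) [IsProbabilityMeasure γ]
    [Fintype J] (ℓ : J → E → ℝ) (hℓ : ∀ i, Measurable (ℓ i)) (τ : J → ℝ → E → E)
    (hτ : ∀ i k s z, 0 ≤ s → ℓ k (τ i s z) ≤ ℓ k z + s)
    (hτi : ∀ i s z, ℓ i (τ i s z) = ℓ i z + s)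
    (hshift : ∀ i s c (A A' : Set E), MeasurableSet A → MeasurableSet A' → 0 ≤ c →
      (∀ z ∈ A, τ i s z ∈ A' ∧ c ≤ Real.exp (-s * ℓ i z - s ^ 2 / 2)) →
      c * γ.real A ≤ γ.real A')
    (L : ℝ) (hL : 1 ≤ L) (hcard : (Fintype.card J : ℝ) ≤ Real.exp (L ^ 2 / 2))
    (I : Finset J) (β : J → ℝ) (ε : ℝ) (hε : 0 < ε) :
    γ.real ({z | ∀ i ∈ I, ℓ i z < β i + ε} \ {z | ∀ i ∈ I, ℓ i z < β i}) ≤ 100 * (ε * L) := by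
  classical
  have hεL : 0 < ε * L := by positivity
  by_cases hbig : 1 < ε * L
  · calc _ ≤ (1 : ℝ) := measureReal_le_one
      _ ≤ _ := by linarith
  push Not at hbig
  have hε1 : ε ≤ 1 := by nlinarith
  set e := Fintype.equivFin J
  set X : J → E → ℝ := fun i z => ℓ i z - β i with hX
  have hXm : ∀ i, Measurable (X i) := fun i => (hℓ i).sub_const _
  set D : J → Set E := fun i => {z | ∀ k ∈ I, X k z < X i z ∨ (X k z = X i z ∧ e i ≤ e k)} with hD
  have hDm : ∀ i, MeasurableSet (D i) := by
    intro i
    have : D i = ⋂ k ∈ I, ({z | X k z < X i z} ∪ ({z | X k z = X i z} ∩ {_z | e i ≤ e k})) := by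
      ext z; simp [hD]
    rw [this]
    refine Finset.measurableSet_biInter _ fun k _ => ?_
    exact (measurableSet_lt (hXm k) (hXm i)).union
      ((measurableSet_eq_fun (hXm k) (hXm i)).inter (MeasurableSet.const _))
  set G : J → ℕ → Set E := fun i k => D i ∩ {z | k * ε ≤ X i z ∧ X i z < (k + 1) * ε} with hG
  have hslabm : ∀ (f : E → ℝ), Measurable f → ∀ k : ℕ,
      MeasurableSet {z | k * ε ≤ f z ∧ f z < (k + 1) * ε} := by
    intro f hf k
    exact (measurableSet_le measurable_const hf).inter (measurableSet_lt hf measurable_const)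
  have hGm : ∀ i k, MeasurableSet (G i k) := fun i k => (hDm i).inter (hslabm _ (hXm i) k)
  have hDdisj : ∀ i ∈ I, ∀ j ∈ I, ∀ z, z ∈ D i → z ∈ D j → i = j := by
    intro i hi j hj z h1 h2
    have a := h1 j hj
    have b := h2 i hi
    rcases a with a | ⟨a, a'⟩ <;> rcases b with b | ⟨b, b'⟩
    · linarith
    · linarith
    · linarith
    · exact e.injective (le_antisymm a' b')
  -- cover
  have hcover : ({z | ∀ i ∈ I, ℓ i z < β i + ε} \ {z | ∀ i ∈ I, ℓ i z < β i})
      ⊆ ⋃ i ∈ I, G i 0 := by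
    rintro z ⟨h1, h2⟩
    simp only [Set.mem_ofPred_eq, not_forall, not_lt] at h1 h2
    obtain ⟨i0, hi0, h0⟩ := h2
    obtain ⟨i1, hi1, hmax⟩ := I.exists_max_image (fun i => X i z) ⟨i0, hi0⟩
    obtain ⟨i2, hi2, hmin⟩ := (I.filter fun i => X i z = X i1 z).exists_min_image e
      ⟨i1, by simp [hi1]⟩
    simp only [Finset.mem_filter] at hi2 hmin
    simp only [Set.mem_iUnion]
    refine ⟨i2, hi2.1, ?_, ?_⟩
    · intro k hk
      rcases (hmax k hk).lt_or_eq with h | h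
      · left; rw [hi2.2]; exact h
      · right; exact ⟨by rw [hi2.2]; exact h, hmin k ⟨hk, h⟩⟩
    · have a := hmax i0 hi0
      have b := h1 i2 hi2.1
      simp only [hX] at a hi2 ⊢
      simp only [Set.mem_ofPred_eq, Nat.cast_zero]
      constructor <;> linarith [hi2.2]
  -- near
  set I1 := I.filter fun i => β i ≤ L with hI1
  set I2 := I.filter fun i => ¬ β i ≤ L with hI2
  have hnear : ∑ i ∈ I1, γ.real (G i 0) ≤ 2 * Real.exp 3 * (ε * L) := by
    set N := ⌊1 / (ε * L)⌋₊ with hN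
    have hN1 : 1 / (ε * L) / 2 ≤ N := floor_half (by rw [le_div_iff₀ hεL]; linarith)
    have hN2 : (N : ℝ) ≤ 1 / (ε * L) := Nat.floor_le (by positivity)
    have hsh : ∀ i ∈ I1, ∀ k ∈ Finset.range N, Real.exp (-3) * γ.real (G i 0) ≤ γ.real (G i k) := by
      intro i hi k hk
      have hk' : (k : ℝ) ≤ N := by exact_mod_cast (Finset.mem_range.1 hk).le
      have hs0 : 0 ≤ (k : ℝ) * ε := by positivity
      have hs1 : (k : ℝ) * ε * L ≤ 1 := by
        have : (k : ℝ) ≤ 1 / (ε * L) := hk'.trans hN2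
        rw [le_div_iff₀ hεL] at this
        linarith
      refine hshift i (k * ε) _ _ _ (hGm i 0) (hGm i k) (Real.exp_pos _).le ?_
      rintro z ⟨hz1, hz2, hz3⟩
      have hXi : X i (τ i (k * ε) z) = X i z + k * ε := by simp only [hX, hτi]; ring
      refine ⟨⟨?_, ?_⟩, ?_⟩
      · intro m hm
        have hXm' : X m (τ i (k * ε) z) ≤ X m z + k * ε := by
          simp only [hX]; linarith [hτ i m (k * ε) z hs0]
        rcases hz1 m hm with h | ⟨h, h'⟩
        · left; rw [hXi]; linarith
        · rcases hXm'.lt_or_eq with h2 | h2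
          · left; rw [hXi]; linarith
          · right; exact ⟨by rw [hXi, h2, h], h'⟩
      · simp only [Set.mem_ofPred_eq, hXi]
        simp only [Nat.cast_zero] at hz2 hz3
        constructor <;> linarith
      · apply Real.exp_le_exp.2
        have hb : β i ≤ L := (Finset.mem_filter.1 hi).2
        have hl : ℓ i z ≤ 2 * L := by
          simp only [hX, Nat.cast_zero] at hz3
          linarith
        have h1 : (k : ℝ) * ε * ℓ i z ≤ 2 := by
          calc (k : ℝ) * ε * ℓ i z ≤ k * ε * (2 * L) := mul_le_mul_of_nonneg_left hl hs0
            _ ≤ 2 := by linarith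
        have h2 : (k : ℝ) * ε ≤ 1 := by nlinarith
        nlinarith
    have htot : ∑ p ∈ I1 ×ˢ Finset.range N, γ.real (G p.1 p.2) ≤ 1 := by
      apply sum_real_le_one
      · intro p _; exact hGm _ _
      · rintro ⟨i, k⟩ hp ⟨j, m⟩ hq z h1 h2
        simp only [Finset.mem_product, hI1, Finset.mem_filter] at hp hq
        have hij : i = j := hDdisj i hp.1.1 j hq.1.1 z h1.1 h2.1
        subst hij
        have := slab_index hε h1.2.1 h1.2.2 h2.2.1 h2.2.2
        exact Prod.ext rfl this
    rw [Finset.sum_product] at htot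
    have h3 : ∑ i ∈ I1, N * (Real.exp (-3) * γ.real (G i 0)) ≤ 1 := by
      refine le_trans (Finset.sum_le_sum fun i hi => ?_) htot
      have := Finset.sum_le_sum (hsh i hi)
      simpa using this
    rw [← Finset.mul_sum, ← Finset.mul_sum] at h3
    set T0 := ∑ i ∈ I1, γ.real (G i 0)
    have hT0 : 0 ≤ T0 := Finset.sum_nonneg fun i _ => measureReal_nonneg
    have h4 : 1 / (ε * L) / 2 * (Real.exp (-3) * T0) ≤ 1 :=
      le_trans (mul_le_mul_of_nonneg_right hN1 (by positivity)) h3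
    rw [Real.exp_neg] at h4
    have he : 0 < Real.exp 3 := Real.exp_pos 3
    have h5 : 1 / (ε * L) / 2 * ((Real.exp 3)⁻¹ * T0) = T0 / (2 * Real.exp 3 * (ε * L)) := by
      field_simp
    rw [h5, div_le_one (by positivity)] at h4
    exact h4
  have hfar : ∑ i ∈ I2, γ.real (G i 0) ≤ 2 * Real.exp (1/2) * ε := by
    have hone : ∀ i ∈ I2, γ.real (G i 0) ≤ 2 * Real.exp (1/2) * ε * (Real.exp (L ^ 2 / 2))⁻¹ := by
      intro i hi
      have hb : L < β i := not_le.1 (Finset.mem_filter.1 hi).2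
      set M := ⌊1 / ε⌋₊ with hM
      have hM1 : 1 / ε / 2 ≤ M := floor_half (by rw [le_div_iff₀ hε]; linarith)
      have hM2 : (M : ℝ) ≤ 1 / ε := Nat.floor_le (by positivity)
      have hsh : ∀ k ∈ Finset.range M, Real.exp (L ^ 2 / 2 - 1 / 2) * γ.real (G i 0)
          ≤ γ.real {z | k * ε ≤ ℓ i z ∧ ℓ i z < (k + 1) * ε} := by
        intro k hk
        have hk' : (k : ℝ) ≤ M := by exact_mod_cast (Finset.mem_range.1 hk).le
        have hs0 : 0 ≤ (k : ℝ) * ε := by positivity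
        have hs1 : (k : ℝ) * ε ≤ 1 := by
          have : (k : ℝ) ≤ 1 / ε := hk'.trans hM2
          rwa [le_div_iff₀ hε] at this
        refine hshift i (-(β i - k * ε)) _ _ _ (hGm i 0) (hslabm _ (hℓ i) k) (Real.exp_pos _).le ?_
        rintro z ⟨hz1, hz2, hz3⟩
        simp only [hX, Nat.cast_zero] at hz2 hz3
        refine ⟨?_, ?_⟩
        · simp only [Set.mem_ofPred_eq, hτi]
          constructor <;> linarith
        · apply Real.exp_le_exp.2
          have h0 : 0 ≤ β i - k * ε := by linarith
          have h1 : (β i - k * ε) * β i ≤ (β i - k * ε) * ℓ i z :=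
            mul_le_mul_of_nonneg_left (by linarith) h0
          nlinarith
      have htot : ∑ k ∈ Finset.range M, γ.real {z | k * ε ≤ ℓ i z ∧ ℓ i z < (k + 1) * ε} ≤ 1 := by
        apply sum_real_le_one
        · intro k _; exact hslabm _ (hℓ i) k
        · intro k _ m _ z h1 h2
          exact slab_index hε h1.1 h1.2 h2.1 h2.2
      have h3 : M * (Real.exp (L ^ 2 / 2 - 1 / 2) * γ.real (G i 0)) ≤ 1 := by
        refine le_trans ?_ htot
        have := Finset.sum_le_sum hsh
        simpa using this
      have h4 : 1 / ε / 2 * (Real.exp (L ^ 2 / 2 - 1 / 2) * γ.real (G i 0)) ≤ 1 :=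
        le_trans (mul_le_mul_of_nonneg_right hM1
          (mul_nonneg (Real.exp_pos _).le measureReal_nonneg)) h3
      rw [Real.exp_sub] at h4
      have he1 := Real.exp_pos (1/2)
      have he2 := Real.exp_pos (L^2/2)
      have h5 : 1 / ε / 2 * (Real.exp (L ^ 2 / 2) / Real.exp (1 / 2) * γ.real (G i 0))
          = γ.real (G i 0) / (2 * Real.exp (1/2) * ε * (Real.exp (L ^ 2 / 2))⁻¹) := by
        field_simp
      rw [h5, div_le_one (by positivity)] at h4
      exact h4
    calc ∑ i ∈ I2, γ.real (G i 0)
        ≤ ∑ i ∈ I2, 2 * Real.exp (1/2) * ε * (Real.exp (L ^ 2 / 2))⁻¹ := Finset.sum_le_sum hone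
      _ = (I2.card : ℝ) * (2 * Real.exp (1/2) * ε * (Real.exp (L ^ 2 / 2))⁻¹) := by simp
      _ ≤ Real.exp (L ^ 2 / 2) * (2 * Real.exp (1/2) * ε * (Real.exp (L ^ 2 / 2))⁻¹) := by
          apply mul_le_mul_of_nonneg_right _ (by positivity)
          exact le_trans (by exact_mod_cast Finset.card_le_univ I2) hcard
      _ = 2 * Real.exp (1/2) * ε := by
          have he2 := Real.exp_pos (L^2/2)
          field_simp
  have he3 : Real.exp 3 ≤ 21 := by
    have : Real.exp 3 = Real.exp 1 ^ 3 := by rw [← Real.exp_nat_mul]; norm_num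
    rw [this]
    have h := Real.exp_one_lt_d9
    calc Real.exp 1 ^ 3 ≤ (2.7182818286 : ℝ) ^ 3 := by gcongr
      _ ≤ 21 := by norm_num
  have he4 : Real.exp (1/2) ≤ 3 := by
    have : Real.exp (1/2) ≤ Real.exp 1 := Real.exp_le_exp.2 (by norm_num)
    linarith [Real.exp_one_lt_d9]
  calc _ ≤ γ.real (⋃ i ∈ I, G i 0) := measureReal_mono hcover (measure_ne_top _ _)
    _ ≤ ∑ i ∈ I, γ.real (G i 0) := measureReal_biUnion_finset_le _ _
    _ = ∑ i ∈ I1, γ.real (G i 0) + ∑ i ∈ I2, γ.real (G i 0) :=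
        (Finset.sum_filter_add_sum_filter_not I (fun i => β i ≤ L) _).symm
    _ ≤ 2 * Real.exp 3 * (ε * L) + 2 * Real.exp (1/2) * ε := add_le_add hnear hfar
    _ ≤ 100 * (ε * L) := by
        have : ε ≤ ε * L := by nlinarith
        nlinarith

lemma ereal_aff_lower (a : EReal) (c p : ℝ) (hc : 0 < c) :
    ∃ a' : EReal, ∀ x : ℝ, a < ((c * x + p : ℝ) : EReal) ↔ a' < (x : EReal) := by
  induction a with
  | bot => exact ⟨⊥, fun x => ⟨fun _ => EReal.bot_lt_coe _, fun _ => EReal.bot_lt_coe _⟩⟩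
  | top => exact ⟨⊤, fun x => by simp⟩
  | coe a =>
    refine ⟨(((a - p) / c : ℝ) : EReal), fun x => ?_⟩
    rw [EReal.coe_lt_coe_iff, EReal.coe_lt_coe_iff, div_lt_iff₀ hc]
    constructor <;> intro h <;> linarith

lemma ereal_aff_upper (b : EReal) (c p : ℝ) (hc : 0 < c) :
    ∃ b' : EReal, ∀ x : ℝ, ((c * x + p : ℝ) : EReal) < b ↔ (x : EReal) < b' := by
  induction b with
  | bot => exact ⟨⊥, fun x => by simp⟩
  | top => exact ⟨⊤, fun x => ⟨fun _ => EReal.coe_lt_top _, fun _ => EReal.coe_lt_top _⟩⟩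
  | coe b =>
    refine ⟨(((b - p) / c : ℝ) : EReal), fun x => ?_⟩
    rw [EReal.coe_lt_coe_iff, EReal.coe_lt_coe_iff, lt_div_iff₀ hc]
    constructor <;> intro h <;> linarith

lemma isHyp_aff {d : ℕ} (a b : Fin d → EReal) (c : ℝ) (hc : 0 < c) (p q : Fin d → ℝ) :
    IsHyperrectangle {x : Fin d → ℝ | ∀ j, a j < ((c * x j + p j : ℝ) : EReal) ∧
      ((c * x j + q j : ℝ) : EReal) < b j} := by
  choose a' ha' using fun j => ereal_aff_lower (a j) c (p j) hc
  choose b' hb' using fun j => ereal_aff_upper (b j) c (q j) hc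
  refine ⟨a', b', ?_⟩
  simp_rw [ha', hb']

lemma isHyp_meas {d : ℕ} {A : Set (Fin d → ℝ)} (hA : IsHyperrectangle A) : MeasurableSet A := by
  obtain ⟨a, b, rfl⟩ := hA
  have : {x : Fin d → ℝ | ∀ j, a j < (x j : EReal) ∧ (x j : EReal) < b j}
      = ⋂ j, ({x | a j < (x j : EReal)} ∩ {x | (x j : EReal) < b j}) := by
    ext x; simp
  rw [this]
  refine MeasurableSet.iInter fun j => ?_
  have hm : Measurable fun x : Fin d → ℝ => (x j : EReal) :=
    measurable_coe_real_ereal.comp (measurable_pi_apply j)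
  exact (measurableSet_lt measurable_const hm).inter (measurableSet_lt hm measurable_const)

/-- sign attached to a Boolean -/
def sgB (b : Bool) : ℝ := if b then 1 else -1

lemma sgB_sq (b : Bool) : sgB b ^ 2 = 1 := by cases b <;> simp [sgB]

lemma quad_pair {d : ℕ} {S : Matrix (Fin d) (Fin d) ℝ} (hS : S.PosDef) (k j : Fin d) (α δ : ℝ)
    (hα : α ^ 2 = 1 / S k k) (hδ : δ ^ 2 = 1 / S j j) : α * δ * S k j ≤ 1 := by
  have hsym : Sᵀ = S := by simpa [Matrix.IsHermitian] using hS.isHermitian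
  have h := hS.posSemidef.dotProduct_mulVec_nonneg (α • Pi.single k 1 + (-δ) • Pi.single j 1)
  simp only [star_trivial] at h
  rw [quad_exp d S hsym] at h
  have hk : 0 < S k k := hS.diag_pos
  have hj : 0 < S j j := hS.diag_pos
  have e1 : α ^ 2 * S k k = 1 := by rw [hα]; field_simp
  have e2 : δ ^ 2 * S j j = 1 := by rw [hδ]; field_simp
  simp only [Matrix.mulVec_single_one, single_one_dotProduct, Matrix.col_apply] at h
  nlinarith

lemma coef_sq {d : ℕ} {S : Matrix (Fin d) (Fin d) ℝ} (hS : S.PosDef) (j : Fin d) (b : Bool) :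
    (sgB b / √(S j j)) ^ 2 = 1 / S j j := by
  have hj : 0 < S j j := hS.diag_pos
  rw [div_pow, sgB_sq, Real.sq_sqrt hj.le]

lemma anti_rect (d : ℕ) (hd : 3 ≤ d) (S : Matrix (Fin d) (Fin d) ℝ) (hS : S.PosDef) (σlow : ℝ)
    (hσ : 0 < σlow) (hlow : ∀ j, σlow ^ 2 ≤ S j j) (a b : Fin d → EReal) (η : ℝ) (hη : 0 < η) :
    (gaussianMeasure d S).real
      ({x | ∀ j, a j < ((x j + η : ℝ) : EReal) ∧ ((x j - η : ℝ) : EReal) < b j} \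
        {x | ∀ j, a j < (x j : EReal) ∧ (x j : EReal) < b j})
      ≤ 100 * (η / σlow * √(2 * Real.log (2 * d))) := by
  classical
  have := gm_prob d S hS
  have hdr : (3 : ℝ) ≤ d := by exact_mod_cast hd
  have hlog : 1 ≤ Real.log (2 * d) := by
    rw [Real.le_log_iff_exp_le (by positivity)]
    linarith [Real.exp_one_lt_d9]
  have hsj : ∀ j, σlow ≤ √(S j j) := fun j => Real.le_sqrt_of_sq_le (hlow j)
  have hpos : ∀ j, 0 < √(S j j) := fun j => hσ.trans_le (hsj j)
  let ℓ : Fin d × Bool → (Fin d → ℝ) → ℝ := fun i z => sgB i.2 / √(S i.1 i.1) * z i.1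
  let τ : Fin d × Bool → ℝ → (Fin d → ℝ) → (Fin d → ℝ) :=
    fun i s z => z + s • ((sgB i.2 / √(S i.1 i.1)) • S.col i.1)
  let β : Fin d × Bool → ℝ := fun i =>
    if i.2 then (b i.1).toReal / √(S i.1 i.1) else - (a i.1).toReal / √(S i.1 i.1)
  let I : Finset (Fin d × Bool) := Finset.univ.filter fun i => if i.2 then b i.1 ≠ ⊤ else a i.1 ≠ ⊥
  have h := anti_abs (gaussianMeasure d S) ℓ (fun i => by fun_prop) τ
    (by
      intro i k s z hs
      have hq := quad_pair hS k.1 i.1 _ _ (coef_sq hS k.1 k.2) (coef_sq hS i.1 i.2)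
      have := mul_le_mul_of_nonneg_left hq hs
      simp only [ℓ, τ, Pi.add_apply, Pi.smul_apply, smul_eq_mul, Matrix.col_apply]
      linarith)
    (by
      intro i s z
      have e := coef_sq hS i.1 i.2
      have hj : S i.1 i.1 ≠ 0 := (hS.diag_pos (i := i.1)).ne'
      have : (sgB i.2 / √(S i.1 i.1)) ^ 2 * S i.1 i.1 = 1 := by rw [e]; field_simp
      simp only [ℓ, τ, Pi.add_apply, Pi.smul_apply, smul_eq_mul, Matrix.col_apply]
      linear_combination s * this)
    (by
      intro i s c A A' hA hA' hc hz
      exact gm_shift d S hS i.1 _ (coef_sq hS i.1 i.2) A A' hA hA' s c hc hz)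
    (√(2 * Real.log (2 * d))) (by rw [Real.one_le_sqrt]; linarith)
    (by
      rw [Real.sq_sqrt (by linarith), mul_div_cancel_left₀ _ (by norm_num),
        Real.exp_log (by positivity)]
      simp [mul_comm])
    I β (η / σlow) (by positivity)
  refine le_trans (measureReal_mono ?_ (measure_ne_top _ _)) h
  rintro x ⟨hx1, hx2⟩
  refine ⟨?_, ?_⟩
  · rintro ⟨j, bb⟩ hi
    have hdiv : η / √(S j j) ≤ η / σlow := div_le_div_of_nonneg_left hη.le hσ (hsj j)
    obtain ⟨h1, h2⟩ := hx1 j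
    have hp := hpos j
    simp only [I, Finset.mem_filter, Finset.mem_univ, true_and] at hi
    cases bb
    · simp only [Bool.false_eq_true, if_false] at hi
      simp only [ℓ, β, sgB, Bool.false_eq_true, if_false]
      generalize a j = aj at *
      induction aj with
      | bot => exact absurd rfl hi
      | top => simp at h1
      | coe y =>
        rw [EReal.coe_lt_coe_iff] at h1
        rw [EReal.toReal_coe]
        have : -1 / √(S j j) * x j < -y / √(S j j) + η / √(S j j) := by
          rw [div_mul_eq_mul_div, ← add_div]
          exact div_lt_div_of_pos_right (by linarith) hp
        linarith
    · simp only [if_true] at hi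
      simp only [ℓ, β, sgB, if_true]
      generalize b j = bj at *
      induction bj with
      | top => exact absurd rfl hi
      | bot => simp at h2
      | coe y =>
        rw [EReal.coe_lt_coe_iff] at h2
        rw [EReal.toReal_coe]
        have : 1 / √(S j j) * x j < y / √(S j j) + η / √(S j j) := by
          rw [div_mul_eq_mul_div, ← add_div]
          exact div_lt_div_of_pos_right (by linarith) hp
        linarith
  · intro hall
    apply hx2
    intro j
    obtain ⟨h1, h2⟩ := hx1 j
    have hp := hpos j
    have ha := hall (j, false)
    have hb := hall (j, true)
    simp only [I, ℓ, β, sgB, Finset.mem_filter, Finset.mem_univ, true_and, if_true,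
      Bool.false_eq_true, if_false] at ha hb
    constructor
    · generalize a j = aj at *
      induction aj with
      | bot => exact EReal.bot_lt_coe _
      | top => simp at h1
      | coe y =>
        have := ha (EReal.coe_ne_bot y)
        rw [EReal.toReal_coe, div_mul_eq_mul_div, div_lt_div_iff_of_pos_right hp] at this
        rw [EReal.coe_lt_coe_iff]; linarith
    · generalize b j = bj at *
      induction bj with
      | top => exact EReal.coe_lt_top _
      | bot => simp at h2
      | coe y =>
        have := hb (EReal.coe_ne_top y)
        rw [EReal.toReal_coe, div_mul_eq_mul_div, div_lt_div_iff_of_pos_right hp] at this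
        rw [EReal.coe_lt_coe_iff]; linarith

lemma tail_cube (d : ℕ) (hd : 3 ≤ d) (S : Matrix (Fin d) (Fin d) ℝ) (hS : S.PosDef) (σbar : ℝ)
    (hσ : 0 < σbar) (hup : ∀ j, S j j ≤ σbar ^ 2) :
    3 / 4 ≤ (gaussianMeasure d S).real {z | ∀ j, |z j| ≤ σbar * √(2 * Real.log (8 * d))} := by
  have := gm_prob d S hS
  have hdr : (3 : ℝ) ≤ d := by exact_mod_cast hd
  have hlog : 0 ≤ Real.log (8 * d) := Real.log_nonneg (by linarith)
  set R := √(2 * Real.log (8 * d)) with hR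
  have hR0 : 0 ≤ R := Real.sqrt_nonneg _
  have hR2 : R ^ 2 = 2 * Real.log (8 * d) := Real.sq_sqrt (by linarith)
  set H : Fin d × Bool → Set (Fin d → ℝ) := fun i => {z | R ≤ sgB i.2 / √(S i.1 i.1) * z i.1} with hH
  have hHm : ∀ i, MeasurableSet (H i) := fun i => measurableSet_le measurable_const (by fun_prop)
  have hone : ∀ i, (gaussianMeasure d S).real (H i) ≤ 1 / (8 * d) := by
    intro i
    have h := gm_shift d S hS i.1 _ (coef_sq hS i.1 i.2) (H i) Set.univ (hHm i) MeasurableSet.univ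
      (-R) (8 * d) (by positivity) (by
        intro z hz
        refine ⟨trivial, ?_⟩
        rw [← Real.exp_log (show (0:ℝ) < 8 * d by positivity)]
        apply Real.exp_le_exp.2
        have hz' : R ≤ sgB i.2 / √(S i.1 i.1) * z i.1 := hz
        nlinarith)
    rw [measure_univ, ENNReal.toReal_one] at h
    rw [le_div_iff₀ (by positivity), mul_comm]
    exact h
  set G := {z : Fin d → ℝ | ∀ j, |z j| ≤ σbar * R} with hG
  have hGm : MeasurableSet G := by
    have : G = ⋂ j, {z | |z j| ≤ σbar * R} := by ext z; simp [hG]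
    rw [this]
    exact MeasurableSet.iInter fun j => measurableSet_le (by fun_prop) measurable_const
  have hc : Gᶜ ⊆ ⋃ i ∈ (Finset.univ : Finset (Fin d × Bool)), H i := by
    intro z hz
    simp only [hG, Set.mem_compl_iff, Set.mem_ofPred_eq, not_forall, not_le] at hz
    obtain ⟨j, hj⟩ := hz
    have hsj : √(S j j) ≤ σbar := Real.sqrt_le_iff.2 ⟨hσ.le, hup j⟩
    have hp : 0 < √(S j j) := Real.sqrt_pos.2 hS.diag_pos
    have h1 : R * √(S j j) ≤ |z j| := by nlinarith
    simp only [Set.mem_iUnion, Finset.mem_univ, exists_true_left]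
    rcases abs_cases (z j) with ⟨h, _⟩ | ⟨h, _⟩
    · refine ⟨(j, true), ?_⟩
      simp only [hH, sgB, Set.mem_ofPred_eq, if_true]
      rw [div_mul_eq_mul_div, le_div_iff₀ hp]; linarith
    · refine ⟨(j, false), ?_⟩
      simp only [hH, sgB, Set.mem_ofPred_eq, Bool.false_eq_true, if_false]
      rw [div_mul_eq_mul_div, le_div_iff₀ hp]; linarith
  have h2 : (gaussianMeasure d S).real Gᶜ ≤ 1 / 4 := by
    calc _ ≤ (gaussianMeasure d S).real (⋃ i ∈ (Finset.univ : Finset (Fin d × Bool)), H i) :=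
          measureReal_mono hc (measure_ne_top _ _)
      _ ≤ ∑ i : Fin d × Bool, (gaussianMeasure d S).real (H i) := measureReal_biUnion_finset_le _ _
      _ ≤ ∑ i : Fin d × Bool, 1 / (8 * (d : ℝ)) := Finset.sum_le_sum fun i _ => hone i
      _ = 1 / 4 := by
          simp
          field_simp
          norm_num
  rw [probReal_compl_eq_one_sub hGm] at h2
  linarith

lemma int_lower {E : Type*} [MeasurableSpace E] (γ : Measure E) [IsProbabilityMeasure γ]
    (g : E → ℝ) (hg : Integrable g γ) (G : Set E) (hG : MeasurableSet G) (hp : 3 / 4 ≤ γ.real G)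
    (m δ : ℝ) (h1 : ∀ z, -δ ≤ g z) (h2 : ∀ z ∈ G, m ≤ g z) :
    3 / 4 * m - δ / 4 ≤ ∫ z, g z ∂γ := by
  by_cases hm : m + δ < 0
  · have : ∫ _z, -δ ∂γ ≤ ∫ z, g z ∂γ := integral_mono (integrable_const _) hg h1
    simp at this
    linarith
  · have hi : Integrable (fun z => G.indicator (fun _ => m + δ) z) γ :=
      (integrable_const _).indicator hG
    have : ∫ z, (-δ + G.indicator (fun _ => m + δ) z) ∂γ ≤ ∫ z, g z ∂γ := by
      refine integral_mono ((integrable_const _).add hi) hg ?_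
      intro z
      by_cases hz : z ∈ G
      · simp only [Set.indicator_of_mem hz]; linarith [h2 z hz]
      · simp only [Set.indicator_of_notMem hz]; linarith [h1 z]
    rw [integral_add (integrable_const _) hi, integral_indicator_const _ hG] at this
    simp at this
    push Not at hm
    nlinarith

lemma OU_eq (d : ℕ) (S : Matrix (Fin d) (Fin d) ℝ) (hS : S.PosDef) (B : Set (Fin d → ℝ))
    (hB : MeasurableSet B) (t : ℝ) (x : Fin d → ℝ) :
    OUsemigroup d S B t x = (gaussianMeasure d S).real
      {z | Real.exp (-t) • x + √(1 - Real.exp (-2 * t)) • z ∈ B} - (gaussianMeasure d S).real B := by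
  have := gm_prob d S hS
  unfold OUsemigroup
  have hm : MeasurableSet {z | Real.exp (-t) • x + √(1 - Real.exp (-2 * t)) • z ∈ B} :=
    (by fun_prop : Measurable fun z : Fin d → ℝ =>
      Real.exp (-t) • x + √(1 - Real.exp (-2 * t)) • z) hB
  have e : (fun z => Set.indicator B (fun _ => (1 : ℝ))
      (Real.exp (-t) • x + Real.sqrt (1 - Real.exp (-2 * t)) • z)) =
      Set.indicator {z | Real.exp (-t) • x + √(1 - Real.exp (-2 * t)) • z ∈ B} (fun _ => (1:ℝ)) := by
    ext z; rfl
  rw [integral_sub, e, integral_indicator_const _ hm]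
  · simp [Measure.real]
  · rw [e]; exact (integrable_const _).indicator hm
  · exact integrable_const _

lemma sec_integrable {d : ℕ} (μ γ : Measure (Fin d → ℝ)) [IsProbabilityMeasure μ]
    [IsProbabilityMeasure γ] (B : Set (Fin d → ℝ)) (hB : MeasurableSet B) (c s : ℝ) :
    Integrable (fun z => μ.real {w | c • w + s • z ∈ B}) γ := by
  have hm : MeasurableSet {p : (Fin d → ℝ) × (Fin d → ℝ) | c • p.1 + s • p.2 ∈ B} :=
    (by fun_prop : Measurable fun p : (Fin d → ℝ) × (Fin d → ℝ) => c • p.1 + s • p.2) hB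
  have hM : Measurable (fun z => μ.real {w | c • w + s • z ∈ B}) :=
    (measurable_measure_prodMk_right (μ := μ) hm).ennreal_toReal
  refine Integrable.of_bound hM.aestronglyMeasurable 1 (Filter.Eventually.of_forall fun z => ?_)
  rw [Real.norm_of_nonneg measureReal_nonneg]
  exact measureReal_le_one

lemma sec_swap {d : ℕ} (μ γ : Measure (Fin d → ℝ)) [IsProbabilityMeasure μ]
    [IsProbabilityMeasure γ] (B : Set (Fin d → ℝ)) (hB : MeasurableSet B) (c s : ℝ) :
    ∫ x, γ.real {z | c • x + s • z ∈ B} ∂μ = ∫ z, μ.real {w | c • w + s • z ∈ B} ∂γ := by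
  have hm : MeasurableSet {p : (Fin d → ℝ) × (Fin d → ℝ) | c • p.1 + s • p.2 ∈ B} :=
    (by fun_prop : Measurable fun p : (Fin d → ℝ) × (Fin d → ℝ) => c • p.1 + s • p.2) hB
  have h1 := Measure.prod_apply (μ := μ) (ν := γ) hm
  have h2 := Measure.prod_apply_symm (μ := μ) (ν := γ) hm
  unfold Measure.real
  rw [integral_toReal, integral_toReal]
  · congr 1
    exact h1.symm.trans h2
  · exact (measurable_measure_prodMk_right (μ := μ) hm).aemeasurable
  · exact Filter.Eventually.of_forall fun z => measure_lt_top _ _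
  · exact (measurable_measure_prodMk_left (ν := γ) hm).aemeasurable
  · exact Filter.Eventually.of_forall fun z => measure_lt_top _ _

lemma OU_int (d : ℕ) (S : Matrix (Fin d) (Fin d) ℝ) (hS : S.PosDef) (B : Set (Fin d → ℝ))
    (hB : MeasurableSet B) (t : ℝ) (ht : 0 < t) {Ω : Type} [MeasurableSpace Ω] (P : Measure Ω)
    [IsProbabilityMeasure P] (W : Ω → Fin d → ℝ) (hW : Measurable W) :
    ∫ ω, OUsemigroup d S B t (W ω) ∂P = ∫ z, ((P.map W).real
      {w | Real.exp (-t) • w + √(1 - Real.exp (-2 * t)) • z ∈ B} - (gaussianMeasure d S).real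
      {w | Real.exp (-t) • w + √(1 - Real.exp (-2 * t)) • z ∈ B}) ∂(gaussianMeasure d S) := by
  have := gm_prob d S hS
  have hPW : IsProbabilityMeasure (P.map W) := Measure.isProbabilityMeasure_map hW.aemeasurable
  set c := Real.exp (-t) with hc
  set s := √(1 - Real.exp (-2 * t)) with hs
  have hm : MeasurableSet {p : (Fin d → ℝ) × (Fin d → ℝ) | c • p.1 + s • p.2 ∈ B} :=
    (by fun_prop : Measurable fun p : (Fin d → ℝ) × (Fin d → ℝ) => c • p.1 + s • p.2) hB
  have hle : Real.exp (-2 * t) ≤ 1 := by rw [Real.exp_le_one_iff]; linarith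
  have hcs : c ^ 2 + s ^ 2 = 1 := by
    rw [hs, Real.sq_sqrt (by linarith), hc, ← Real.exp_nat_mul]
    have : ((2:ℕ):ℝ) * -t = -2 * t := by push_cast; ring
    rw [this]; ring
  have hM : Measurable (fun x => (gaussianMeasure d S).real {z | c • x + s • z ∈ B}) :=
    (measurable_measure_prodMk_left (ν := gaussianMeasure d S) hm).ennreal_toReal
  have hMi : Integrable (fun x => (gaussianMeasure d S).real {z | c • x + s • z ∈ B}) (P.map W) := by
    refine Integrable.of_bound hM.aestronglyMeasurable 1 (Filter.Eventually.of_forall fun z => ?_)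
    rw [Real.norm_of_nonneg measureReal_nonneg]
    exact measureReal_le_one
  have hinv : ∫ z, (gaussianMeasure d S).real {w | c • w + s • z ∈ B} ∂(gaussianMeasure d S)
      = (gaussianMeasure d S).real B := by
    have h := gm_invariant d S hS c s (Real.exp_pos _) hcs B hB
    unfold Measure.real
    rw [integral_toReal, h]
    · exact (measurable_measure_prodMk_right (μ := gaussianMeasure d S) hm).aemeasurable
    · exact Filter.Eventually.of_forall fun z => measure_lt_top _ _
  rw [integral_sub (sec_integrable _ _ B hB c s) (sec_integrable _ _ B hB c s), hinv,
    ← sec_swap _ _ B hB c s]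
  simp_rw [OU_eq d S hS B hB]
  have hMi2 : Integrable (fun ω => (gaussianMeasure d S).real {z | c • W ω + s • z ∈ B}) P :=
    hMi.comp_measurable hW
  rw [integral_sub hMi2 (integrable_const _), integral_map hW.aemeasurable hM.aestronglyMeasurable]
  simp [hc, hs]

lemma kappa_bound (d : ℕ) (hd : 3 ≤ d) (σbar σlow : ℝ) (hσb : 0 < σbar) (hσl : 0 < σlow) (t : ℝ)
    (ht : 0 < t) :
    100 * ((2 * Real.exp t * √(1 - Real.exp (-2 * t)) * (σbar * √(2 * Real.log (8 * d)))) / σlow *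
      √(2 * Real.log (2 * d))) ≤ 2400 * ((σbar / σlow) * Real.exp t * √t * Real.log d) := by
  have hdr : (3 : ℝ) ≤ d := by exact_mod_cast hd
  have hl0 : 0 ≤ Real.log d := Real.log_nonneg (by linarith)
  have h1 : √(1 - Real.exp (-2 * t)) ≤ 2 * √t := by
    rw [Real.sqrt_le_left (by positivity), mul_pow, Real.sq_sqrt ht.le]
    have := Real.add_one_le_exp (-2 * t)
    linarith
  have h2 : √(2 * Real.log (8 * d)) ≤ 3 * √(Real.log d) := by
    rw [Real.sqrt_le_left (by positivity), mul_pow, Real.sq_sqrt hl0]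
    have : Real.log (8 * d) ≤ 3 * Real.log d := by
      have : 3 * Real.log d = Real.log ((d : ℝ) ^ 3) := by rw [Real.log_pow]; norm_num
      rw [this]
      apply Real.log_le_log (by positivity)
      have : (8 : ℝ) ≤ d ^ 2 := by nlinarith
      nlinarith
    linarith
  have h3 : √(2 * Real.log (2 * d)) ≤ 2 * √(Real.log d) := by
    rw [Real.sqrt_le_left (by positivity), mul_pow, Real.sq_sqrt hl0]
    have : Real.log (2 * d) ≤ 2 * Real.log d := by
      have : 2 * Real.log d = Real.log ((d : ℝ) ^ 2) := by rw [Real.log_pow]; norm_num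
      rw [this]
      apply Real.log_le_log (by positivity)
      nlinarith
    linarith
  have hsq : √(Real.log d) * √(Real.log d) = Real.log d := Real.mul_self_sqrt hl0
  calc _ ≤ 100 * ((2 * Real.exp t * (2 * √t) * (σbar * (3 * √(Real.log d)))) / σlow *
      (2 * √(Real.log d))) := by gcongr
    _ = 2400 * ((σbar / σlow) * Real.exp t * √t * (√(Real.log d) * √(Real.log d))) := by ring
    _ = _ := by rw [hsq]

lemma main_aux (d : ℕ) (hd : 3 ≤ d) (S : Matrix (Fin d) (Fin d) ℝ) (hS : S.PosDef)
    (σbar σlow : ℝ) (hσb : 0 < σbar) (hσl : 0 < σlow)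
    (hgr : IsGreatest (Set.range fun j => S j j) (σbar ^ 2))
    (hle : IsLeast (Set.range fun j => S j j) (σlow ^ 2))
    {Ω : Type} [MeasurableSpace Ω] (P : Measure Ω) [IsProbabilityMeasure P]
    (W : Ω → Fin d → ℝ) (hW : Measurable W) (t : ℝ) (ht : 0 < t)
    (A : Set (Fin d → ℝ)) (hA : IsHyperrectangle A) :
    |(P (W ⁻¹' A)).toReal - (gaussianMeasure d S A).toReal| ≤
          4800 * ((⨆ B : {B : Set (Fin d → ℝ) // IsHyperrectangle B},
              |∫ ω, OUsemigroup d S B.1 t (W ω) ∂P|) +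
            (σbar / σlow) * Real.exp t * Real.sqrt t * Real.log d) := by
  have hγp := gm_prob d S hS
  have hPW : IsProbabilityMeasure (P.map W) := Measure.isProbabilityMeasure_map hW.aemeasurable
  have hdr : (3 : ℝ) ≤ d := by exact_mod_cast hd
  set γ := gaussianMeasure d S with hγ
  set μ := P.map W with hμ
  set c := Real.exp (-t) with hc
  set s := √(1 - Real.exp (-2 * t)) with hs
  set r := σbar * √(2 * Real.log (8 * d)) with hr
  set η := 2 * Real.exp t * s * r with hη
  set κ := 100 * (η / σlow * √(2 * Real.log (2 * d))) with hκ
  have hκb : κ ≤ 2400 * ((σbar / σlow) * Real.exp t * √t * Real.log d) :=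
    kappa_bound d hd σbar σlow hσb hσl t ht
  have hcC : Real.exp t * c = 1 := by rw [hc, ← Real.exp_add]; simp
  have hC : 0 < Real.exp t := Real.exp_pos t
  have hc0 : 0 < c := Real.exp_pos _
  have hs0 : 0 < s := Real.sqrt_pos.2 (by
    have : Real.exp (-2 * t) < 1 := by rw [Real.exp_lt_one_iff]; linarith
    linarith)
  have hr0 : 0 < r := mul_pos hσb (Real.sqrt_pos.2 (by
    have : 0 < Real.log (8 * d) := Real.log_pos (by linarith)
    linarith))
  have hη0 : 0 < η := by positivity
  have hκ0 : 0 ≤ κ := by positivity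
  have hlow : ∀ j, σlow ^ 2 ≤ S j j := fun j => hle.2 ⟨j, rfl⟩
  have hup : ∀ j, S j j ≤ σbar ^ 2 := fun j => hgr.2 ⟨j, rfl⟩
  have hanti := anti_rect d hd S hS σlow hσl hlow
  have hcube := tail_cube d hd S hS σbar hσb hup
  set G := {z : Fin d → ℝ | ∀ j, |z j| ≤ r} with hG
  have hGm : MeasurableSet G := by
    have : G = ⋂ j, {z | |z j| ≤ r} := by ext z; simp [hG]
    rw [this]
    exact MeasurableSet.iInter fun j => measurableSet_le (by fun_prop) measurable_const
  let H := {B : Set (Fin d → ℝ) // IsHyperrectangle B}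
  have hprobdiff : ∀ B, |μ.real B - γ.real B| ≤ 1 := by
    intro B
    rw [abs_le]
    constructor <;> linarith [measureReal_le_one (μ := μ) (s := B), measureReal_le_one (μ := γ) (s := B),
      measureReal_nonneg (μ := μ) (s := B), measureReal_nonneg (μ := γ) (s := B)]
  set δ := ⨆ B : H, |μ.real B.1 - γ.real B.1| with hδ
  have hδb : BddAbove (Set.range fun B : H => |μ.real B.1 - γ.real B.1|) :=
    ⟨1, by rintro _ ⟨B, rfl⟩; exact hprobdiff B.1⟩
  have hδle : ∀ B, IsHyperrectangle B → |μ.real B - γ.real B| ≤ δ := fun B hB =>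
    le_ciSup hδb (⟨B, hB⟩ : H)
  set T := ⨆ B : H, |∫ ω, OUsemigroup d S B.1 t (W ω) ∂P| with hT
  have hTb : BddAbove (Set.range fun B : H => |∫ ω, OUsemigroup d S B.1 t (W ω) ∂P|) := by
    refine ⟨1, ?_⟩
    rintro _ ⟨B, rfl⟩
    have := norm_integral_le_of_norm_le_const (μ := P) (f := fun ω => OUsemigroup d S B.1 t (W ω))
      (C := 1) (Filter.Eventually.of_forall fun ω => by
        rw [OU_eq d S hS B.1 (isHyp_meas B.2), Real.norm_eq_abs, abs_le]
        constructor <;> linarith [measureReal_le_one (μ := γ) (s := B.1),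
          measureReal_nonneg (μ := γ) (s := B.1),
          measureReal_le_one (μ := γ) (s := {z | c • W ω + s • z ∈ B.1}),
          measureReal_nonneg (μ := γ) (s := {z | c • W ω + s • z ∈ B.1})])
    simpa using this
  have hTle : ∀ B, IsHyperrectangle B → |∫ z, (μ.real {w | c • w + s • z ∈ B} -
      γ.real {w | c • w + s • z ∈ B}) ∂γ| ≤ T := by
    intro B hB
    rw [← OU_int d S hS B (isHyp_meas hB) t ht P W hW]
    exact le_ciSup hTb (⟨B, hB⟩ : H)
  have hgi : ∀ B, IsHyperrectangle B → Integrable (fun z => μ.real {w | c • w + s • z ∈ B} -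
      γ.real {w | c • w + s • z ∈ B}) γ := fun B hB =>
    (sec_integrable _ _ B (isHyp_meas hB) c s).sub (sec_integrable _ _ B (isHyp_meas hB) c s)
  -- the key step
  have key : ∀ A, IsHyperrectangle A → 3 / 4 * |μ.real A - γ.real A| ≤ T + κ + δ / 4 := by
    intro A hA
    obtain ⟨a, b, hab⟩ := hA
    -- the family of test rectangles
    let Bρ : ℝ → Set (Fin d → ℝ) := fun ρ =>
      {y | ∀ j, a j < ((Real.exp t * y j + Real.exp t * (s * ρ) : ℝ) : EReal) ∧
        ((Real.exp t * y j + - (Real.exp t * (s * ρ)) : ℝ) : EReal) < b j}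
    have hBρ : ∀ ρ, IsHyperrectangle (Bρ ρ) := fun ρ => isHyp_aff a b _ hC _ _
    have hsec : ∀ ρ z, {w : Fin d → ℝ | c • w + s • z ∈ Bρ ρ} =
        {w | ∀ j, a j < ((1 * w j + Real.exp t * s * (z j + ρ) : ℝ) : EReal) ∧
          ((1 * w j + Real.exp t * s * (z j - ρ) : ℝ) : EReal) < b j} := by
      intro ρ z
      ext w
      simp only [Bρ, Set.mem_ofPred_eq, Pi.add_apply, Pi.smul_apply, smul_eq_mul]
      have e1 : ∀ j, Real.exp t * (c * w j + s * z j) + Real.exp t * (s * ρ)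
          = 1 * w j + Real.exp t * s * (z j + ρ) := fun j => by
        linear_combination w j * hcC
      have e2 : ∀ j, Real.exp t * (c * w j + s * z j) + -(Real.exp t * (s * ρ))
          = 1 * w j + Real.exp t * s * (z j - ρ) := fun j => by
        linear_combination w j * hcC
      simp_rw [e1, e2]
    have hsecH : ∀ ρ z, IsHyperrectangle {w : Fin d → ℝ | c • w + s • z ∈ Bρ ρ} := by
      intro ρ z
      rw [hsec]
      exact isHyp_aff a b 1 one_pos _ _
    have hCs : 0 < Real.exp t * s := by positivity
    have hup1 : 3 / 4 * (μ.real A - γ.real A - κ) - δ / 4 ≤ T := by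
      refine le_trans (int_lower γ _ (hgi (Bρ r) (hBρ r)) G hGm hcube _ δ ?_ ?_)
        ((le_abs_self _).trans (hTle (Bρ r) (hBρ r)))
      · intro z
        exact (abs_le.1 (hδle _ (hsecH r z))).1
      · intro z hz
        have hz' : ∀ j, |z j| ≤ r := hz
        have i1 : A ⊆ {w | c • w + s • z ∈ Bρ r} := by
          rw [hsec, hab]
          intro w hw j
          obtain ⟨h1, h2⟩ := hw j
          have hzj := abs_le.1 (hz' j)
          refine ⟨h1.trans_le (EReal.coe_le_coe_iff.2 ?_), lt_of_le_of_lt (EReal.coe_le_coe_iff.2 ?_) h2⟩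
          · have : 0 ≤ Real.exp t * s * (z j + r) := mul_nonneg hCs.le (by linarith)
            linarith
          · have : Real.exp t * s * (z j - r) ≤ 0 := mul_nonpos_of_nonneg_of_nonpos hCs.le (by linarith)
            linarith
        have i2 : {w | c • w + s • z ∈ Bρ r} ⊆
            A ∪ ({x | ∀ j, a j < ((x j + η : ℝ) : EReal) ∧ ((x j - η : ℝ) : EReal) < b j} \
              {x | ∀ j, a j < (x j : EReal) ∧ (x j : EReal) < b j}) := by
          rw [← hab, Set.union_sdiff_self, hsec]
          intro w hw
          right
          intro j
          obtain ⟨h1, h2⟩ := hw j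
          have hzj := abs_le.1 (hz' j)
          refine ⟨h1.trans_le (EReal.coe_le_coe_iff.2 ?_), lt_of_le_of_lt (EReal.coe_le_coe_iff.2 ?_) h2⟩
          · have : Real.exp t * s * (z j + r) ≤ Real.exp t * s * (2 * r) :=
              mul_le_mul_of_nonneg_left (by linarith) hCs.le
            rw [hη]; linarith
          · have : Real.exp t * s * (-(2 * r)) ≤ Real.exp t * s * (z j - r) :=
              mul_le_mul_of_nonneg_left (by linarith) hCs.le
            rw [hη]; linarith
        have j1 := measureReal_mono (μ := μ) i1 (measure_ne_top _ _)
        have j2 := (measureReal_mono (μ := γ) i2 (measure_ne_top _ _)).trans (measureReal_union_le _ _)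
        have j3 := hanti a b η hη0
        linarith
    have hlo1 : 3 / 4 * (-(μ.real A - γ.real A) - κ) - δ / 4 ≤ T := by
      refine le_trans (int_lower γ _ (hgi (Bρ (-r)) (hBρ (-r))).neg G hGm hcube _ δ ?_ ?_) ?_
      · intro z
        have := (abs_le.1 (hδle _ (hsecH (-r) z))).2
        simp only [Pi.neg_apply]
        linarith
      · intro z hz
        have hz' : ∀ j, |z j| ≤ r := hz
        choose a' ha' using fun j => ereal_aff_lower (a j) 1 (-η) one_pos
        choose b' hb' using fun j => ereal_aff_upper (b j) 1 η one_pos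
        have i1 : {w | c • w + s • z ∈ Bρ (-r)} ⊆ A := by
          rw [hsec, hab]
          intro w hw j
          obtain ⟨h1, h2⟩ := hw j
          have hzj := abs_le.1 (hz' j)
          refine ⟨h1.trans_le (EReal.coe_le_coe_iff.2 ?_), lt_of_le_of_lt (EReal.coe_le_coe_iff.2 ?_) h2⟩
          · have : Real.exp t * s * (z j + -r) ≤ 0 := mul_nonpos_of_nonneg_of_nonpos hCs.le (by linarith)
            linarith
          · have : 0 ≤ Real.exp t * s * (z j - -r) := mul_nonneg hCs.le (by linarith)
            linarith
        have i2 : A ⊆ {w | c • w + s • z ∈ Bρ (-r)} ∪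
            ({x | ∀ j, a' j < ((x j + η : ℝ) : EReal) ∧ ((x j - η : ℝ) : EReal) < b' j} \
              {x | ∀ j, a' j < (x j : EReal) ∧ (x j : EReal) < b' j}) := by
          intro w hw
          rw [hab] at hw
          by_cases hw2 : w ∈ {x : Fin d → ℝ | ∀ j, a' j < (x j : EReal) ∧ (x j : EReal) < b' j}
          · left
            rw [hsec]
            intro j
            obtain ⟨h1, h2⟩ := hw2 j
            rw [← ha'] at h1
            rw [← hb'] at h2
            have hzj := abs_le.1 (hz' j)
            refine ⟨h1.trans_le (EReal.coe_le_coe_iff.2 ?_),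
              lt_of_le_of_lt (EReal.coe_le_coe_iff.2 ?_) h2⟩
            · have : Real.exp t * s * (-(2 * r)) ≤ Real.exp t * s * (z j + -r) :=
                mul_le_mul_of_nonneg_left (by linarith) hCs.le
              rw [hη]; linarith
            · have : Real.exp t * s * (z j - -r) ≤ Real.exp t * s * (2 * r) :=
                mul_le_mul_of_nonneg_left (by linarith) hCs.le
              rw [hη]; linarith
          · right
            refine ⟨?_, hw2⟩
            intro j
            obtain ⟨h1, h2⟩ := hw j
            rw [← ha', ← hb']
            have e1 : 1 * (w j + η) + -η = w j := by ring
            have e2 : 1 * (w j - η) + η = w j := by ring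
            rw [e1, e2]
            exact ⟨h1, h2⟩
        have j1 := measureReal_mono (μ := μ) i1 (measure_ne_top _ _)
        have j2 := (measureReal_mono (μ := γ) i2 (measure_ne_top _ _)).trans (measureReal_union_le _ _)
        have j3 := hanti a' b' η hη0
        simp only [Pi.neg_apply]
        linarith
      · have := hTle (Bρ (-r)) (hBρ (-r))
        simp only [Pi.neg_apply]
        rw [integral_neg]
        exact (neg_le_abs _).trans this
    rcases abs_cases (μ.real A - γ.real A) with ⟨h, _⟩ | ⟨h, _⟩ <;> rw [h] <;> linarith
  have hne : Nonempty H := ⟨⟨A, hA⟩⟩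
  have hδ2 : δ ≤ 4 / 3 * (T + κ + δ / 4) :=
    ciSup_le fun B => by have := key B.1 B.2; linarith
  have hT0 : 0 ≤ T := (abs_nonneg _).trans (hTle A hA)
  have hfin := hδle A hA
  have hPA : (P (W ⁻¹' A)).toReal = μ.real A := by
    rw [hμ, Measure.real, Measure.map_apply hW (isHyp_meas hA)]
  rw [hPA]
  change |μ.real A - γ.real A| ≤ _
  linarith

/-- **The basic smoothing estimate: reduction to the Stein-equation term.** -/
theorem rectangle_distance_le_semigroup_term :
    ∃ C : ℝ, 0 < C ∧
      ∀ (d : ℕ), 3 ≤ d →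
      ∀ S : Matrix (Fin d) (Fin d) ℝ, S.PosDef →
      ∀ σbar σlow : ℝ, 0 < σbar → 0 < σlow →
        IsGreatest (Set.range fun j => S j j) (σbar ^ 2) →
        IsLeast (Set.range fun j => S j j) (σlow ^ 2) →
      ∀ (Ω : Type) (_ : MeasurableSpace Ω) (P : Measure Ω) (_ : IsProbabilityMeasure P)
        (W : Ω → Fin d → ℝ), Measurable W →
      ∀ t : ℝ, 0 < t →
      ∀ A : Set (Fin d → ℝ), IsHyperrectangle A →
        |(P (W ⁻¹' A)).toReal - (gaussianMeasure d S A).toReal| ≤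
          C * ((⨆ B : {B : Set (Fin d → ℝ) // IsHyperrectangle B},
              |∫ ω, OUsemigroup d S B.1 t (W ω) ∂P|) +
            (σbar / σlow) * Real.exp t * Real.sqrt t * Real.log d) := by
  refine ⟨4800, by norm_num, ?_⟩
  intro d hd S hS σbar σlow hσb hσl hgr hle Ω mΩ P hP W hW t ht A hA
  exact main_aux d hd S hS σbar σlow hσb hσl hgr hle P W hW t ht A hA
end
end
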